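/- arXiv:1211.6974 — 5 statements merged into one kernel-verified Lean document; each statement's English description precedes it below -/
import Mathlib

section
/- Let G = (V,E) be a finite graph with conductances c : E → ℝ_{>0}, let α assign a positive weight α(γ) to every simple cycle γ of G, and let μ = μ_{c,α} be the probability measure giving a CRSF Γ probability proportional to Π_{e∈Γ} c(e) · Π_{cycles γ⊆Γ} α(γ). Let {γ_1,…,γ_k} be pairwise vertex-disjoint simple cycles of G and let G_1,…,G_r be subgraphs of G with distinguished boundary vertex sets ∂G_1,…,∂G_r contained in the vertices of γ_1 ∪ … ∪ γ_k, such that the map Γ ↦ (Γ_1,…,Γ_r) sending a CRSF to its restrictions to the G_i is a bijection between the set of CRSFs of G containing all the γ_j and the set of tuples (Γ_1,…,Γ_r) where each Γ_i is an essential CRSF of G_i with Dirichlet boundary ∂G_i (every such tuple together with the γ_j forming a CRSF of G). Then, conditionally on the event that the random CRSF contains γ_1 ∪ … ∪ γ_k, the restrictions Γ_1,…,Γ_r are independent, and each Γ_i is distributed according to the essential CRSF measure on G_i with Dirichlet boundary ∂G_i which gives Γ_i probability proportional to Π_{e∈Γ_i} c(e) · Π_{cycles η⊆Γ_i} α(η).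 -/
/-!
STATEMENT 6 (spatial Markov property).  Conditionally on the event that the
`μ_{c,α}`-random CRSF contains the pairwise disjoint simple cycles `γ_1,…,γ_k`, the
restrictions `Γ_i = Γ ∩ E_i` to the pieces `G_i` are independent essential CRSFs with
Dirichlet boundary `∂G_i`, each distributed proportionally to
`Π_{e∈Γ_i} c(e) · Π_{cycles η⊆Γ_i} α(η)`.
-/

open Classical

noncomputable section

namespace CRSFStmt

variable {V : Type*} [Fintype V] [DecidableEq V]

/-- `δ` is the edge set of a simple cycle on the vertex set `V`. -/
def IsCycleEdgeSet (δ : Finset (Sym2 V)) : Prop :=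
  ∃ (v : V) (w : (⊤ : SimpleGraph V).Walk v v), w.IsCycle ∧ w.edges.toFinset = δ

/-- The collection of (edge sets of the) cycles contained in `Γ`. -/
def cyclesOf (Γ : Finset (Sym2 V)) : Finset (Finset (Sym2 V)) :=
  Γ.powerset.filter IsCycleEdgeSet

/-- `Γ` is (the edge set of) a cycle-rooted spanning forest of `G`. -/
def IsCRSF (G : SimpleGraph V) (Γ : Finset (Sym2 V)) : Prop :=
  ↑Γ ⊆ G.edgeSet ∧
    ∀ C : (SimpleGraph.fromEdgeSet (↑Γ : Set (Sym2 V))).ConnectedComponent,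
      (Γ.filter fun e => ∀ v ∈ e, v ∈ C.supp).card = C.supp.toFinite.toFinset.card

/-- `Γ` is an essential CRSF of the graph with edge set `E`, vertex set `W` and
Dirichlet boundary `S`: every component (of the subgraph spanned by `Γ` inside `W`)
is either a unicyclic graph disjoint from `S` or a tree containing exactly one vertex
of `S`. -/
def IsEssentialCRSFOn (E : Finset (Sym2 V)) (W S : Finset V) (Γ : Finset (Sym2 V)) :
    Prop :=
  Γ ⊆ E ∧ (∀ e ∈ Γ, ∀ v ∈ e, v ∈ W) ∧
    ∀ C : (SimpleGraph.fromEdgeSet (↑Γ : Set (Sym2 V))).ConnectedComponent,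
      (C.supp ∩ ↑W).Nonempty →
        ((Γ.filter fun e => ∀ v ∈ e, v ∈ C.supp).card = C.supp.toFinite.toFinset.card ∧
            C.supp.toFinite.toFinset ∩ S = ∅) ∨
        ((Γ.filter fun e => ∀ v ∈ e, v ∈ C.supp).card + 1 =
              C.supp.toFinite.toFinset.card ∧
            (C.supp.toFinite.toFinset ∩ S).card = 1)

/-- The conductance as a function of unoriented edges. -/
def edgeC (c : V → V → ℝ) (hc : ∀ v w, c v w = c w v) : Sym2 V → ℝ :=
  Sym2.lift ⟨c, hc⟩

/-- The `μ_{c,α}`-weight of a configuration `Γ`: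
`Π_{e∈Γ} c(e) · Π_{cycles η ⊆ Γ} α(η)`. -/
def wt (c : V → V → ℝ) (hc : ∀ v w, c v w = c w v) (α : Finset (Sym2 V) → ℝ)
    (Γ : Finset (Sym2 V)) : ℝ :=
  (∏ e ∈ Γ, edgeC c hc e) * ∏ δ ∈ cyclesOf Γ, α δ

lemma aux_count (Γ : Finset (Sym2 V)) (hΓ : ∀ e ∈ Γ, ¬ e.IsDiag)
    (C : (SimpleGraph.fromEdgeSet (↑Γ : Set (Sym2 V))).ConnectedComponent) :
    Nat.card C.toSimpleGraph.edgeSet = (Γ.filter fun e => ∀ v ∈ e, v ∈ C.supp).card := by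
  have h1 : (Sym2.map (Subtype.val : C → V)) '' C.toSimpleGraph.edgeSet
      = ↑(Γ.filter fun e => ∀ v ∈ e, v ∈ C.supp) := by
    ext e
    constructor
    · rintro ⟨f, hf, rfl⟩
      induction f with
      | h a b =>
        obtain ⟨a, ha⟩ := a
        obtain ⟨b, hb⟩ := b
        rw [SimpleGraph.mem_edgeSet, SimpleGraph.ConnectedComponent.toSimpleGraph_adj,
          SimpleGraph.fromEdgeSet_adj] at hf
        simp only [Sym2.map_mk, Finset.coe_filter, Set.mem_ofPred_eq]
        refine ⟨hf.1, ?_⟩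
        intro v hv
        rcases Sym2.mem_iff.1 hv with rfl | rfl
        · exact ha
        · exact hb
    · intro he
      rw [Finset.coe_filter] at he
      obtain ⟨he, hm⟩ := he
      induction e with
      | h a b =>
        have ha := hm a (by simp)
        have hb := hm b (by simp)
        refine ⟨s(⟨a, ha⟩, ⟨b, hb⟩), ?_, by simp⟩
        rw [SimpleGraph.mem_edgeSet, SimpleGraph.ConnectedComponent.toSimpleGraph_adj,
          SimpleGraph.fromEdgeSet_adj]
        exact ⟨he, fun h => hΓ _ he (by simpa using h)⟩
  have h2 := Set.ncard_image_of_injective C.toSimpleGraph.edgeSet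
    (Sym2.map.injective (Subtype.val_injective : Function.Injective (Subtype.val : C → V)))
  rw [h1, Set.ncard_coe_finset] at h2
  rw [h2]
  exact Nat.card_coe_set_eq _

lemma aux_cardsupp {H : SimpleGraph V} (C : H.ConnectedComponent) :
    Nat.card C = C.supp.toFinite.toFinset.card := by
  rw [← Set.ncard_eq_toFinset_card]
  exact Nat.card_coe_set_eq _

lemma aux_conn (Γ : Finset (Sym2 V)) (hΓ : ∀ e ∈ Γ, ¬ e.IsDiag)
    (C : (SimpleGraph.fromEdgeSet (↑Γ : Set (Sym2 V))).ConnectedComponent) :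
    C.supp.toFinite.toFinset.card ≤ (Γ.filter fun e => ∀ v ∈ e, v ∈ C.supp).card + 1 := by
  rw [← aux_count Γ hΓ C, ← aux_cardsupp]
  exact C.connected_toSimpleGraph.card_vert_le_card_edgeSet_add_one

lemma aux_exists_cycle (Γ : Finset (Sym2 V)) (hΓ : ∀ e ∈ Γ, ¬ e.IsDiag)
    (C : (SimpleGraph.fromEdgeSet (↑Γ : Set (Sym2 V))).ConnectedComponent)
    (hC : (Γ.filter fun e => ∀ v ∈ e, v ∈ C.supp).card = C.supp.toFinite.toFinset.card) :
    ∃ δ, IsCycleEdgeSet δ ∧ δ ⊆ Γ ∧ ∃ e ∈ δ, ∃ v ∈ e, v ∈ C.supp := by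
  rw [← aux_count Γ hΓ C, ← aux_cardsupp] at hC
  have h : ¬ C.toSimpleGraph.IsAcyclic := by
    intro hac
    have ht : C.toSimpleGraph.IsTree := ⟨C.connected_toSimpleGraph, hac⟩
    have := (SimpleGraph.isTree_iff_connected_and_card.1 ht).2
    omega
  simp only [SimpleGraph.IsAcyclic, not_forall, not_not] at h
  obtain ⟨v, w, hw⟩ := h
  have hinj : Function.Injective C.toSimpleGraph_hom := by
    intro a b hab
    exact Subtype.val_injective hab
  have hw1 := hw.map hinj
  have hw2 := hw1.mapLe (le_top)
  refine ⟨_, ⟨_, _, hw2, rfl⟩, ?_, ?_⟩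
  · intro e he
    rw [List.mem_toFinset, SimpleGraph.Walk.edges_mapLe_eq_edges] at he
    have := SimpleGraph.Walk.edges_subset_edgeSet _ he
    rw [SimpleGraph.edgeSet_fromEdgeSet] at this
    exact this.1
  · have hn := hw2.not_nil
    refine ⟨_, List.mem_toFinset.2 (SimpleGraph.Walk.mk_start_snd_mem_edges hn), _, Sym2.mem_mk_left _ _, v.2⟩

lemma aux_cycle_walk (Γ δ : Finset (Sym2 V)) (hδ : IsCycleEdgeSet δ) (hs : δ ⊆ Γ) :
    ∃ (v : V) (w : (SimpleGraph.fromEdgeSet (↑Γ : Set (Sym2 V))).Walk v v),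
      w.IsCycle ∧ w.edges.toFinset = δ := by
  obtain ⟨v, w, hw, rfl⟩ := hδ
  have hq : ∀ e ∈ w.edges, e ∈ (SimpleGraph.fromEdgeSet (↑Γ : Set (Sym2 V))).edgeSet := by
    intro e he
    rw [SimpleGraph.edgeSet_fromEdgeSet]
    exact ⟨hs (List.mem_toFinset.2 he), SimpleGraph.not_isDiag_of_mem_edgeSet _
      (w.edges_subset_edgeSet he)⟩
  exact ⟨v, w.transfer _ hq, hw.transfer hq, by rw [SimpleGraph.Walk.edges_transfer]⟩

lemma aux_nonempty (δ : Finset (Sym2 V)) (hδ : IsCycleEdgeSet δ) : δ.Nonempty := by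
  obtain ⟨v, w, hw, rfl⟩ := hδ
  exact ⟨_, List.mem_toFinset.2 (SimpleGraph.Walk.mk_start_snd_mem_edges hw.not_nil)⟩

lemma aux_reach_in (Γ δ : Finset (Sym2 V)) (hδ : IsCycleEdgeSet δ) (hs : δ ⊆ Γ)
    (e f : Sym2 V) (he : e ∈ δ) (hf : f ∈ δ) (u v : V) (hu : u ∈ e) (hv : v ∈ f) :
    (SimpleGraph.fromEdgeSet (↑Γ : Set (Sym2 V))).Reachable u v := by
  obtain ⟨x, w, hw, rfl⟩ := aux_cycle_walk Γ δ hδ hs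
  rw [List.mem_toFinset] at he hf
  have h1 := SimpleGraph.Walk.mem_support_of_mem_edges he hu
  have h2 := SimpleGraph.Walk.mem_support_of_mem_edges hf hv
  exact (w.takeUntil u h1).reachable.symm.trans (w.takeUntil v h2).reachable

lemma aux_reach_erase (Γ δ : Finset (Sym2 V)) (hδ : IsCycleEdgeSet δ) (hs : δ ⊆ Γ)
    (e : Sym2 V) (he : e ∈ δ) (u v : V)
    (h : (SimpleGraph.fromEdgeSet (↑Γ : Set (Sym2 V))).Reachable u v) :
    (SimpleGraph.fromEdgeSet (↑(Γ.erase e) : Set (Sym2 V))).Reachable u v := by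
  obtain ⟨x, w, hw, rfl⟩ := aux_cycle_walk Γ δ hδ hs
  rw [List.mem_toFinset] at he
  have hb : ¬ (SimpleGraph.fromEdgeSet (↑Γ : Set (Sym2 V))).IsBridge e :=
    fun hb => hb.notMem_edges_of_isCycle hw he
  have hle : (SimpleGraph.fromEdgeSet (↑Γ : Set (Sym2 V))).deleteEdges {e} ≤
      SimpleGraph.fromEdgeSet (↑(Γ.erase e) : Set (Sym2 V)) := by
    intro a b hab
    rw [SimpleGraph.deleteEdges_adj, SimpleGraph.fromEdgeSet_adj] at hab
    rw [SimpleGraph.fromEdgeSet_adj]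
    refine ⟨?_, hab.1.2⟩
    simp only [Finset.coe_erase]
    exact ⟨hab.1.1, hab.2⟩
  obtain ⟨p⟩ := h
  induction p with
  | nil => exact SimpleGraph.Reachable.refl _
  | @cons a b c hab p ih =>
    refine SimpleGraph.Reachable.trans ?_ ih
    by_cases heq : s(a, b) = e
    · subst heq
      rw [SimpleGraph.isBridge_iff, not_not] at hb
      exact hb.mono hle
    · apply SimpleGraph.Adj.reachable
      apply hle
      rw [SimpleGraph.deleteEdges_adj]
      exact ⟨hab, heq⟩

lemma aux_unique_sub (G : SimpleGraph V) (Γ δ₁ δ₂ : Finset (Sym2 V)) (hΓ : IsCRSF G Γ)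
    (h1 : IsCycleEdgeSet δ₁) (h2 : IsCycleEdgeSet δ₂) (hs1 : δ₁ ⊆ Γ) (hs2 : δ₂ ⊆ Γ)
    (e f : Sym2 V) (he : e ∈ δ₁) (hf : f ∈ δ₂) (u v : V) (hu : u ∈ e) (hv : v ∈ f)
    (huv : (SimpleGraph.fromEdgeSet (↑Γ : Set (Sym2 V))).Reachable u v) : δ₁ ⊆ δ₂ := by
  intro a ha
  by_contra hna
  have hd : ∀ e ∈ Γ, ¬ e.IsDiag := fun e he =>
    SimpleGraph.not_isDiag_of_mem_edgeSet _ (hΓ.1 he)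
  have hs2' : δ₂ ⊆ Γ.erase a := fun x hx =>
    Finset.mem_erase.2 ⟨fun h => hna (h ▸ hx), hs2 hx⟩
  have hR : ∀ x y, (SimpleGraph.fromEdgeSet (↑Γ : Set (Sym2 V))).Reachable x y →
      (SimpleGraph.fromEdgeSet (↑((Γ.erase a).erase f) : Set (Sym2 V))).Reachable x y :=
    fun x y h => aux_reach_erase _ δ₂ h2 hs2' f hf x y (aux_reach_erase Γ δ₁ h1 hs1 a ha x y h)
  have hR' : ∀ x y, (SimpleGraph.fromEdgeSet
      (↑((Γ.erase a).erase f) : Set (Sym2 V))).Reachable x y →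
      (SimpleGraph.fromEdgeSet (↑Γ : Set (Sym2 V))).Reachable x y := by
    intro x y h
    refine h.mono (SimpleGraph.fromEdgeSet_mono ?_)
    exact_mod_cast (Finset.erase_subset _ _).trans (Finset.erase_subset _ _)
  have key := aux_conn ((Γ.erase a).erase f)
    (fun e he => hd e (Finset.mem_of_mem_erase (Finset.mem_of_mem_erase he)))
    (SimpleGraph.connectedComponentMk _ u)
  have hC := hΓ.2 (SimpleGraph.connectedComponentMk _ u)
  have hsupp : (SimpleGraph.connectedComponentMk (SimpleGraph.fromEdgeSet
      (↑((Γ.erase a).erase f) : Set (Sym2 V))) u).supp =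
      (SimpleGraph.connectedComponentMk (SimpleGraph.fromEdgeSet (↑Γ : Set (Sym2 V))) u).supp := by
    ext x
    simp only [SimpleGraph.ConnectedComponent.mem_supp_iff, SimpleGraph.ConnectedComponent.eq]
    exact ⟨hR' _ _, hR _ _⟩
  simp only [hsupp] at key
  rw [← hC] at key
  have haf : f ≠ a := fun h => hna (h ▸ hf)
  set P : Sym2 V → Prop := fun e => ∀ v ∈ e, v ∈ (SimpleGraph.connectedComponentMk
    (SimpleGraph.fromEdgeSet (↑Γ : Set (Sym2 V))) u).supp with hP
  have hPa : P a := by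
    intro x hx
    rw [SimpleGraph.ConnectedComponent.mem_supp_iff, SimpleGraph.ConnectedComponent.eq]
    exact aux_reach_in Γ δ₁ h1 hs1 a e ha he x u hx hu
  have hPf : P f := by
    intro x hx
    rw [SimpleGraph.ConnectedComponent.mem_supp_iff, SimpleGraph.ConnectedComponent.eq]
    exact (aux_reach_in Γ δ₂ h2 hs2 f f hf hf x v hx hv).trans huv.symm
  have key2 : (Γ.filter P).card ≤ (((Γ.filter P).erase a).erase f).card + 1 := by
    rw [← Finset.filter_erase, ← Finset.filter_erase]
    convert key
  have m1 : a ∈ Γ.filter P := Finset.mem_filter.2 ⟨hs1 ha, hPa⟩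
  have m2 : f ∈ (Γ.filter P).erase a :=
    Finset.mem_erase.2 ⟨haf, Finset.mem_filter.2 ⟨hs2 hf, hPf⟩⟩
  have c1 := Finset.card_erase_add_one m1
  have c2 := Finset.card_erase_add_one m2
  omega

lemma aux_unique (G : SimpleGraph V) (Γ δ₁ δ₂ : Finset (Sym2 V)) (hΓ : IsCRSF G Γ)
    (h1 : IsCycleEdgeSet δ₁) (h2 : IsCycleEdgeSet δ₂) (hs1 : δ₁ ⊆ Γ) (hs2 : δ₂ ⊆ Γ)
    (e f : Sym2 V) (he : e ∈ δ₁) (hf : f ∈ δ₂) (u v : V) (hu : u ∈ e) (hv : v ∈ f)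
    (huv : (SimpleGraph.fromEdgeSet (↑Γ : Set (Sym2 V))).Reachable u v) : δ₁ = δ₂ :=
  Finset.Subset.antisymm
    (aux_unique_sub G Γ δ₁ δ₂ hΓ h1 h2 hs1 hs2 e f he hf u v hu hv huv)
    (aux_unique_sub G Γ δ₂ δ₁ hΓ h2 h1 hs2 hs1 f e hf he v u hv hu huv.symm)

lemma aux_weights {X : Type*} (A B : Finset X) (m : X → ℕ) (f : X → ℝ)
    (h : ∀ x, m x ≠ 1 → (x ∈ A ↔ x ∈ B)) :
    (∏ x ∈ A, f x) * (∏ x ∈ B, f x ^ m x) = (∏ x ∈ B, f x) * ∏ x ∈ A, f x ^ m x := by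
  have hF : A.filter (fun x => ¬ m x = 1) = B.filter (fun x => ¬ m x = 1) := by
    ext x
    simp only [Finset.mem_filter]
    constructor
    · rintro ⟨h1, h2⟩; exact ⟨(h x h2).1 h1, h2⟩
    · rintro ⟨h1, h2⟩; exact ⟨(h x h2).2 h1, h2⟩
  have h1 : ∀ A : Finset X, ∏ x ∈ A.filter (fun x => m x = 1), f x ^ m x =
      ∏ x ∈ A.filter (fun x => m x = 1), f x := by
    intro A
    refine Finset.prod_congr rfl fun x hx => ?_
    rw [(Finset.mem_filter.1 hx).2, pow_one]
  rw [← Finset.prod_filter_mul_prod_filter_not A (fun x => m x = 1) f,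
    ← Finset.prod_filter_mul_prod_filter_not B (fun x => m x = 1) f,
    ← Finset.prod_filter_mul_prod_filter_not A (fun x => m x = 1) (fun x => f x ^ m x),
    ← Finset.prod_filter_mul_prod_filter_not B (fun x => m x = 1) (fun x => f x ^ m x),
    h1, h1, hF]
  ring

lemma aux_swap {X ι : Type*} [Fintype ι] (A : Finset X) (p : ι → X → Prop) (f : X → ℝ) :
    ∏ i, ∏ x ∈ A.filter (p i), f x =
      ∏ x ∈ A, f x ^ (Finset.univ.filter fun i => p i x).card := by
  simp_rw [Finset.prod_filter]
  rw [Finset.prod_comm]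
  refine Finset.prod_congr rfl fun x _ => ?_
  rw [← Finset.prod_filter, Finset.prod_const]

lemma edgeC_pos (G : SimpleGraph V) (c : V → V → ℝ) (hc : ∀ v w, c v w = c w v)
    (hc_pos : ∀ v w, G.Adj v w → 0 < c v w) (e : Sym2 V) (he : e ∈ G.edgeSet) :
    0 < edgeC c hc e := by
  induction e with
  | h a b => exact hc_pos a b he

lemma aux_cyclesOf_inter (Γ E : Finset (Sym2 V)) :
    cyclesOf (Γ ∩ E) = (cyclesOf Γ).filter (fun δ => δ ⊆ E) := by
  ext δ
  simp only [cyclesOf, Finset.mem_filter, Finset.mem_powerset, Finset.subset_inter_iff]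
  tauto

lemma aux_wt_pos (G : SimpleGraph V) (c : V → V → ℝ) (α : Finset (Sym2 V) → ℝ)
    (hc : ∀ v w, c v w = c w v)
    (hc_pos : ∀ v w, G.Adj v w → 0 < c v w)
    (hα_pos : ∀ δ : Finset (Sym2 V), IsCycleEdgeSet δ → ↑δ ⊆ G.edgeSet → 0 < α δ)
    (Γ : Finset (Sym2 V)) (hΓ : ↑Γ ⊆ G.edgeSet) : 0 < wt c hc α Γ := by
  unfold wt
  refine mul_pos (Finset.prod_pos fun e he => edgeC_pos G c hc hc_pos e (hΓ he))
    (Finset.prod_pos fun δ hδ => ?_)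
  simp only [cyclesOf, Finset.mem_filter, Finset.mem_powerset] at hδ
  exact hα_pos δ hδ.2 (fun x hx => hΓ (hδ.1 hx))

lemma aux_prod_wt (c : V → V → ℝ) (α : Finset (Sym2 V) → ℝ)
    (hc : ∀ v w, c v w = c w v) {r : ℕ} (E : Fin r → Finset (Sym2 V)) (Γ : Finset (Sym2 V)) :
    ∏ i, wt c hc α (Γ ∩ E i) =
      (∏ e ∈ Γ, edgeC c hc e ^ (Finset.univ.filter fun i => e ∈ E i).card) *
      ∏ δ ∈ cyclesOf Γ, α δ ^ (Finset.univ.filter fun i => δ ⊆ E i).card := by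
  unfold wt
  rw [Finset.prod_mul_distrib]
  have s1 := aux_swap Γ (fun i e => e ∈ E i) (edgeC c hc)
  have s2 := aux_swap (cyclesOf Γ) (fun i δ => δ ⊆ E i) α
  congr 1
  · refine Eq.trans ?_ (s1.trans ?_)
    · refine Finset.prod_congr rfl fun i _ => Finset.prod_congr ?_ fun _ _ => rfl
      ext x
      simp
    · refine Finset.prod_congr rfl fun x _ => ?_
      congr!
  · refine Eq.trans ?_ (s2.trans ?_)
    · refine Finset.prod_congr rfl fun i _ => ?_
      rw [aux_cyclesOf_inter]
      congr!
    · refine Finset.prod_congr rfl fun x _ => ?_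
      congr!

lemma aux_cycle_cover (G : SimpleGraph V)
    (k r : ℕ) (γ : Fin k → Finset (Sym2 V))
    (E : Fin r → Finset (Sym2 V)) (W S : Fin r → Finset V)
    (hγ : ∀ j, IsCycleEdgeSet (γ j) ∧ ↑(γ j) ⊆ G.edgeSet)
    (hEW : ∀ i, ∀ e ∈ E i, ∀ v ∈ e, v ∈ W i)
    (hSγ : ∀ i, ∀ v ∈ S i, ∃ j, ∃ e ∈ γ j, v ∈ e)
    (Γ : Finset (Sym2 V)) (hΓ : IsCRSF G Γ) (hγΓ : ∀ j, γ j ⊆ Γ)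
    (hess : ∀ i, IsEssentialCRSFOn (E i) (W i) (S i) (Γ ∩ E i))
    (hdec : Γ = Finset.univ.biUnion γ ∪ Finset.univ.biUnion fun i => Γ ∩ E i)
    (δ : Finset (Sym2 V)) (hδ : IsCycleEdgeSet δ) (hs : δ ⊆ Γ) (hn : ∀ i, ¬ δ ⊆ E i) :
    ∃ j, δ = γ j := by
  obtain ⟨e, he⟩ := aux_nonempty δ hδ
  obtain ⟨u, hu⟩ : ∃ u, u ∈ e := ⟨_, Sym2.out_fst_mem e⟩
  have heΓ := hs he
  rw [hdec] at heΓ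
  simp only [Finset.mem_union, Finset.mem_biUnion, Finset.mem_univ, true_and] at heΓ
  rcases heΓ with ⟨j, hj⟩ | ⟨i, hi⟩
  · exact ⟨j, aux_unique G Γ δ (γ j) hΓ hδ (hγ j).1 hs (hγΓ j) e e he hj u u hu hu
      (SimpleGraph.Reachable.refl _)⟩
  · have hmono : SimpleGraph.fromEdgeSet (↑(Γ ∩ E i) : Set (Sym2 V)) ≤
        SimpleGraph.fromEdgeSet (↑Γ : Set (Sym2 V)) := by
      apply SimpleGraph.fromEdgeSet_mono
      exact_mod_cast Finset.inter_subset_left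
    have huW : u ∈ W i := hEW i e (Finset.mem_inter.1 hi).2 u hu
    rcases (hess i).2.2 (SimpleGraph.connectedComponentMk _ u) ⟨u, rfl, huW⟩ with h | h
    · exfalso
      obtain ⟨δ', h1, h2, f, hf, v, hv, hvC⟩ := aux_exists_cycle (Γ ∩ E i)
        (fun e he => SimpleGraph.not_isDiag_of_mem_edgeSet _ (hΓ.1 (Finset.mem_inter.1 he).1))
        _ (by convert h.1)
      rw [SimpleGraph.ConnectedComponent.mem_supp_iff, SimpleGraph.ConnectedComponent.eq] at hvC
      have := aux_unique G Γ δ δ' hΓ hδ h1 hs (h2.trans Finset.inter_subset_left) e f he hf u v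
        hu hv (hvC.symm.mono hmono)
      subst this
      exact hn i (h2.trans Finset.inter_subset_right)
    · have hne := Finset.card_pos.1 (by rw [h.2]; exact one_pos)
      obtain ⟨v, hv⟩ := hne
      rw [Finset.mem_inter, Set.Finite.mem_toFinset,
        SimpleGraph.ConnectedComponent.mem_supp_iff, SimpleGraph.ConnectedComponent.eq] at hv
      obtain ⟨j, f, hf, hvf⟩ := hSγ i v hv.2
      exact ⟨j, aux_unique G Γ δ (γ j) hΓ hδ (hγ j).1 hs (hγΓ j) e f he hf u v hu hvf
        (hv.1.symm.mono hmono)⟩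

theorem markov_property
    (G : SimpleGraph V) (c : V → V → ℝ) (α : Finset (Sym2 V) → ℝ)
    (hc_symm : ∀ v w, c v w = c w v)
    (hc_pos : ∀ v w, G.Adj v w → 0 < c v w)
    (hc_zero : ∀ v w, ¬G.Adj v w → c v w = 0)
    (hα_pos : ∀ δ : Finset (Sym2 V), IsCycleEdgeSet δ → ↑δ ⊆ G.edgeSet → 0 < α δ)
    (k r : ℕ) (γ : Fin k → Finset (Sym2 V))
    (E : Fin r → Finset (Sym2 V)) (W S : Fin r → Finset V)
    -- the `γ j` are pairwise vertex-disjoint simple cycles of `G`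
    (hγ : ∀ j, IsCycleEdgeSet (γ j) ∧ ↑(γ j) ⊆ G.edgeSet)
    (hγdisj : ∀ j j', j ≠ j' → ∀ v : V,
      (∃ e ∈ γ j, v ∈ e) → (∃ e ∈ γ j', v ∈ e) → False)
    -- the pieces `G_i = (W i, E i)` are subgraphs of `G` with boundary `S i`
    -- contained in the vertices of the cycles
    (hE : ∀ i, ↑(E i) ⊆ G.edgeSet)
    (hEW : ∀ i, ∀ e ∈ E i, ∀ v ∈ e, v ∈ W i)
    (hSγ : ∀ i, ∀ v ∈ S i, ∃ j, ∃ e ∈ γ j, v ∈ e)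
    -- restriction is a bijection between CRSFs of `G` containing the cycles and
    -- tuples of essential CRSFs of the pieces
    (hbij : Set.BijOn (fun Γ => fun i => Γ ∩ E i)
      {Γ : Finset (Sym2 V) | IsCRSF G Γ ∧ ∀ j, γ j ⊆ Γ}
      {t : Fin r → Finset (Sym2 V) | ∀ i, IsEssentialCRSFOn (E i) (W i) (S i) (t i)})
    -- every CRSF containing the cycles is the union of the cycles and its restrictions
    (hdecomp : ∀ Γ : Finset (Sym2 V), IsCRSF G Γ → (∀ j, γ j ⊆ Γ) →
      Γ = Finset.univ.biUnion γ ∪ Finset.univ.biUnion fun i => Γ ∩ E i) :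
    ∀ Γ : Finset (Sym2 V), IsCRSF G Γ → (∀ j, γ j ⊆ Γ) →
      wt c hc_symm α Γ /
          (∑ Γ' ∈ Finset.univ.filter
            (fun Γ' : Finset (Sym2 V) => IsCRSF G Γ' ∧ ∀ j, γ j ⊆ Γ'),
            wt c hc_symm α Γ')
        = ∏ i, (wt c hc_symm α (Γ ∩ E i) /
            ∑ Γᵢ ∈ Finset.univ.filter (IsEssentialCRSFOn (E i) (W i) (S i)),
              wt c hc_symm α Γᵢ) := by
  have hess : ∀ Γ, IsCRSF G Γ → (∀ j, γ j ⊆ Γ) →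
      ∀ i, IsEssentialCRSFOn (E i) (W i) (S i) (Γ ∩ E i) :=
    fun Γ h1 h2 => hbij.mapsTo ⟨h1, h2⟩
  -- sets contained in two pieces are always or never present
  have hdouble : ∀ Γ Γ', IsCRSF G Γ → (∀ j, γ j ⊆ Γ) → IsCRSF G Γ' → (∀ j, γ j ⊆ Γ') →
      ∀ i i', i ≠ i' → ∀ x, x ∈ Γ → x ∈ E i → x ∈ E i' → x ∈ Γ' := by
    intro Γ Γ' h1 h2 h1' h2' i i' hii x hx hxi hxi'
    obtain ⟨Γ'', -, hΓ''⟩ := hbij.surjOn (show (fun l => if l = i then Γ ∩ E l else Γ' ∩ E l) ∈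
      {t : Fin r → Finset (Sym2 V) | ∀ i, IsEssentialCRSFOn (E i) (W i) (S i) (t i)} by
        intro l
        by_cases hl : l = i
        · simp only [hl, if_true]; exact hess Γ h1 h2 i
        · simp only [hl, if_false]; exact hess Γ' h1' h2' l)
    have e1 := congrFun hΓ'' i
    have e2 := congrFun hΓ'' i'
    simp only [if_true, hii.symm, if_false] at e1 e2
    have : x ∈ Γ'' ∩ E i := by rw [e1]; exact Finset.mem_inter.2 ⟨hx, hxi⟩
    have : x ∈ Γ'' ∩ E i' := Finset.mem_inter.2 ⟨(Finset.mem_inter.1 this).1, hxi'⟩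
    rw [e2] at this
    exact (Finset.mem_inter.1 this).1
  have hedge : ∀ Γ Γ', IsCRSF G Γ → (∀ j, γ j ⊆ Γ) → IsCRSF G Γ' → (∀ j, γ j ⊆ Γ') →
      ∀ e, (Finset.univ.filter fun i => e ∈ E i).card ≠ 1 → e ∈ Γ → e ∈ Γ' := by
    intro Γ Γ' h1 h2 h1' h2' e hm he
    rcases Nat.lt_or_gt_of_ne hm with hm | hm
    · have h0 := Finset.card_eq_zero.1 (Nat.lt_one_iff.1 hm)
      have hde := he
      rw [hdecomp Γ h1 h2] at hde
      simp only [Finset.mem_union, Finset.mem_biUnion, Finset.mem_univ, true_and] at hde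
      rcases hde with ⟨j, hj⟩ | ⟨i, hi⟩
      · exact h2' j hj
      · exact absurd (Finset.mem_inter.1 hi).2 (Finset.filter_eq_empty_iff.1 h0
          (Finset.mem_univ i))
    · obtain ⟨i, hi, i', hi', hne⟩ := Finset.one_lt_card.1 hm
      exact hdouble Γ Γ' h1 h2 h1' h2' i i' hne e he (Finset.mem_filter.1 hi).2
        (Finset.mem_filter.1 hi').2
  have hcyc : ∀ Γ Γ', IsCRSF G Γ → (∀ j, γ j ⊆ Γ) → IsCRSF G Γ' → (∀ j, γ j ⊆ Γ') →
      ∀ δ, (Finset.univ.filter fun i => δ ⊆ E i).card ≠ 1 → δ ∈ cyclesOf Γ →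
        δ ∈ cyclesOf Γ' := by
    intro Γ Γ' h1 h2 h1' h2' δ hm hδ
    simp only [cyclesOf, Finset.mem_filter, Finset.mem_powerset] at hδ ⊢
    refine ⟨?_, hδ.2⟩
    rcases Nat.lt_or_gt_of_ne hm with hm | hm
    · have h0 := Finset.card_eq_zero.1 (Nat.lt_one_iff.1 hm)
      obtain ⟨j, rfl⟩ := aux_cycle_cover G k r γ E W S hγ hEW hSγ Γ h1 h2 (hess Γ h1 h2)
        (hdecomp Γ h1 h2) δ hδ.2 hδ.1
        (fun i => Finset.filter_eq_empty_iff.1 h0 (Finset.mem_univ i))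
      exact h2' j
    · obtain ⟨i, hi, i', hi', hne⟩ := Finset.one_lt_card.1 hm
      intro e he
      exact hdouble Γ Γ' h1 h2 h1' h2' i i' hne e (hδ.1 he) ((Finset.mem_filter.1 hi).2 he)
        ((Finset.mem_filter.1 hi').2 he)
  intro Γ hΓ hΓγ
  have hcross : ∀ Γ', IsCRSF G Γ' → (∀ j, γ j ⊆ Γ') →
      wt c hc_symm α Γ * ∏ i, wt c hc_symm α (Γ' ∩ E i) =
        wt c hc_symm α Γ' * ∏ i, wt c hc_symm α (Γ ∩ E i) := by
    intro Γ' h1 h2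
    rw [aux_prod_wt, aux_prod_wt]
    have a1 := aux_weights Γ Γ' (fun e => (Finset.univ.filter fun i => e ∈ E i).card)
      (edgeC c hc_symm) (fun e he => ⟨hedge Γ Γ' hΓ hΓγ h1 h2 e he,
        hedge Γ' Γ h1 h2 hΓ hΓγ e he⟩)
    have a2 := aux_weights (cyclesOf Γ) (cyclesOf Γ')
      (fun δ => (Finset.univ.filter fun i => δ ⊆ E i).card)
      α (fun e he => ⟨hcyc Γ Γ' hΓ hΓγ h1 h2 e he, hcyc Γ' Γ h1 h2 hΓ hΓγ e he⟩)
    unfold wt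
    rw [mul_mul_mul_comm, a1, a2, mul_mul_mul_comm]
  have hsum : ∑ Γ' ∈ Finset.univ.filter
      (fun Γ' : Finset (Sym2 V) => IsCRSF G Γ' ∧ ∀ j, γ j ⊆ Γ'),
      ∏ i, wt c hc_symm α (Γ' ∩ E i) =
      ∏ i, ∑ Γᵢ ∈ Finset.univ.filter (IsEssentialCRSFOn (E i) (W i) (S i)),
        wt c hc_symm α Γᵢ := by
    rw [Finset.prod_univ_sum]
    refine Finset.sum_bij (fun Γ' _ => fun i => Γ' ∩ E i) ?_ ?_ ?_ ?_
    · intro Γ' h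
      have h := (Finset.mem_filter.1 h).2
      rw [Fintype.mem_piFinset]
      intro i
      exact Finset.mem_filter.2 ⟨Finset.mem_univ _, hess Γ' h.1 h.2 i⟩
    · intro a ha b hb hab
      exact hbij.injOn (Finset.mem_filter.1 ha).2 (Finset.mem_filter.1 hb).2 hab
    · intro t ht
      rw [Fintype.mem_piFinset] at ht
      obtain ⟨a, ha, hat⟩ := hbij.surjOn (show t ∈
        {t : Fin r → Finset (Sym2 V) | ∀ i, IsEssentialCRSFOn (E i) (W i) (S i) (t i)} from
          fun i => (Finset.mem_filter.1 (ht i)).2)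
      exact ⟨a, Finset.mem_filter.2 ⟨Finset.mem_univ _, ha⟩, hat⟩
    · intro _ _
      rfl
  rw [Finset.prod_div_distrib, ← hsum]
  have hpos : ∀ Γ', IsCRSF G Γ' → 0 < wt c hc_symm α Γ' :=
    fun Γ' h => aux_wt_pos G c α hc_symm hc_pos hα_pos Γ' h.1
  have hposP : ∀ Γ', IsCRSF G Γ' → 0 < ∏ i, wt c hc_symm α (Γ' ∩ E i) :=
    fun Γ' h => Finset.prod_pos fun i _ => aux_wt_pos G c α hc_symm hc_pos hα_pos _
      (fun x hx => h.1 (Finset.mem_inter.1 hx).1)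
  have hmem : Γ ∈ Finset.univ.filter
      (fun Γ' : Finset (Sym2 V) => IsCRSF G Γ' ∧ ∀ j, γ j ⊆ Γ') :=
    Finset.mem_filter.2 ⟨Finset.mem_univ _, hΓ, hΓγ⟩
  rw [div_eq_div_iff
    (Finset.sum_pos (fun Γ' h => hpos Γ' (Finset.mem_filter.1 h).2.1) ⟨Γ, hmem⟩).ne'
    (Finset.sum_pos (fun Γ' h => hposP Γ' (Finset.mem_filter.1 h).2.1) ⟨Γ, hmem⟩).ne',
    Finset.mul_sum, Finset.mul_sum]
  refine Finset.sum_congr rfl fun Γ' h => ?_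
  have h := (Finset.mem_filter.1 h).2
  rw [hcross Γ' h.1 h.2, mul_comm]

end CRSFStmt
end
end

section
/- Let G = (V,E) be a finite connected graph with conductances c : E → ℝ_{>0} and Φ a unitary connection with Laplacian Δ_Φ, and suppose det(Δ_Φ) ≠ 0. Let μ_Φ be the probability measure on CRSFs of G giving Γ probability Π_{e∈Γ} c(e) · Π_{cycles γ of Γ} (2 − ω_γ − ω_γ^{-1}) / det(Δ_Φ). Let γ_1,…,γ_k be pairwise vertex-disjoint simple cycles of G with union of vertex sets W. Then the μ_Φ-probability that the random CRSF contains all edges of γ_1 ∪ … ∪ γ_k equals (Π_{e∈γ_1∪…∪γ_k} c(e) · Π_{i=1}^k (2 − ω_{γ_i} − ω_{γ_i}^{-1})) · det(Δ_{Φ,W}) / det(Δ_Φ), where Δ_{Φ,W} is the Dirichlet Laplacian with boundary W. -/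
/-!
STATEMENT 7.  For the measure `μ_Φ` (a CRSF `Γ` has probability
`Π_{e∈Γ} c(e) · Π_{cycles} (2−ω−ω⁻¹) / det Δ_Φ`), the probability that the random CRSF
contains the pairwise vertex-disjoint simple cycles `γ_1,…,γ_k` equals
`(Π_{e∈γ_1∪…∪γ_k} c(e) · Π_i (2−ω_{γ_i}−ω_{γ_i}⁻¹)) · det(Δ_{Φ,W}) / det(Δ_Φ)`,
where `W` is the set of vertices of the cycles.
-/

open Classical

noncomputable section

namespace CRSFStmt

variable {V : Type*} [Fintype V] [DecidableEq V]

/-- The product of the values of the connection `φ` along the darts of a walk. -/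
def walkHol (φ : V → V → ℂ) {v : V} (w : (⊤ : SimpleGraph V).Walk v v) : ℂ :=
  (w.darts.map fun d => φ d.toProd.1 d.toProd.2).prod

/-- The weight `2 − ω − ω⁻¹` attached by `φ` to a cycle with edge set `δ`. -/
def cycleWeight (φ : V → V → ℂ) (δ : Finset (Sym2 V)) : ℂ :=
  if h : IsCycleEdgeSet δ then
    2 - walkHol φ h.choose_spec.choose - (walkHol φ h.choose_spec.choose)⁻¹
  else 0

/-- The line-bundle Laplacian of conductances `c` and connection `φ`. -/
def lineLaplacian (c : V → V → ℝ) (φ : V → V → ℂ) : Matrix V V ℂ :=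
  Matrix.of fun v w => if v = w then (∑ u, (c v u : ℂ)) else -(c v w : ℂ) * φ w v

/-- The determinant of the Dirichlet Laplacian with boundary `S`. -/
def dirichletDet (c : V → V → ℝ) (φ : V → V → ℂ) (S : Finset V) : ℂ :=
  Matrix.det (n := {v : V // v ∉ S})
    ((lineLaplacian c φ).submatrix (fun v => (v : V)) (fun v => (v : V)))

set_option linter.unusedSectionVars false
set_option linter.unusedVariables false

lemma darts_map_eq {β : Type*} (F : V → V → β) {G : SimpleGraph V} {u v : V} (w : G.Walk u v) :
    w.darts.map (fun d => F d.toProd.1 d.toProd.2) =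
      (List.range w.length).map (fun i => F (w.getVert i) (w.getVert (i + 1))) := by
  induction w with
  | nil => simp
  | cons h p ih =>
    rw [SimpleGraph.Walk.darts_cons, List.map_cons, SimpleGraph.Walk.length_cons,
      List.range_succ_eq_map, List.map_cons, ih]
    simp [Function.comp_def]

lemma cycle_param {v : V} (w : (⊤ : SimpleGraph V).Walk v v) (hw : w.IsCycle) :
    ∃ (n : ℕ) (y : ℕ → V), 3 ≤ n ∧ (∀ i, y (i + n) = y i) ∧ Set.InjOn y (Set.Iio n) ∧
      (w.edges.toFinset = (Finset.range n).image (fun i => s(y i, y (i + 1)))) ∧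
      ∀ φ : V → V → ℂ, walkHol φ w = ∏ i ∈ Finset.range n, φ (y i) (y (i + 1)) := by
  have h3 := hw.three_le_length
  have hy : ∀ i ∈ Finset.range w.length, w.getVert ((i + 1) % w.length) = w.getVert (i + 1) := by
    intro i hi
    rw [Finset.mem_range] at hi
    rcases Nat.lt_or_ge (i + 1) w.length with h | h
    · rw [Nat.mod_eq_of_lt h]
    · have : i + 1 = w.length := by omega
      rw [this]; simp
  have hx : ∀ i ∈ Finset.range w.length, w.getVert (i % w.length) = w.getVert i := by
    intro i hi
    rw [Nat.mod_eq_of_lt (Finset.mem_range.1 hi)]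
  refine ⟨w.length, fun i => w.getVert (i % w.length), h3, ?_, ?_, ?_, ?_⟩
  · intro i; simp
  · intro i hi j hj hij
    simp only [Set.mem_Iio] at hi hj
    simp only [Nat.mod_eq_of_lt hi, Nat.mod_eq_of_lt hj] at hij
    exact hw.getVert_injOn' (by simp; omega) (by simp; omega) hij
  · have : w.edges = w.darts.map (fun d => s(d.toProd.1, d.toProd.2)) := rfl
    rw [this, darts_map_eq (fun a b => s(a, b))]
    ext e
    simp only [List.mem_toFinset, List.mem_map, List.mem_range, Finset.mem_image, Finset.mem_range]
    constructor
    · rintro ⟨i, hi, rfl⟩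
      exact ⟨i, hi, by rw [hx i (by simpa), hy i (by simpa)]⟩
    · rintro ⟨i, hi, rfl⟩
      exact ⟨i, hi, by rw [hx i (by simpa), hy i (by simpa)]⟩
  · intro φ
    unfold walkHol
    rw [darts_map_eq φ]
    rw [Finset.prod_congr rfl (fun i hi => by simp only [hx i hi, hy i hi]; rfl)]
    rfl

lemma walk_of_seq (y : ℕ → V) (hne : ∀ i, y i ≠ y (i + 1)) (m : ℕ) :
    ∃ p : (⊤ : SimpleGraph V).Walk (y 0) (y m), p.support = (List.range (m + 1)).map y ∧
      p.edges = (List.range m).map (fun i => s(y i, y (i + 1))) := by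
  induction m with
  | zero => exact ⟨.nil, by simp, by simp⟩
  | succ m ih =>
    obtain ⟨p, h1, h2⟩ := ih
    refine ⟨p.concat (by simpa using hne m), ?_, ?_⟩
    · rw [SimpleGraph.Walk.support_concat, h1, List.range_succ (n := m + 1)]; simp
    · rw [SimpleGraph.Walk.edges_concat, h2, List.range_succ (n := m)]; simp

lemma isCycle_of_seq (n : ℕ) (y : ℕ → V) (hn : 3 ≤ n) (hper : ∀ i, y (i + n) = y i)
    (hinj : Set.InjOn y (Set.Iio n)) (hne : ∀ i, y i ≠ y (i + 1)) :
    IsCycleEdgeSet ((Finset.range n).image (fun i => s(y i, y (i + 1)))) := by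
  obtain ⟨m, rfl⟩ : ∃ m, n = m + 1 := ⟨n - 1, by omega⟩
  obtain ⟨p, h1, h2⟩ := walk_of_seq y hne m
  have h0 : y (m + 1) = y 0 := by simpa using hper 0
  have hadj : (⊤ : SimpleGraph V).Adj (y m) (y 0) := by
    have := hne m
    rw [h0] at this
    simpa using this
  refine ⟨y m, .cons hadj p, ?_, ?_⟩
  · rw [SimpleGraph.Walk.cons_isCycle_iff]
    constructor
    · rw [SimpleGraph.Walk.isPath_def, h1]
      refine List.Nodup.map_on ?_ List.nodup_range
      intro a ha b hb hab
      exact hinj (by simpa using ha) (by simpa using hb) hab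
    · rw [h2]
      simp only [List.mem_map, List.mem_range, not_exists, not_and]
      intro i hi h
      rw [Sym2.eq_iff] at h
      rcases h with ⟨a, b⟩ | ⟨a, b⟩
      · have := hinj (by simp; omega) (by simp) a
        omega
      · have h4 := hinj (x₁ := i) (x₂ := 0) (by simp; omega) (by simp) a
        have h5 := hinj (x₁ := i + 1) (x₂ := m) (by simp; omega) (by simp) b
        omega
  · rw [SimpleGraph.Walk.edges_cons, h2]
    ext e
    simp only [List.toFinset_cons, Finset.mem_insert, List.mem_toFinset, List.mem_map,
      List.mem_range, Finset.mem_image, Finset.mem_range]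
    constructor
    · rintro (rfl | ⟨i, hi, rfl⟩)
      · exact ⟨m, by omega, by rw [h0]⟩
      · exact ⟨i, by omega, rfl⟩
    · rintro ⟨i, hi, rfl⟩
      rcases Nat.lt_or_ge i m with h | h
      · exact Or.inr ⟨i, h, rfl⟩
      · obtain rfl : i = m := by omega
        left; rw [h0]

/-- The edge chosen by `f` at `v`. -/
def em (f : V → V) (v : V) : Sym2 V := s(v, f v)

/-- Minimal nonempty invariant set. -/
def MinInv (f : V → V) (Z : Finset V) : Prop :=
  Z.Nonempty ∧ (∀ v ∈ Z, f v ∈ Z) ∧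
    ∀ T : Finset V, T ⊆ Z → T.Nonempty → (∀ v ∈ T, f v ∈ T) → T = Z

lemma em_inj {f : V → V} (h : ∀ v, f (f v) ≠ v) : Function.Injective (em f) := by
  intro a b hab
  unfold em at hab
  rw [Sym2.eq_iff] at hab
  rcases hab with ⟨h1, _⟩ | ⟨h1, h2⟩
  · exact h1
  · exfalso
    apply h a
    rw [h2, h1]

lemma ne_of_N2 {f : V → V} (h : ∀ v, f (f v) ≠ v) (v : V) : f v ≠ v := by
  intro h1
  apply h v
  rw [h1, h1]

lemma exists_minInv (f : V → V) (S : Finset V) (hS : S.Nonempty) (hinv : ∀ v ∈ S, f v ∈ S) :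
    ∃ Z, Z ⊆ S ∧ MinInv f Z := by
  induction S using Finset.strongInduction with
  | H S ih =>
    by_cases h : ∃ T, T ⊂ S ∧ T.Nonempty ∧ ∀ v ∈ T, f v ∈ T
    · obtain ⟨T, hT, hn, hi⟩ := h
      obtain ⟨Z, hZ, hm⟩ := ih T hT hn hi
      exact ⟨Z, hZ.trans hT.subset, hm⟩
    · push Not at h
      refine ⟨S, subset_rfl, hS, hinv, ?_⟩
      intro T hT hn hi
      by_contra hne
      obtain ⟨v, hv, hv'⟩ := h T (lt_of_le_of_ne hT hne) hn
      exact hv' (hi v hv)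

lemma MinInv.eq_of_mem {f : V → V} {Z Z' : Finset V} (h : MinInv f Z) (h' : MinInv f Z') {v : V}
    (hv : v ∈ Z) (hv' : v ∈ Z') : Z = Z' := by
  have hn : (Z ∩ Z').Nonempty := ⟨v, by simp [hv, hv']⟩
  have hi : ∀ u ∈ Z ∩ Z', f u ∈ Z ∩ Z' := by
    intro u hu
    simp only [Finset.mem_inter] at hu ⊢
    exact ⟨h.2.1 u hu.1, h'.2.1 u hu.2⟩
  rw [← h.2.2 _ Finset.inter_subset_left hn hi]
  nth_rewrite 1 [h'.2.2 _ Finset.inter_subset_right hn hi]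
  rfl

/-- An invariant set meeting `Z` contains `Z`. -/
lemma MinInv.subset_of_mem {f : V → V} {Z S : Finset V} (h : MinInv f Z)
    (hS : ∀ v ∈ S, f v ∈ S) {v : V}
    (hv : v ∈ Z) (hv' : v ∈ S) : Z ⊆ S := by
  have hn : (Z ∩ S).Nonempty := ⟨v, by simp [hv, hv']⟩
  have hi : ∀ u ∈ Z ∩ S, f u ∈ Z ∩ S := by
    intro u hu
    simp only [Finset.mem_inter] at hu ⊢
    exact ⟨h.2.1 u hu.1, hS u hu.2⟩
  rw [← h.2.2 _ Finset.inter_subset_left hn hi]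
  exact Finset.inter_subset_right

lemma MinInv.exists_perm {f : V → V} {Z : Finset V} (h : MinInv f Z) :
    ∃ σ : Equiv.Perm V, (∀ v ∈ Z, σ v = f v) ∧ ∀ v, v ∉ Z → σ v = v := by
  have him : Z.image f = Z := by
    apply h.2.2
    · intro v hv
      obtain ⟨u, hu, rfl⟩ := Finset.mem_image.1 hv
      exact h.2.1 u hu
    · exact h.1.image f
    · intro v hv
      obtain ⟨u, hu, rfl⟩ := Finset.mem_image.1 hv
      exact Finset.mem_image_of_mem f (h.2.1 u hu)
  have hinj : Set.InjOn f Z := by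
    rw [← Finset.card_image_iff, him]
  have hbij : Function.Bijective (fun v => if v ∈ Z then f v else v) := by
    rw [← Finite.injective_iff_bijective]
    intro a b hab
    by_cases ha : a ∈ Z <;> by_cases hb : b ∈ Z <;> simp only [ha, hb, if_true, if_false] at hab
    · exact hinj ha hb hab
    · exact absurd (hab ▸ h.2.1 a ha) hb
    · exact absurd (hab ▸ h.2.1 b hb) ha
    · exact hab
  refine ⟨Equiv.ofBijective _ hbij, ?_, ?_⟩
  · intro v hv; simp [hv]
  · intro v hv; simp [hv]

lemma MinInv.isCycle_perm {f : V → V} {Z : Finset V} (h : MinInv f Z) (hf : ∀ v, f (f v) ≠ v)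
    {σ : Equiv.Perm V} (h1 : ∀ v ∈ Z, σ v = f v) (h2 : ∀ v, v ∉ Z → σ v = v) :
    σ.IsCycle ∧ σ.support = Z := by
  have hm : ∀ v, σ v ≠ v ↔ v ∈ Z := by
    intro v
    constructor
    · intro hv; by_contra hv'; exact hv (h2 v hv')
    · intro hv; rw [h1 v hv]; exact ne_of_N2 hf v
  constructor
  · obtain ⟨x, hx⟩ := h.1
    refine ⟨x, (hm x).2 hx, ?_⟩
    intro y hy
    rw [hm] at hy
    have := h.2.2 (Z.filter (fun z => σ.SameCycle x z)) (Finset.filter_subset _ _)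
      ⟨x, by simp only [Finset.mem_filter]; exact ⟨hx, Equiv.Perm.SameCycle.refl _ _⟩⟩ (by
        intro v hv
        simp only [Finset.mem_filter] at hv ⊢
        refine ⟨h.2.1 v hv.1, ?_⟩
        rw [← h1 v hv.1]
        exact Equiv.Perm.sameCycle_apply_right.2 hv.2)
    rw [← this] at hy
    exact (Finset.mem_filter.1 hy).2
  · ext v
    rw [Equiv.Perm.mem_support, hm]

lemma MinInv.isCycleEdgeSet {f : V → V} {Z : Finset V} (h : MinInv f Z) (hf : ∀ v, f (f v) ≠ v) :
    IsCycleEdgeSet (Z.image (em f)) := by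
  obtain ⟨v, hv⟩ := h.1
  have hit : ∀ i, f^[i] v ∈ Z := by
    intro i
    induction i with
    | zero => exact hv
    | succ i ih => rw [Function.iterate_succ_apply']; exact h.2.1 _ ih
  have hT := h.2.2 (Z.filter (fun x => ∃ i, x = f^[i + 1] v)) (Finset.filter_subset _ _)
    ⟨f v, by simp only [Finset.mem_filter]; exact ⟨h.2.1 v hv, 0, rfl⟩⟩ (by
      intro u hu
      simp only [Finset.mem_filter] at hu ⊢
      obtain ⟨hu, i, rfl⟩ := hu
      exact ⟨h.2.1 _ hu, i + 1, by rw [Function.iterate_succ_apply' f (i + 1)]⟩)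
  have hper : v ∈ Function.periodicPts f := by
    have hv2 := hv
    rw [← hT] at hv2
    obtain ⟨_, i, hi⟩ := Finset.mem_filter.1 hv2
    exact ⟨i + 1, by omega, hi.symm⟩
  set n := Function.minimalPeriod f v with hn
  have hpos : 0 < n := Function.minimalPeriod_pos_of_mem_periodicPts hper
  have hpn : f^[n] v = v := Function.isPeriodicPt_minimalPeriod f v
  have h1 : n ≠ 1 := by
    intro h1; rw [h1] at hpn; exact ne_of_N2 hf v hpn
  have h2 : n ≠ 2 := by
    intro h1; rw [h1] at hpn; exact hf v hpn
  have key := isCycle_of_seq n (fun i => f^[i] v) (by omega)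
    (fun i => Function.iterate_add_minimalPeriod_eq) Function.iterate_injOn_Iio_minimalPeriod
    (fun i => by
      simp only [Function.iterate_succ_apply']
      exact (ne_of_N2 hf _).symm)
  have hZ : (Finset.range n).image (fun i => f^[i] v) = Z := by
    apply h.2.2
    · intro x hx
      obtain ⟨i, _, rfl⟩ := Finset.mem_image.1 hx
      exact hit i
    · exact ⟨v, Finset.mem_image.2 ⟨0, by simpa using hpos, rfl⟩⟩
    · intro x hx
      obtain ⟨i, hi, rfl⟩ := Finset.mem_image.1 hx
      rw [Finset.mem_range] at hi
      rcases Nat.lt_or_ge (i + 1) n with h3 | h3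
      · exact Finset.mem_image.2 ⟨i + 1, by simpa using h3, by rw [Function.iterate_succ_apply']⟩
      · have h4 : i + 1 = n := by omega
        refine Finset.mem_image.2 ⟨0, by simpa using hpos, ?_⟩
        rw [← Function.iterate_succ_apply' f, Nat.succ_eq_add_one, h4, hpn]; rfl
  have : Z.image (em f) = (Finset.range n).image (fun i => s(f^[i] v, f^[i + 1] v)) := by
    rw [← hZ, Finset.image_image]
    apply Finset.image_congr
    intro i _
    simp [em, Function.iterate_succ_apply']
  rw [this]
  exact key

/-- Structure of cycles in a functional graph. -/
lemma cycle_structure {f : V → V} (hf : ∀ v, f (f v) ≠ v) {v : V}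
    (w : (⊤ : SimpleGraph V).Walk v v) (hw : w.IsCycle)
    (hsub : w.edges.toFinset ⊆ Finset.univ.image (em f)) :
    ∃ Z, MinInv f Z ∧ w.edges.toFinset = Z.image (em f) ∧
      ∀ φ : V → V → ℂ, walkHol φ w = ∏ v ∈ Z, φ v (f v) ∨ walkHol φ w = ∏ v ∈ Z, φ (f v) v := by
  obtain ⟨n, y, hn, hper, hinj, hedge, hhol⟩ := cycle_param w hw
  have hper' : ∀ k i, y (i + n * k) = y i := by
    intro k
    induction k with
    | zero => intro i; simp
    | succ k ih => intro i; rw [Nat.mul_succ, ← add_assoc, hper, ih]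
  have hmod : ∀ i, y (i % n) = y i := by
    intro i
    conv_rhs => rw [← Nat.mod_add_div i n]
    rw [hper']
  have hmod1 : ∀ i, y (i % n + 1) = y (i + 1) := by
    intro i
    conv_rhs => rw [← Nat.mod_add_div i n, add_right_comm]
    rw [hper']
  have hmem : ∀ e, e ∈ w.edges.toFinset ↔ ∃ i, s(y i, y (i + 1)) = e := by
    intro e
    rw [hedge]
    simp only [Finset.mem_image, Finset.mem_range]
    constructor
    · rintro ⟨i, _, rfl⟩; exact ⟨i, rfl⟩
    · rintro ⟨i, rfl⟩
      exact ⟨i % n, Nat.mod_lt _ (by omega), by rw [hmod, hmod1]⟩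
  have hback : ∀ i, y (i + 2) ≠ y i := by
    intro i h
    rw [← hmod (i + 2), ← hmod i] at h
    have := hinj (Nat.mod_lt _ (by omega)) (Nat.mod_lt _ (by omega)) h
    have h5 : (i + 2) ≡ i + 0 [MOD n] := this
    have h6 := Nat.ModEq.add_left_cancel' i h5
    have h7 : 2 % n = 0 % n := h6
    rw [Nat.mod_eq_of_lt (by omega)] at h7
    simp at h7
  have hor : ∀ i, y (i + 1) = f (y i) ∨ y i = f (y (i + 1)) := by
    intro i
    have := hsub ((hmem _).2 ⟨i, rfl⟩)
    obtain ⟨u, _, hu⟩ := Finset.mem_image.1 this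
    unfold em at hu
    rw [Sym2.eq_iff] at hu
    rcases hu with ⟨h1, h2⟩ | ⟨h1, h2⟩
    · left; rw [← h1, h2]
    · right; rw [← h1, h2]
  have hprop : ∀ i, y i = f (y (i + 1)) → y (i + 1) = f (y (i + 2)) := by
    intro i hi
    rcases hor (i + 1) with h | h
    · exact absurd (h.trans hi.symm) (hback i)
    · exact h
  set Z := (Finset.range n).image y with hZ
  have hmemZ : ∀ x, x ∈ Z ↔ ∃ i, y i = x := by
    intro x
    simp only [hZ, Finset.mem_image, Finset.mem_range]
    constructor
    · rintro ⟨i, _, rfl⟩; exact ⟨i, rfl⟩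
    · rintro ⟨i, rfl⟩
      exact ⟨i % n, Nat.mod_lt _ (by omega), hmod i⟩
  have hZprod : ∀ F : V → ℂ, ∏ v ∈ Z, F v = ∏ i ∈ Finset.range n, F (y i) := by
    intro F
    rw [hZ, Finset.prod_image]
    intro a ha b hb
    exact hinj (by simpa using ha) (by simpa using hb)
  have hZne : Z.Nonempty := ⟨y 0, (hmemZ _).2 ⟨0, rfl⟩⟩
  by_cases hb : ∃ i, y i = f (y (i + 1))
  · -- backward
    obtain ⟨i0, hi0⟩ := hb
    have hall0 : ∀ k, y (i0 + k) = f (y (i0 + k + 1)) := by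
      intro k
      induction k with
      | zero => exact hi0
      | succ k ih => exact hprop _ ih
    have hall : ∀ i, y i = f (y (i + 1)) := by
      intro i
      have h1 : i0 ≤ i + n * i0 := by nlinarith
      obtain ⟨k, hk⟩ := Nat.exists_eq_add_of_le h1
      have := hall0 k
      rw [← hk, hper', add_right_comm, hper'] at this
      exact this
    refine ⟨Z, ⟨hZne, ?_, ?_⟩, ?_, ?_⟩
    · intro x hx
      obtain ⟨i, rfl⟩ := (hmemZ x).1 hx
      refine (hmemZ _).2 ⟨i + (n - 1), ?_⟩
      rw [hall, show i + (n - 1) + 1 = i + n by omega, hper]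
    · intro T hT hTn hTi
      have hdown : ∀ k j, y (j + k) ∈ T → y j ∈ T := by
        intro k
        induction k with
        | zero => intro j h; exact h
        | succ k ih =>
          intro j h
          apply ih
          rw [hall]
          exact hTi _ h
      apply Finset.Subset.antisymm hT
      intro x hx
      obtain ⟨j, rfl⟩ := (hmemZ x).1 hx
      obtain ⟨t, ht⟩ := hTn
      obtain ⟨i, rfl⟩ := (hmemZ t).1 (hT ht)
      have h1 : j ≤ i + n * j := by nlinarith
      obtain ⟨k, hk⟩ := Nat.exists_eq_add_of_le h1
      apply hdown k
      rw [← hk, hper']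
      exact ht
    · ext e
      rw [hmem]
      simp only [Finset.mem_image, hmemZ]
      constructor
      · rintro ⟨i, rfl⟩
        refine ⟨y (i + 1), ⟨_, rfl⟩, ?_⟩
        rw [em, ← hall, Sym2.eq_swap]
      · rintro ⟨_, ⟨i, rfl⟩, rfl⟩
        refine ⟨i + (n - 1), ?_⟩
        have h1 : i + (n - 1) + 1 = i + n := by omega
        rw [hall (i + (n - 1)), h1, hper, em, Sym2.eq_swap]
    · intro φ
      right
      rw [hhol, hZprod (fun v => φ (f v) v)]
      have h1 : ∀ i ∈ Finset.range n, φ (y i) (y (i + 1)) =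
          (fun j => φ (f (y j)) (y j)) (i + 1) := by
        intro i _
        simp only
        rw [← hall]
      rw [Finset.prod_congr rfl h1]
      obtain ⟨m, rfl⟩ : ∃ m, n = m + 1 := ⟨n - 1, by omega⟩
      rw [Finset.prod_range_succ, Finset.prod_range_succ' _ m]
      have h0 : y (m + 1) = y 0 := by simpa using hper 0
      simp only [h0]
  · push Not at hb
    have hall : ∀ i, y (i + 1) = f (y i) := fun i => (hor i).resolve_right (hb i)
    refine ⟨Z, ⟨hZne, ?_, ?_⟩, ?_, ?_⟩
    · intro x hx
      obtain ⟨i, rfl⟩ := (hmemZ x).1 hx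
      exact (hmemZ _).2 ⟨i + 1, hall i⟩
    · intro T hT hTn hTi
      obtain ⟨t, ht⟩ := hTn
      obtain ⟨i, rfl⟩ := (hmemZ t).1 (hT ht)
      have hup : ∀ k, y (i + k) ∈ T := by
        intro k
        induction k with
        | zero => exact ht
        | succ k ih => rw [← add_assoc, hall]; exact hTi _ ih
      apply Finset.Subset.antisymm hT
      intro x hx
      obtain ⟨j, rfl⟩ := (hmemZ x).1 hx
      have h1 : i ≤ j + n * i := by nlinarith
      obtain ⟨k, hk⟩ := Nat.exists_eq_add_of_le h1
      rw [← hper' i, hk]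
      exact hup k
    · ext e
      rw [hmem]
      simp only [Finset.mem_image, hmemZ]
      constructor
      · rintro ⟨i, rfl⟩
        exact ⟨y i, ⟨_, rfl⟩, by rw [em, ← hall]⟩
      · rintro ⟨_, ⟨i, rfl⟩, rfl⟩
        exact ⟨i, by rw [em, ← hall]⟩
    · intro φ
      left
      rw [hhol, hZprod (fun v => φ v (f v))]
      exact Finset.prod_congr rfl (fun i _ => by rw [hall])

lemma cycle_weight {f : V → V} (hf : ∀ v, f (f v) ≠ v) {δ : Finset (Sym2 V)}
    (hδ : IsCycleEdgeSet δ) (hsub : δ ⊆ Finset.univ.image (em f)) :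
    ∃ Z, MinInv f Z ∧ δ = Z.image (em f) ∧
      ∀ φ : V → V → ℂ, (∀ v ∈ Z, φ v (f v) * φ (f v) v = 1) →
        cycleWeight φ δ = 2 - ∏ v ∈ Z, φ v (f v) - ∏ v ∈ Z, φ (f v) v := by
  have hc := hδ.choose_spec.choose_spec
  obtain ⟨Z, h1, h2, h3⟩ := cycle_structure hf hδ.choose_spec.choose hc.1 (by rw [hc.2]; exact hsub)
  refine ⟨Z, h1, hc.2.symm.trans h2, ?_⟩
  intro φ hφ
  have hp : (∏ v ∈ Z, φ v (f v)) * ∏ v ∈ Z, φ (f v) v = 1 := by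
    rw [← Finset.prod_mul_distrib]
    exact Finset.prod_eq_one hφ
  unfold cycleWeight
  rw [dif_pos hδ]
  rcases h3 φ with h | h
  · rw [h, inv_eq_of_mul_eq_one_right hp]
  · rw [h, inv_eq_of_mul_eq_one_left hp]; ring

/-- The matrix with rows `e_v` on `W` and `e_v - φ (f v) v e_{f v}` off `W`. -/
def Amat (φ : V → V → ℂ) (f : V → V) (W : Finset V) : Matrix V V ℂ :=
  Matrix.of fun v u =>
    (if v = u then 1 else 0) - (if v ∈ W then 0 else if f v = u then φ (f v) v else 0)

lemma det_step_v (φ : V → V → ℂ) (f : V → V) (W : Finset V) (v : V) (hv : v ∉ W) (hfv : f v ∈ W) :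
    (Amat φ f W).det = (Amat φ f (insert v W)).det := by
  have hne : v ≠ f v := fun h => hv (h ▸ hfv)
  rw [← Matrix.det_updateRow_add_smul_self (Amat φ f (insert v W)) hne (-φ (f v) v)]
  congr 1
  ext x u
  by_cases hx : x = v
  · subst hx
    rw [Matrix.updateRow_self]
    simp only [Amat, Matrix.of_apply, Pi.add_apply, Pi.smul_apply, smul_eq_mul, hv, hfv,
      Finset.mem_insert, true_or, or_true, if_true, if_false]
    split_ifs <;> ring
  · rw [Matrix.updateRow_ne hx]
    simp [Amat, hx]

lemma mat_step_Z (φ : V → V → ℂ) (f : V → V) (W Z : Finset V) (hZ : ∀ v ∈ Z, f v ∈ Z)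
    (hd : ∀ v ∈ Z, v ∉ W) : Amat φ f W = Amat φ f Zᶜ * Amat φ f (W ∪ Z) := by
  ext v u
  rw [Matrix.mul_apply]
  simp only [Amat, Matrix.of_apply, sub_mul, Finset.sum_sub_distrib]
  by_cases hv : v ∈ Z
  · have := hZ v hv
    have := hd v hv
    simp [*]
  · simp [hv]

lemma det_Z (φ : V → V → ℂ) {f : V → V} (hf : ∀ v, f (f v) ≠ v) {Z : Finset V} (h : MinInv f Z) :
    (Amat φ f Zᶜ).det = 1 - ∏ v ∈ Z, φ (f v) v := by
  obtain ⟨σ, h1, h2⟩ := h.exists_perm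
  obtain ⟨hcyc, hsupp⟩ := h.isCycle_perm hf h1 h2
  rw [← Matrix.det_transpose, Matrix.det_apply']
  simp only [Matrix.transpose_apply]
  have hne : (1 : Equiv.Perm V) ≠ σ := fun h => hcyc.ne_one h.symm
  rw [← Finset.sum_subset (Finset.subset_univ {1, σ}), Finset.sum_pair hne]
  · have e1 : ∏ x, Amat φ f Zᶜ x ((1 : Equiv.Perm V) x) = 1 := by
      apply Finset.prod_eq_one
      intro x _
      simp [Amat, ne_of_N2 hf x]
    have e2 : ∏ x, Amat φ f Zᶜ x (σ x) = (-1) ^ Z.card * ∏ v ∈ Z, φ (f v) v := by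
      rw [← Finset.prod_const, ← Finset.prod_mul_distrib,
        ← Finset.prod_subset (Finset.subset_univ Z)]
      · apply Finset.prod_congr rfl
        intro x hx
        simp [Amat, hx, h1 x hx, (ne_of_N2 hf x).symm]
      · intro x _ hx
        simp [Amat, hx, h2 x hx]
    rw [e1, e2, hcyc.sign, hsupp]
    simp only [Equiv.Perm.sign_one, Units.val_one, Int.cast_one, mul_one]
    push_cast
    have : ((-1 : ℂ) ^ Z.card) * (-1) ^ Z.card = 1 := by
      rw [← mul_pow]; simp
    linear_combination (-∏ v ∈ Z, φ (f v) v) * this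
  · intro τ _ hτ
    by_contra hne0
    apply hτ
    have hp : ∏ x, Amat φ f Zᶜ x (τ x) ≠ 0 := right_ne_zero_of_mul hne0
    rw [Finset.prod_ne_zero_iff] at hp
    have ha : ∀ v, v ∉ Z → τ v = v := by
      intro v hv
      by_contra hh
      apply hp v (Finset.mem_univ _)
      simp [Amat, hv, Ne.symm hh]
    have hb : ∀ v ∈ Z, τ v ≠ v → τ v = f v := by
      intro v hv hh
      by_contra hh2
      apply hp v (Finset.mem_univ _)
      simp [Amat, Ne.symm hh, Ne.symm hh2]
    simp only [Finset.mem_insert, Finset.mem_singleton]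
    by_cases hT : (Z.filter (fun v => τ v ≠ v)).Nonempty
    · right
      have := h.2.2 _ (Finset.filter_subset _ _) hT (by
        intro v hv
        simp only [Finset.mem_filter] at hv ⊢
        refine ⟨h.2.1 v hv.1, ?_⟩
        rw [← hb v hv.1 hv.2]
        intro h5
        exact hv.2 (τ.injective h5))
      ext v
      by_cases hv : v ∈ Z
      · rw [h1 v hv]
        apply hb v hv
        rw [← this] at hv
        exact (Finset.mem_filter.1 hv).2
      · rw [h2 v hv, ha v hv]
    · left
      rw [Finset.not_nonempty_iff_eq_empty, Finset.filter_eq_empty_iff] at hT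
      ext v
      by_cases hv : v ∈ Z
      · simpa using hT hv
      · simpa using ha v hv

lemma exists_rev {f : V → V} (hf : ∀ v, f (f v) ≠ v) {Z : Finset V} (h : MinInv f Z) :
    ∃ f1 : V → V, (∀ v, f1 (f1 v) ≠ v) ∧ Finset.univ.image (em f1) = Finset.univ.image (em f) ∧
      MinInv f1 Z ∧ (∀ v, v ∉ Z → f1 v = f v) ∧ (∀ v ∈ Z, f1 (f v) = v) ∧
      (∀ v ∈ Z, f (f1 v) = v) ∧
      ∀ φ : V → V → ℂ, ∏ v ∈ Z, φ (f1 v) v = ∏ v ∈ Z, φ v (f v) := by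
  obtain ⟨σ, h1, h2⟩ := h.exists_perm
  have hσ : ∀ v, σ v ∈ Z ↔ v ∈ Z := by
    intro v
    by_cases hv : v ∈ Z
    · rw [h1 v hv]; simp [hv, h.2.1 v hv]
    · rw [h2 v hv]
  have hσ' : ∀ v, σ⁻¹ v ∈ Z ↔ v ∈ Z := by
    intro v
    rw [← hσ]; simp
  have g1 : ∀ v ∈ Z, (fun v => if v ∈ Z then σ⁻¹ v else f v) (f v) = v := by
    intro v hv
    simp only [h.2.1 v hv, if_true]
    rw [← h1 v hv]; simp
  have g2 : ∀ v ∈ Z, f ((fun v => if v ∈ Z then σ⁻¹ v else f v) v) = v := by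
    intro v hv
    simp only [hv, if_true]
    rw [← h1 _ ((hσ' v).2 hv)]; simp
  have g3 : ∀ v ∈ Z, (fun v => if v ∈ Z then σ⁻¹ v else f v) v ∈ Z := by
    intro v hv
    simp only [hv, if_true]
    exact (hσ' v).2 hv
  have g4 : ∀ v, v ∉ Z → (fun v => if v ∈ Z then σ⁻¹ v else f v) v = f v := by
    intro v hv
    simp only [hv, if_false]
  generalize (fun v => if v ∈ Z then σ⁻¹ v else f v) = f1 at g1 g2 g3 g4
  refine ⟨f1, ?_, ?_, ⟨h.1, g3, ?_⟩, g4, g1, g2, ?_⟩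
  · intro v hv
    by_cases hz : v ∈ Z
    · have a := g2 v hz
      have b := g2 _ (g3 v hz)
      rw [hv] at b
      apply hf v
      rw [b, a]
    · rw [g4 v hz] at hv
      by_cases hz2 : f v ∈ Z
      · exact hz (hv ▸ g3 _ hz2)
      · rw [g4 _ hz2] at hv
        exact hf v hv
  · ext e
    simp only [Finset.mem_image, Finset.mem_univ, true_and]
    constructor
    · rintro ⟨v, rfl⟩
      by_cases hz : v ∈ Z
      · exact ⟨f1 v, by rw [em, em, g2 v hz, Sym2.eq_swap]⟩
      · exact ⟨v, by rw [em, em, g4 v hz]⟩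
    · rintro ⟨v, rfl⟩
      by_cases hz : v ∈ Z
      · exact ⟨f v, by rw [em, em, g1 v hz, Sym2.eq_swap]⟩
      · exact ⟨v, by rw [em, em, g4 v hz]⟩
  · intro T hT hTn hTi
    apply h.2.2 T hT hTn
    have him : T.image f1 = T := by
      apply Finset.eq_of_subset_of_card_le
      · intro x hx
        obtain ⟨u, hu, rfl⟩ := Finset.mem_image.1 hx
        exact hTi u hu
      · rw [Finset.card_image_of_injOn]
        intro a ha b hb hab
        rw [← g2 a (hT ha), ← g2 b (hT hb), hab]
    intro v hv
    rw [← him] at hv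
    obtain ⟨u, hu, rfl⟩ := Finset.mem_image.1 hv
    rw [g2 u (hT hu)]
    exact hu
  · intro φ
    symm
    apply Finset.prod_bij (fun v _ => f v)
    · exact fun v hv => h.2.1 v hv
    · intro a ha b hb hab
      rw [← g1 a ha, ← g1 b hb, hab]
    · intro b hb
      exact ⟨f1 b, g3 b hb, g2 b hb⟩
    · intro a ha
      rw [g1 a ha]

lemma mem_verts {f : V → V} {Z : Finset V} (h : ∀ v ∈ Z, f v ∈ Z) (v : V) :
    (∃ e ∈ Z.image (em f), v ∈ e) ↔ v ∈ Z := by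
  constructor
  · rintro ⟨e, he, hv⟩
    obtain ⟨u, hu, rfl⟩ := Finset.mem_image.1 he
    rw [em, Sym2.mem_iff] at hv
    rcases hv with rfl | rfl
    · exact hu
    · exact h u hu
  · intro hv
    exact ⟨em f v, Finset.mem_image_of_mem _ hv, by simp [em]⟩

lemma orient_dichotomy {f f0 f1 : V → V} (hf : ∀ v, f (f v) ≠ v) (hf0 : ∀ v, f0 (f0 v) ≠ v)
    (hE : Finset.univ.image (em f) = Finset.univ.image (em f0)) {Z : Finset V} (h : MinInv f0 Z)
    (g3 : ∀ v ∈ Z, f1 v ∈ Z) (g2 : ∀ v ∈ Z, f0 (f1 v) = v) :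
    (∀ v ∈ Z, f v = f0 v) ∨ (∀ v ∈ Z, f v = f1 v) := by
  have key : ∀ v, f v ≠ f0 v → f (f0 v) = v := by
    intro v hv
    have : em f0 v ∈ Finset.univ.image (em f) := by
      rw [hE]; exact Finset.mem_image_of_mem _ (Finset.mem_univ _)
    obtain ⟨u, _, hu⟩ := Finset.mem_image.1 this
    rw [em, em, Sym2.eq_iff] at hu
    rcases hu with ⟨rfl, h2⟩ | ⟨h1, h2⟩
    · exact absurd h2 hv
    · rw [← h1, h2]
  by_cases hT : (Z.filter (fun v => f v ≠ f0 v)).Nonempty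
  · right
    have := h.2.2 _ (Finset.filter_subset _ _) hT (by
      intro v hv
      simp only [Finset.mem_filter] at hv ⊢
      refine ⟨h.2.1 v hv.1, ?_⟩
      rw [key v hv.2]
      exact (hf0 v).symm)
    intro v hv
    have h5 := g3 v hv
    rw [← this] at h5
    have := key _ (Finset.mem_filter.1 h5).2
    rw [g2 v hv] at this
    exact this
  · left
    rw [Finset.not_nonempty_iff_eq_empty, Finset.filter_eq_empty_iff] at hT
    intro v hv
    simpa using hT hv

lemma orient_sum (φ : V → V → ℂ) (Γ : Finset (Sym2 V))
    (hφ : ∀ u v, s(u, v) ∈ Γ → φ u v * φ v u = 1) (n : ℕ) :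
    ∀ (W : Finset V) (f0 : V → V), Wᶜ.card = n → (∀ v, f0 (f0 v) ≠ v) →
      Finset.univ.image (em f0) = Γ → (∀ v ∈ W, f0 v ∈ W) →
      ∑ f ∈ Finset.univ.filter (fun f : V → V => (∀ v, f (f v) ≠ v) ∧
          Finset.univ.image (em f) = Γ ∧ ∀ v ∈ W, f v = f0 v), (Amat φ f W).det =
      ∏ δ ∈ (cyclesOf Γ).filter (fun δ => ∀ e ∈ δ, ∀ v ∈ e, v ∉ W), cycleWeight φ δ := by
  induction n using Nat.strong_induction_on with
  | _ n ih =>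
  intro W f0 hn hf0 hE hW
  have hφ0 : ∀ v, φ v (f0 v) * φ (f0 v) v = 1 := by
    intro v
    apply hφ
    rw [← hE]
    exact Finset.mem_image_of_mem (em f0) (Finset.mem_univ v)
  have hcyc : ∀ δ ∈ cyclesOf Γ, ∃ Z, MinInv f0 Z ∧ δ = Z.image (em f0) ∧
      cycleWeight φ δ = 2 - ∏ v ∈ Z, φ v (f0 v) - ∏ v ∈ Z, φ (f0 v) v := by
    intro δ hδ
    simp only [cyclesOf, Finset.mem_filter, Finset.mem_powerset] at hδ
    obtain ⟨Z, h1, h2, h3⟩ := cycle_weight hf0 hδ.2 (by rw [hE]; exact hδ.1)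
    exact ⟨Z, h1, h2, h3 φ (fun v _ => hφ0 v)⟩
  by_cases hU : W = Finset.univ
  · subst hU
    have e1 : Finset.univ.filter (fun f : V → V => (∀ v, f (f v) ≠ v) ∧
          Finset.univ.image (em f) = Γ ∧ ∀ v ∈ Finset.univ, f v = f0 v) = {f0} := by
      ext f
      simp only [Finset.mem_filter, Finset.mem_univ, true_and, Finset.mem_singleton, true_implies]
      constructor
      · rintro ⟨_, _, h⟩; exact funext h
      · rintro rfl; exact ⟨hf0, hE, fun _ => rfl⟩
    have e2 : (cyclesOf Γ).filter (fun δ => ∀ e ∈ δ, ∀ v ∈ e, v ∉ Finset.univ) = ∅ := by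
      rw [Finset.filter_eq_empty_iff]
      intro δ hδ h
      obtain ⟨Z, h1, h2, _⟩ := hcyc δ hδ
      obtain ⟨v, hv⟩ := h1.1
      obtain ⟨e, he, hve⟩ := (mem_verts h1.2.1 v).2 hv
      exact h e (h2 ▸ he) v hve (Finset.mem_univ _)
    rw [e1, e2, Finset.sum_singleton, Finset.prod_empty]
    have : Amat φ f0 Finset.univ = 1 := by
      ext v u
      simp [Amat, Matrix.one_apply]
    rw [this, Matrix.det_one]
  by_cases hv : ∃ v, v ∉ W ∧ f0 v ∈ W
  · obtain ⟨v, hvW, hfv⟩ := hv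
    have hlt : (insert v W)ᶜ.card < n := by
      rw [← hn]
      apply Finset.card_lt_card
      rw [Finset.compl_ssubset_compl]
      exact Finset.ssubset_insert hvW
    have hi := ih _ hlt (insert v W) f0 rfl hf0 hE (by
      intro u hu
      rw [Finset.mem_insert] at hu ⊢
      rcases hu with rfl | hu
      · exact Or.inr hfv
      · exact Or.inr (hW u hu))
    have e2 : (cyclesOf Γ).filter (fun δ => ∀ e ∈ δ, ∀ x ∈ e, x ∉ W) =
        (cyclesOf Γ).filter (fun δ => ∀ e ∈ δ, ∀ x ∈ e, x ∉ insert v W) := by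
      apply Finset.filter_congr
      intro δ hδ
      constructor
      · intro h e he x hx hxW
        rw [Finset.mem_insert] at hxW
        rcases hxW with rfl | hxW
        · obtain ⟨Z, h1, h2, _⟩ := hcyc δ hδ
          subst h2
          have hxZ := (mem_verts h1.2.1 x).1 ⟨e, he, hx⟩
          obtain ⟨e', he', hx'⟩ := (mem_verts h1.2.1 (f0 x)).2 (h1.2.1 x hxZ)
          exact h e' he' _ hx' hfv
        · exact h e he x hx hxW
      · intro h e he x hx hxW
        exact h e he x hx (Finset.mem_insert_of_mem hxW)
    rw [e2, ← hi]
    have e1 : Finset.univ.filter (fun f : V → V => (∀ v, f (f v) ≠ v) ∧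
          Finset.univ.image (em f) = Γ ∧ ∀ u ∈ W, f u = f0 u) =
        Finset.univ.filter (fun f : V → V => (∀ v, f (f v) ≠ v) ∧
          Finset.univ.image (em f) = Γ ∧ ∀ u ∈ insert v W, f u = f0 u) := by
      apply Finset.filter_congr
      intro f _
      constructor
      · rintro ⟨h1, h2, h3⟩
        refine ⟨h1, h2, ?_⟩
        intro u hu
        rw [Finset.mem_insert] at hu
        rcases hu with rfl | hu
        · have : em f0 u ∈ Finset.univ.image (em f) := by
            rw [h2, ← hE]; exact Finset.mem_image_of_mem _ (Finset.mem_univ _)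
          obtain ⟨x, _, hx⟩ := Finset.mem_image.1 this
          rw [em, em, Sym2.eq_iff] at hx
          rcases hx with ⟨rfl, h5⟩ | ⟨rfl, h5⟩
          · exact h5
          · rw [h3 _ hfv] at h5
            exact absurd (h5 ▸ hW _ hfv) hvW
        · exact h3 u hu
      · rintro ⟨h1, h2, h3⟩
        exact ⟨h1, h2, fun u hu => h3 u (Finset.mem_insert_of_mem hu)⟩
    rw [e1]
    apply Finset.sum_congr rfl
    intro f hf
    simp only [Finset.mem_filter, Finset.mem_univ, true_and] at hf
    apply det_step_v _ _ _ _ hvW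
    rw [hf.2.2 v (Finset.mem_insert_self _ _)]
    exact hfv
  · push Not at hv
    obtain ⟨Z, hZW, hZ⟩ := exists_minInv f0 Wᶜ (by
      rw [Finset.nonempty_iff_ne_empty]
      simpa using hU) (by simpa using hv)
    have hd : ∀ v ∈ Z, v ∉ W := fun v hv => by simpa using hZW hv
    obtain ⟨f1, k1, k2, k3, k4, k5, k6, k7⟩ := exists_rev hf0 hZ
    have hlt : (W ∪ Z)ᶜ.card < n := by
      rw [← hn]
      apply Finset.card_lt_card
      rw [Finset.compl_ssubset_compl]
      refine ⟨Finset.subset_union_left, ?_⟩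
      intro h
      obtain ⟨v, hv⟩ := hZ.1
      exact hd v hv (h (Finset.mem_union_right _ hv))
    have i0 := ih _ hlt (W ∪ Z) f0 rfl hf0 hE (by
      intro u hu
      rw [Finset.mem_union] at hu ⊢
      exact hu.imp (hW u) (hZ.2.1 u))
    have i1 := ih _ hlt (W ∪ Z) f1 rfl k1 (k2.trans hE) (by
      intro u hu
      rw [Finset.mem_union] at hu ⊢
      rcases hu with hu | hu
      · left; rw [k4 u (fun h => hd u h hu)]; exact hW u hu
      · right; exact k3.2.1 u hu)
    have e1 : Finset.univ.filter (fun f : V → V => (∀ v, f (f v) ≠ v) ∧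
          Finset.univ.image (em f) = Γ ∧ ∀ u ∈ W, f u = f0 u) =
        Finset.univ.filter (fun f : V → V => (∀ v, f (f v) ≠ v) ∧
          Finset.univ.image (em f) = Γ ∧ ∀ u ∈ W ∪ Z, f u = f0 u) ∪
        Finset.univ.filter (fun f : V → V => (∀ v, f (f v) ≠ v) ∧
          Finset.univ.image (em f) = Γ ∧ ∀ u ∈ W ∪ Z, f u = f1 u) := by
      ext f
      simp only [Finset.mem_filter, Finset.mem_univ, true_and, Finset.mem_union]
      constructor
      · rintro ⟨h1, h2, h3⟩
        rcases orient_dichotomy h1 hf0 (h2.trans hE.symm) hZ k3.2.1 k6 with h | h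
        · left
          exact ⟨h1, h2, fun u hu => hu.elim (h3 u) (h u)⟩
        · right
          refine ⟨h1, h2, fun u hu => hu.elim (fun hu => ?_) (h u)⟩
          rw [k4 u (fun h => hd u h hu)]
          exact h3 u hu
      · rintro (⟨h1, h2, h3⟩ | ⟨h1, h2, h3⟩)
        · exact ⟨h1, h2, fun u hu => h3 u (Or.inl hu)⟩
        · refine ⟨h1, h2, fun u hu => ?_⟩
          rw [h3 u (Or.inl hu), k4 u (fun h => hd u h hu)]
    have e1d : Disjoint (Finset.univ.filter (fun f : V → V => (∀ v, f (f v) ≠ v) ∧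
          Finset.univ.image (em f) = Γ ∧ ∀ u ∈ W ∪ Z, f u = f0 u))
        (Finset.univ.filter (fun f : V → V => (∀ v, f (f v) ≠ v) ∧
          Finset.univ.image (em f) = Γ ∧ ∀ u ∈ W ∪ Z, f u = f1 u)) := by
      rw [Finset.disjoint_left]
      intro f ha hb
      simp only [Finset.mem_filter, Finset.mem_univ, true_and] at ha hb
      obtain ⟨v, hv⟩ := hZ.1
      have a := ha.2.2 v (Finset.mem_union_right _ hv)
      have b := hb.2.2 v (Finset.mem_union_right _ hv)
      have c := k6 v hv
      rw [← b, a] at c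
      exact hf0 v c
    have s0 : ∀ g : V → V, (∀ v, g (g v) ≠ v) → MinInv g Z →
        ∀ f ∈ Finset.univ.filter (fun f : V → V => (∀ v, f (f v) ≠ v) ∧
          Finset.univ.image (em f) = Γ ∧ ∀ u ∈ W ∪ Z, f u = g u),
        (Amat φ f W).det = (1 - ∏ v ∈ Z, φ (g v) v) * (Amat φ f (W ∪ Z)).det := by
      intro g hg hgZ f hf
      simp only [Finset.mem_filter, Finset.mem_univ, true_and] at hf
      have hfg : ∀ u ∈ Z, f u = g u := fun u hu => hf.2.2 u (Finset.mem_union_right _ hu)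
      have hfZ : MinInv f Z := by
        refine ⟨hgZ.1, ?_, ?_⟩
        · intro u hu; rw [hfg u hu]; exact hgZ.2.1 u hu
        · intro T hT hTn hTi
          refine hgZ.2.2 T hT hTn ?_
          intro u hu
          rw [← hfg u (hT hu)]; exact hTi u hu
      rw [mat_step_Z φ f W Z hfZ.2.1 hd, Matrix.det_mul, det_Z φ hf.1 hfZ]
      congr 2
      exact Finset.prod_congr rfl (fun v hv => by rw [hfg v hv])
    rw [e1, Finset.sum_union e1d, Finset.sum_congr rfl (s0 f0 hf0 hZ),
      Finset.sum_congr rfl (s0 f1 k1 k3), ← Finset.mul_sum, ← Finset.mul_sum, i0, i1, k7]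
    have hδ0 : Z.image (em f0) ∈ cyclesOf Γ := by
      simp only [cyclesOf, Finset.mem_filter, Finset.mem_powerset]
      refine ⟨?_, hZ.isCycleEdgeSet hf0⟩
      rw [← hE]
      exact Finset.image_subset_image (Finset.subset_univ _)
    have e2 : (cyclesOf Γ).filter (fun δ => ∀ e ∈ δ, ∀ x ∈ e, x ∉ W) =
        insert (Z.image (em f0))
          ((cyclesOf Γ).filter (fun δ => ∀ e ∈ δ, ∀ x ∈ e, x ∉ W ∪ Z)) := by
      ext δ
      simp only [Finset.mem_filter, Finset.mem_insert]
      constructor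
      · rintro ⟨h1, h2⟩
        by_cases h : ∃ e ∈ δ, ∃ x ∈ e, x ∈ Z
        · left
          obtain ⟨e, he, x, hx, hxZ⟩ := h
          obtain ⟨Z', j1, j2, _⟩ := hcyc δ h1
          rw [j2] at he
          have := (mem_verts j1.2.1 x).1 ⟨e, he, hx⟩
          rw [j2, j1.eq_of_mem hZ this hxZ]
        · right
          push Not at h
          refine ⟨h1, ?_⟩
          intro e he x hx hxm
          rcases Finset.mem_union.1 hxm with h5 | h5
          · exact h2 e he x hx h5
          · exact h e he x hx h5
      · rintro (rfl | ⟨h1, h2⟩)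
        · refine ⟨hδ0, ?_⟩
          intro e he x hx
          exact hd x ((mem_verts hZ.2.1 x).1 ⟨e, he, hx⟩)
        · exact ⟨h1, fun e he x hx hxW => h2 e he x hx (Finset.mem_union_left _ hxW)⟩
    rw [e2, Finset.prod_insert]
    · obtain ⟨Z', j1, j2, j3⟩ := hcyc _ hδ0
      have : Z' = Z := by
        obtain ⟨v, hv⟩ := hZ.1
        have hv2 := (mem_verts hZ.2.1 v).2 hv
        rw [j2] at hv2
        exact j1.eq_of_mem hZ ((mem_verts j1.2.1 v).1 hv2) hv
      rw [j3, this]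
      ring
    · simp only [Finset.mem_filter, not_and]
      intro _ h
      obtain ⟨v, hv⟩ := hZ.1
      obtain ⟨e, he, hve⟩ := (mem_verts hZ.2.1 v).2 hv
      exact h e he v hve (Finset.mem_union_right _ hv)

lemma crsf_of_orient (G : SimpleGraph V) {f : V → V} (hf : ∀ v, f (f v) ≠ v)
    (hadj : ∀ v, G.Adj v (f v)) : IsCRSF G (Finset.univ.image (em f)) := by
  constructor
  · intro e he
    simp only [Finset.coe_image, Set.mem_image] at he
    obtain ⟨v, _, rfl⟩ := he
    exact hadj v
  · intro C
    have hst : ∀ v, v ∈ C.supp → f v ∈ C.supp := by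
      intro v hv
      rw [SimpleGraph.ConnectedComponent.mem_supp_iff] at hv ⊢
      rw [← hv]
      apply SimpleGraph.ConnectedComponent.sound
      apply SimpleGraph.Adj.reachable
      rw [SimpleGraph.fromEdgeSet_adj]
      refine ⟨?_, ne_of_N2 hf v⟩
      rw [Sym2.eq_swap]
      exact Finset.mem_coe.2 (Finset.mem_image_of_mem (em f) (Finset.mem_univ v))
    rw [← Finset.card_image_of_injective C.supp.toFinite.toFinset (em_inj hf)]
    congr 1
    ext e
    simp only [Finset.mem_filter, Finset.mem_image, Finset.mem_univ, true_and,
      Set.Finite.mem_toFinset]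
    constructor
    · rintro ⟨⟨v, rfl⟩, h⟩
      exact ⟨v, h v (by simp [em]), rfl⟩
    · rintro ⟨v, hv, rfl⟩
      refine ⟨⟨v, rfl⟩, ?_⟩
      intro u hu
      rw [em, Sym2.mem_iff] at hu
      rcases hu with rfl | rfl
      · exact hv
      · exact hst v hv

lemma dist_step {H : SimpleGraph V} {v r : V} (h : H.Reachable v r) (hne : v ≠ r) :
    ∃ u, H.Adj v u ∧ H.dist u r < H.dist v r := by
  obtain ⟨p, hp⟩ := h.exists_walk_length_eq_dist
  cases p with
  | nil => exact absurd rfl hne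
  | cons hadj q =>
    refine ⟨_, hadj, ?_⟩
    rw [← hp, SimpleGraph.Walk.length_cons]
    exact Nat.lt_succ_of_le (SimpleGraph.dist_le q)

lemma hall_comp (Γ : Finset (Sym2 V))
    (C : (SimpleGraph.fromEdgeSet (↑Γ : Set (Sym2 V))).ConnectedComponent)
    (hC : (Γ.filter fun e => ∀ v ∈ e, v ∈ C.supp).card = C.supp.toFinite.toFinset.card) :
    ∃ F : {v // v ∈ C.supp} → Sym2 V, Function.Injective F ∧
      ∀ v, F v ∈ Γ.filter (fun e => v.1 ∈ e) := by
  rw [← Finset.all_card_le_biUnion_card_iff_exists_injective]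
  intro S
  by_cases hS : S = Finset.univ
  · subst hS
    have h1 : (Finset.univ : Finset {v // v ∈ C.supp}).card = C.supp.toFinite.toFinset.card := by
      rw [← Finset.card_map (Function.Embedding.subtype _)]
      congr 1
      ext v
      simp
    rw [h1, ← hC]
    apply Finset.card_le_card
    intro e he
    simp only [Finset.mem_filter] at he
    obtain ⟨he, h⟩ := he
    induction e using Sym2.ind with
    | _ a b =>
      rw [Finset.mem_biUnion]
      exact ⟨⟨a, h a (by simp)⟩, Finset.mem_univ _, by simp [he]⟩
  · obtain ⟨r, hr⟩ : ∃ r, r ∉ S := by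
      by_contra h
      push Not at h
      exact hS (Finset.eq_univ_iff_forall.2 h)
    have hex : ∀ v : {v // v ∈ C.supp}, ∃ u, v ∈ S →
        (SimpleGraph.fromEdgeSet (↑Γ : Set (Sym2 V))).Adj v.1 u ∧
        (SimpleGraph.fromEdgeSet (↑Γ : Set (Sym2 V))).dist u r.1 <
          (SimpleGraph.fromEdgeSet (↑Γ : Set (Sym2 V))).dist v.1 r.1 := by
      intro v
      by_cases hv : v ∈ S
      · have hreach : (SimpleGraph.fromEdgeSet (↑Γ : Set (Sym2 V))).Reachable v.1 r.1 := by
          apply SimpleGraph.ConnectedComponent.exact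
          have h1 := v.2
          have h2 := r.2
          rw [SimpleGraph.ConnectedComponent.mem_supp_iff] at h1 h2
          rw [h1, h2]
        obtain ⟨u, hu⟩ := dist_step hreach (fun h => hr (Subtype.ext h ▸ hv))
        exact ⟨u, fun _ => hu⟩
      · exact ⟨v.1, fun h => absurd h hv⟩
    choose p hp using hex
    apply Finset.card_le_card_of_injOn (fun v => s(v.1, p v))
    · intro v hv
      have := (hp v hv).1
      rw [SimpleGraph.fromEdgeSet_adj] at this
      rw [Finset.mem_coe, Finset.mem_biUnion]
      refine ⟨v, hv, ?_⟩
      rw [Finset.mem_filter]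
      exact ⟨by simpa using this.1, by simp⟩
    · intro v hv u hu huv
      simp only [Sym2.eq_iff] at huv
      rcases huv with ⟨h, _⟩ | ⟨h1, h2⟩
      · exact Subtype.ext h
      · have a := (hp v hv).2
        have b := (hp u hu).2
        rw [← h1] at b
        rw [h2] at a
        omega

lemma orient_of_crsf (G : SimpleGraph V) {Γ : Finset (Sym2 V)} (h : IsCRSF G Γ) :
    ∃ f : V → V, (∀ v, f (f v) ≠ v) ∧ Finset.univ.image (em f) = Γ := by
  obtain ⟨hG, hC⟩ := h
  set H := SimpleGraph.fromEdgeSet (↑Γ : Set (Sym2 V)) with hH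
  have hhall : ∀ C : H.ConnectedComponent, ∃ F : {v // v ∈ C.supp} → Sym2 V,
      Function.Injective F ∧ ∀ v, F v ∈ Γ.filter (fun e => v.1 ∈ e) :=
    fun C => hall_comp Γ C (hC C)
  choose F hFi hFm using hhall
  have hmem : ∀ v, v ∈ (H.connectedComponentMk v).supp := by
    intro v; rfl
  have hF : ∀ v, ∃ u, s(v, u) = F (H.connectedComponentMk v) ⟨v, hmem v⟩ := by
    intro v
    have := hFm (H.connectedComponentMk v) ⟨v, hmem v⟩
    rw [Finset.mem_filter] at this
    obtain ⟨u, hu⟩ := this.2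
    exact ⟨u, hu.symm⟩
  choose f hf using hF
  have hΓ : ∀ v, em f v ∈ Γ := by
    intro v
    rw [em, hf]
    exact (Finset.mem_filter.1 (hFm (H.connectedComponentMk v) ⟨v, hmem v⟩)).1
  have hne : ∀ v, f v ≠ v := by
    intro v hv
    have h1 : s(v, f v) ∈ G.edgeSet := hG (hΓ v)
    rw [SimpleGraph.mem_edgeSet] at h1
    exact h1.ne hv.symm
  have hadj : ∀ v, H.Adj v (f v) := by
    intro v
    rw [hH, SimpleGraph.fromEdgeSet_adj]
    exact ⟨hΓ v, (hne v).symm⟩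
  have hcc : ∀ v, H.connectedComponentMk (f v) = H.connectedComponentMk v := by
    intro v
    exact SimpleGraph.ConnectedComponent.sound (hadj v).symm.reachable
  have hF2 : ∀ (C C' : H.ConnectedComponent) (a : {v // v ∈ C.supp}) (b : {v // v ∈ C'.supp}),
      C = C' → F C a = F C' b → a.1 = b.1 := by
    rintro C _ a b rfl hab
    rw [hFi C hab]
  have hN2 : ∀ v, f (f v) ≠ v := by
    intro v hv
    have h1 := hf (f v)
    rw [hv, Sym2.eq_swap, hf v] at h1
    have := hF2 _ _ _ _ (hcc v).symm h1
    exact hne v this.symm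
  refine ⟨f, hN2, ?_⟩
  apply Finset.Subset.antisymm
  · intro e he
    obtain ⟨v, _, rfl⟩ := Finset.mem_image.1 he
    exact hΓ v
  · intro e he
    induction e using Sym2.ind with
    | _ a b =>
    set C := H.connectedComponentMk a with hCa
    have hsub : C.supp.toFinite.toFinset.image (em f) ⊆ Γ.filter fun e => ∀ v ∈ e, v ∈ C.supp := by
      intro e he
      obtain ⟨v, hv, rfl⟩ := Finset.mem_image.1 he
      rw [Set.Finite.mem_toFinset] at hv
      rw [Finset.mem_filter]
      refine ⟨hΓ v, ?_⟩
      intro u hu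
      rw [em, Sym2.mem_iff] at hu
      rcases hu with rfl | rfl
      · exact hv
      · rw [SimpleGraph.ConnectedComponent.mem_supp_iff] at hv ⊢
        rw [hcc, hv]
    have heq := Finset.eq_of_subset_of_card_le hsub (by
      rw [hC C, Finset.card_image_of_injective _ (em_inj hN2)])
    have hab : s(a, b) ∈ Γ.filter fun e => ∀ v ∈ e, v ∈ C.supp := by
      rw [Finset.mem_filter]
      refine ⟨he, ?_⟩
      intro v hv
      rw [Sym2.mem_iff] at hv
      rcases hv with rfl | rfl
      · exact hmem v
      · rw [SimpleGraph.ConnectedComponent.mem_supp_iff, hCa]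
        apply SimpleGraph.ConnectedComponent.sound
        apply SimpleGraph.Adj.reachable
        rw [hH, SimpleGraph.fromEdgeSet_adj]
        have h1 : s(a, v) ∈ G.edgeSet := hG he
        rw [SimpleGraph.mem_edgeSet] at h1
        exact ⟨by rw [Sym2.eq_swap]; exact he, h1.ne.symm⟩
    rw [← heq] at hab
    obtain ⟨v, _, hv⟩ := Finset.mem_image.1 hab
    exact Finset.mem_image.2 ⟨v, Finset.mem_univ _, hv⟩

lemma cycle_orient {δ : Finset (Sym2 V)} (hδ : IsCycleEdgeSet δ) :
    ∃ g : V → V, (∀ v, (∃ e ∈ δ, v ∈ e) → s(v, g v) ∈ δ ∧ g (g v) ≠ v) ∧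
      (∀ e ∈ δ, ∃ v, v ∈ e ∧ s(v, g v) = e) ∧ δ.Nonempty := by
  obtain ⟨v, w, hw, rfl⟩ := hδ
  obtain ⟨n, y, hn, hper, hinj, hedge, -⟩ := cycle_param w hw
  have hper' : ∀ k i, y (i + n * k) = y i := by
    intro k
    induction k with
    | zero => intro i; simp
    | succ k ih => intro i; rw [Nat.mul_succ, ← add_assoc, hper, ih]
  have hmod : ∀ i, y (i % n) = y i := by
    intro i
    conv_rhs => rw [← Nat.mod_add_div i n]
    rw [hper']
  have hmod1 : ∀ i, y (i % n + 1) = y (i + 1) := by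
    intro i
    conv_rhs => rw [← Nat.mod_add_div i n, add_right_comm]
    rw [hper']
  have hmem : ∀ e, e ∈ w.edges.toFinset ↔ ∃ i, s(y i, y (i + 1)) = e := by
    intro e
    rw [hedge]
    simp only [Finset.mem_image, Finset.mem_range]
    constructor
    · rintro ⟨i, _, rfl⟩; exact ⟨i, rfl⟩
    · rintro ⟨i, rfl⟩
      exact ⟨i % n, Nat.mod_lt _ (by omega), by rw [hmod, hmod1]⟩
  have hback : ∀ i, y (i + 2) ≠ y i := by
    intro i h
    rw [← hmod (i + 2), ← hmod i] at h
    have := hinj (Nat.mod_lt _ (by omega)) (Nat.mod_lt _ (by omega)) h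
    have h5 : (i + 2) ≡ i + 0 [MOD n] := this
    have h6 := Nat.ModEq.add_left_cancel' i h5
    have h7 : 2 % n = 0 % n := h6
    rw [Nat.mod_eq_of_lt (by omega)] at h7
    simp at h7
  have hsucc : ∀ i j, y i = y j → y (i + 1) = y (j + 1) := by
    intro i j hij
    rw [← hmod i, ← hmod j] at hij
    have := hinj (Nat.mod_lt _ (by omega)) (Nat.mod_lt _ (by omega)) hij
    rw [← hmod1 i, ← hmod1 j, this]
  have hg : ∀ v, ∃ u, ∀ i, y i = v → u = y (i + 1) := by
    intro v
    by_cases h : ∃ i, y i = v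
    · obtain ⟨i, rfl⟩ := h
      exact ⟨y (i + 1), fun j hj => (hsucc j i hj).symm⟩
    · exact ⟨v, fun i hi => absurd ⟨i, hi⟩ h⟩
  choose g hg using hg
  have hgy : ∀ i, g (y i) = y (i + 1) := fun i => hg (y i) i rfl
  refine ⟨g, ?_, ?_, ⟨_, (hmem _).2 ⟨0, rfl⟩⟩⟩
  · rintro v ⟨e, he, hv⟩
    have : ∃ i, y i = v := by
      obtain ⟨i, rfl⟩ := (hmem e).1 he
      rw [Sym2.mem_iff] at hv
      rcases hv with rfl | rfl
      · exact ⟨i, rfl⟩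
      · exact ⟨i + 1, rfl⟩
    obtain ⟨i, rfl⟩ := this
    rw [hgy, hgy]
    exact ⟨(hmem _).2 ⟨i, rfl⟩, hback i⟩
  · intro e he
    obtain ⟨i, rfl⟩ := (hmem e).1 he
    exact ⟨y i, by simp, by rw [hgy]⟩

lemma exists_g (k : ℕ) (γ : Fin k → Finset (Sym2 V))
    (hγ : ∀ j, IsCycleEdgeSet (γ j))
    (hγdisj : ∀ j j', j ≠ j' → ∀ v : V,
      (∃ e ∈ γ j, v ∈ e) → (∃ e ∈ γ j', v ∈ e) → False)
    (W : Finset V) (hW : ∀ v, v ∈ W ↔ ∃ j, ∃ e ∈ γ j, v ∈ e) :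
    ∃ g : V → V, (∀ v ∈ W, g v ∈ W) ∧ (∀ v ∈ W, g (g v) ≠ v) ∧
      W.image (em g) = Finset.univ.biUnion γ := by
  choose gg h1 h2 h3 using fun j => cycle_orient (hγ j)
  have hg : ∀ v, ∃ u, ∀ j, (∃ e ∈ γ j, v ∈ e) → u = gg j v := by
    intro v
    by_cases h : ∃ j, ∃ e ∈ γ j, v ∈ e
    · obtain ⟨j, hj⟩ := h
      refine ⟨gg j v, fun j' hj' => ?_⟩
      by_cases hjj : j = j'
      · rw [hjj]
      · exact (hγdisj j j' hjj v hj hj').elim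
    · exact ⟨v, fun j hj => absurd ⟨j, hj⟩ h⟩
  choose g hg using hg
  have hst : ∀ j v, (∃ e ∈ γ j, v ∈ e) → ∃ e ∈ γ j, g v ∈ e := by
    intro j v hv
    rw [hg v j hv]
    exact ⟨_, (h1 j v hv).1, by simp⟩
  refine ⟨g, ?_, ?_, ?_⟩
  · intro v hv
    obtain ⟨j, hj⟩ := (hW v).1 hv
    exact (hW _).2 ⟨j, hst j v hj⟩
  · intro v hv
    obtain ⟨j, hj⟩ := (hW v).1 hv
    rw [hg _ j (hst j v hj), hg v j hj]
    exact (h1 j v hj).2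
  · ext e
    simp only [Finset.mem_image, Finset.mem_biUnion, Finset.mem_univ, true_and]
    constructor
    · rintro ⟨v, hv, rfl⟩
      obtain ⟨j, hj⟩ := (hW v).1 hv
      refine ⟨j, ?_⟩
      rw [em, hg v j hj]
      exact (h1 j v hj).1
    · rintro ⟨j, he⟩
      obtain ⟨v, hv, hve⟩ := h2 j e he
      refine ⟨v, (hW v).2 ⟨j, e, he, hv⟩, ?_⟩
      rw [em, hg v j ⟨e, he, hv⟩, hve]

/-- The Laplacian with the rows of `W` replaced by unit vectors. -/
def Bmat (c : V → V → ℝ) (φ : V → V → ℂ) (W : Finset V) : Matrix V V ℂ :=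
  Matrix.of fun v u => if v ∈ W then (if v = u then 1 else 0) else lineLaplacian c φ v u

lemma det_Bmat (c : V → V → ℝ) (φ : V → V → ℂ) (W : Finset V) :
    (Bmat c φ W).det = dirichletDet c φ W := by
  rw [Matrix.twoBlockTriangular_det (Bmat c φ W) (fun v => v ∉ W)]
  · have h1 : (Bmat c φ W).toSquareBlockProp (fun v => ¬ v ∉ W) = 1 := by
      ext i j
      have := i.2
      simp only [not_not] at this
      simp [Matrix.toSquareBlockProp_def, Bmat, this, Matrix.one_apply, Subtype.ext_iff]
    have h2 : (Bmat c φ W).toSquareBlockProp (fun v => v ∉ W) =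
        (lineLaplacian c φ).submatrix (fun v : {a // a ∉ W} => (v : V))
          (fun v : {a // a ∉ W} => (v : V)) := by
      ext i j
      simp [Matrix.toSquareBlockProp_def, Bmat, i.2]
    rw [h1, h2, Matrix.det_one, mul_one, dirichletDet]
  · intro i hi j hj
    simp only [not_not] at hi
    have : i ≠ j := fun h => hj (h ▸ hi)
    simp [Bmat, hi, this]

lemma det_expand (c : V → V → ℝ) (φ : V → V → ℂ) (hcd : ∀ v, c v v = 0) (W : Finset V)
    (g : V → V) :
    dirichletDet c φ W = ∑ f ∈ Finset.univ.filter (fun f : V → V => ∀ v ∈ W, f v = g v),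
      (∏ v ∈ Wᶜ, (c v (f v) : ℂ)) * (Amat φ f W).det := by
  rw [← det_Bmat]
  set A : V → Finset V := fun v => if v ∈ W then {g v} else Finset.univ with hA
  set R : V → V → V → ℂ := fun v u x => if v ∈ W then (if v = x then 1 else 0) else
    (c v u : ℂ) * ((if v = x then 1 else 0) - if u = x then φ u v else 0) with hR
  have hB : Bmat c φ W = fun v => ∑ u ∈ A v, R v u := by
    ext v x
    rw [Finset.sum_apply]
    by_cases hv : v ∈ W
    · simp [Bmat, hA, hR, hv]
    · simp only [Bmat, hA, hR, hv, if_false, Matrix.of_apply, lineLaplacian, mul_sub,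
        Finset.sum_sub_distrib]
      by_cases hvx : v = x
      · subst hvx
        simp [hcd]
      · simp [hvx]
  have hpi : Fintype.piFinset A = Finset.univ.filter (fun f : V → V => ∀ v ∈ W, f v = g v) := by
    ext f
    simp only [Fintype.mem_piFinset, Finset.mem_filter, Finset.mem_univ, true_and]
    apply forall_congr'
    intro v
    by_cases hv : v ∈ W <;> simp [hA, hv]
  have hdet : (Bmat c φ W).det =
      (Matrix.detRowAlternating (R := ℂ) (n := V)).toMultilinearMap (fun v => ∑ u ∈ A v, R v u) := by
    rw [← hB]; rfl
  rw [hdet, MultilinearMap.map_sum_finset, hpi]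
  apply Finset.sum_congr rfl
  intro f hf
  have e1 : (fun v => R v (f v)) = Matrix.of fun v x =>
      (if v ∈ W then 1 else (c v (f v) : ℂ)) * Amat φ f W v x := by
    ext v x
    by_cases hv : v ∈ W <;> simp [hR, Amat, hv]
  have e2 : ∏ v ∈ Wᶜ, (c v (f v) : ℂ) = ∏ v, if v ∈ W then 1 else (c v (f v) : ℂ) := by
    rw [← Finset.prod_subset (Finset.subset_univ Wᶜ)]
    · apply Finset.prod_congr rfl
      intro v hv
      rw [Finset.mem_compl] at hv
      simp [hv]
    · intro v _ hv
      simp only [Finset.mem_compl, not_not] at hv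
      simp [hv]
  rw [e2, ← Matrix.det_mul_column, ← e1]
  rfl

lemma det_two_cycle (φ : V → V → ℂ) (f : V → V) (W : Finset V) (v : V) (hv : v ∉ W)
    (hfv : f v ∉ W) (hne : f v ≠ v) (h2 : f (f v) = v) (hφ : φ v (f v) * φ (f v) v = 1) :
    (Amat φ f W).det = 0 := by
  have : (Amat φ f W).det = (Matrix.updateRow (Amat φ f W) v
      ((-φ (f v) v) • (Amat φ f W) (f v))).det := by
    congr 1
    ext x u
    by_cases hx : x = v
    · subst hx
      rw [Matrix.updateRow_self]
      simp only [Amat, Matrix.of_apply, Pi.smul_apply, smul_eq_mul, hv, hfv, if_false, h2]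
      by_cases h1 : x = u
      · subst h1
        simp only [hne, if_true, if_false]
        linear_combination -hφ
      · by_cases h3 : f x = u <;> simp [h1, h3]
    · rw [Matrix.updateRow_ne hx]
  rw [this, Matrix.det_updateRow_smul]
  have h0 : ((Amat φ f W).updateRow v ((Amat φ f W) (f v))).det = 0 := by
    apply Matrix.det_zero_of_row_eq hne.symm
    rw [Matrix.updateRow_self, Matrix.updateRow_ne hne]
  rw [h0, mul_zero]
theorem prob_contains_cycles
    (G : SimpleGraph V) (hG : G.Connected)
    (c : V → V → ℝ) (φ : V → V → ℂ)
    (hc_symm : ∀ v w, c v w = c w v)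
    (hc_pos : ∀ v w, G.Adj v w → 0 < c v w)
    (hc_zero : ∀ v w, ¬G.Adj v w → c v w = 0)
    (hφ_unit : ∀ v w, G.Adj v w → ‖φ v w‖ = 1)
    (hφ_symm : ∀ v w, G.Adj v w → φ w v = starRingEnd ℂ (φ v w))
    (hdet : (lineLaplacian c φ).det ≠ 0)
    (k : ℕ) (γ : Fin k → Finset (Sym2 V))
    (hγ : ∀ j, IsCycleEdgeSet (γ j) ∧ ↑(γ j) ⊆ G.edgeSet)
    (hγdisj : ∀ j j', j ≠ j' → ∀ v : V,
      (∃ e ∈ γ j, v ∈ e) → (∃ e ∈ γ j', v ∈ e) → False)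
    (W : Finset V) (hW : ∀ v, v ∈ W ↔ ∃ j, ∃ e ∈ γ j, v ∈ e) :
    (∑ Γ ∈ Finset.univ.filter
        (fun Γ : Finset (Sym2 V) => IsCRSF G Γ ∧ ∀ j, γ j ⊆ Γ),
        (∏ e ∈ Γ, (edgeC c hc_symm e : ℂ)) * ∏ δ ∈ cyclesOf Γ, cycleWeight φ δ) /
        (lineLaplacian c φ).det
      = (∏ e ∈ Finset.univ.biUnion γ, (edgeC c hc_symm e : ℂ)) *
          (∏ j, cycleWeight φ (γ j)) * dirichletDet c φ W /
          (lineLaplacian c φ).det := by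
  congr 1
  have hγc : ∀ j, IsCycleEdgeSet (γ j) := fun j => (hγ j).1
  have hφ1 : ∀ u v, G.Adj u v → φ u v * φ v u = 1 := by
    intro u v h
    rw [hφ_symm u v h, Complex.mul_conj, Complex.normSq_eq_norm_sq, hφ_unit u v h]
    norm_num
  have hcd : ∀ v, c v v = 0 := fun v => hc_zero v v (G.loopless.irrefl v)
  obtain ⟨g, hgW, hg2, hgE⟩ := exists_g k γ hγc hγdisj W hW
  have hgadj : ∀ v ∈ W, G.Adj v (g v) := by
    intro v hv
    have : em g v ∈ Finset.univ.biUnion γ := hgE ▸ Finset.mem_image_of_mem _ hv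
    obtain ⟨j, _, hj⟩ := Finset.mem_biUnion.1 this
    exact (hγ j).2 hj
  have hginj : Set.InjOn (em g) W := by
    intro a ha b hb hab
    unfold em at hab
    rw [Sym2.eq_iff] at hab
    rcases hab with ⟨h1, _⟩ | ⟨h1, h2⟩
    · exact h1
    · exfalso
      apply hg2 a ha
      rw [h2, h1]
  -- functions with `f = g` on `W` and no two-cycle off `W`
  have hN2W : ∀ f : V → V, (∀ v ∈ W, f v = g v) → ∀ v, f (f v) = v → v ∉ W ∧ f v ∉ W := by
    intro f hf v hv
    have h1 : v ∉ W := by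
      intro hvW
      apply hg2 v hvW
      rw [hf v hvW, hf _ (hgW v hvW)] at hv
      exact hv
    refine ⟨h1, ?_⟩
    intro h2
    apply h1
    rw [← hv, hf _ h2]
    exact hgW _ h2
  set F : Finset (V → V) := Finset.univ.filter (fun f : V → V =>
    (∀ v, f (f v) ≠ v) ∧ (∀ v, G.Adj v (f v)) ∧ ∀ v ∈ W, f v = g v) with hF
  have hD : dirichletDet c φ W = ∑ f ∈ F, (∏ v ∈ Wᶜ, (c v (f v) : ℂ)) * (Amat φ f W).det := by
    rw [det_expand c φ hcd W g]
    symm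
    apply Finset.sum_subset
    · intro f hf
      simp only [hF, Finset.mem_filter, Finset.mem_univ, true_and] at hf ⊢
      exact hf.2.2
    · intro f hf hfF
      simp only [Finset.mem_filter, Finset.mem_univ, true_and] at hf
      by_cases hadj : ∀ v, G.Adj v (f v)
      · have : ∃ v, f (f v) = v := by
          by_contra h
          push Not at h
          apply hfF
          simp only [hF, Finset.mem_filter, Finset.mem_univ, true_and]
          exact ⟨h, hadj, hf⟩
        obtain ⟨v, hv⟩ := this
        obtain ⟨h1, h2⟩ := hN2W f hf v hv
        rw [det_two_cycle φ f W v h1 h2 (hadj v).ne.symm hv (hφ1 _ _ (hadj v)), mul_zero]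
      · push Not at hadj
        obtain ⟨v, hv⟩ := hadj
        have hvW : v ∈ Wᶜ := by
          rw [Finset.mem_compl]
          intro h
          rw [hf v h] at hv
          exact hv (hgadj v h)
        rw [Finset.prod_eq_zero hvW, zero_mul]
        rw [hc_zero _ _ hv]; simp
  have hPK : ∀ f ∈ F, (∏ e ∈ Finset.univ.biUnion γ, (edgeC c hc_symm e : ℂ)) *
      (∏ v ∈ Wᶜ, (c v (f v) : ℂ)) =
      ∏ e ∈ Finset.univ.image (em f), (edgeC c hc_symm e : ℂ) := by
    intro f hf
    simp only [hF, Finset.mem_filter, Finset.mem_univ, true_and] at hf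
    rw [← hgE, Finset.prod_image hginj, Finset.prod_image (em_inj hf.1).injOn,
      ← Finset.prod_mul_prod_compl W]
    congr 1
    apply Finset.prod_congr rfl
    intro v hv
    rw [em, em, hf.2.2 v hv]
  rw [mul_right_comm, hD, Finset.mul_sum]
  have hmaps : ∀ f ∈ F, Finset.univ.image (em f) ∈ Finset.univ.filter
        (fun Γ : Finset (Sym2 V) => IsCRSF G Γ ∧ ∀ j, γ j ⊆ Γ) := by
    intro f hf
    simp only [hF, Finset.mem_filter, Finset.mem_univ, true_and] at hf ⊢
    refine ⟨crsf_of_orient G hf.1 hf.2.1, ?_⟩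
    intro j e he
    have : e ∈ W.image (em g) := hgE ▸ Finset.mem_biUnion.2 ⟨j, Finset.mem_univ _, he⟩
    obtain ⟨v, hv, rfl⟩ := Finset.mem_image.1 this
    refine Finset.mem_image.2 ⟨v, Finset.mem_univ _, ?_⟩
    rw [em, em, hf.2.2 v hv]
  rw [← Finset.sum_fiberwise_of_maps_to hmaps, Finset.sum_mul]
  apply Finset.sum_congr rfl
  intro Γ hΓ
  simp only [Finset.mem_filter, Finset.mem_univ, true_and] at hΓ
  obtain ⟨hcr, hγΓ⟩ := hΓ
  obtain ⟨f', hf'2, hf'E⟩ := orient_of_crsf G hcr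
  -- cycles of `Γ`
  have hcyc : ∀ δ ∈ cyclesOf Γ, ∃ Z, MinInv f' Z ∧ δ = Z.image (em f') := by
    intro δ hδ
    simp only [cyclesOf, Finset.mem_filter, Finset.mem_powerset] at hδ
    obtain ⟨Z, h1, h2, _⟩ := cycle_weight hf'2 hδ.2 (by rw [hf'E]; exact hδ.1)
    exact ⟨Z, h1, h2⟩
  have hγcyc : ∀ j, γ j ∈ cyclesOf Γ := by
    intro j
    simp only [cyclesOf, Finset.mem_filter, Finset.mem_powerset]
    exact ⟨hγΓ j, hγc j⟩
  have hf'W : W.image (em f') = Finset.univ.biUnion γ := by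
    ext e
    simp only [Finset.mem_image, Finset.mem_biUnion, Finset.mem_univ, true_and]
    constructor
    · rintro ⟨v, hv, rfl⟩
      obtain ⟨j, hj⟩ := (hW v).1 hv
      obtain ⟨Z, h1, h2⟩ := hcyc _ (hγcyc j)
      rw [h2] at hj
      refine ⟨j, ?_⟩
      rw [h2]
      exact Finset.mem_image_of_mem _ ((mem_verts h1.2.1 v).1 hj)
    · rintro ⟨j, he⟩
      obtain ⟨Z, h1, h2⟩ := hcyc _ (hγcyc j)
      have he' := he
      rw [h2] at he'
      obtain ⟨v, hv, rfl⟩ := Finset.mem_image.1 he'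
      exact ⟨v, (hW v).2 ⟨j, _, he, by simp [em]⟩, rfl⟩
  obtain ⟨f0, hf0W, hf0c⟩ : ∃ f0 : V → V, (∀ v ∈ W, f0 v = g v) ∧ ∀ v, v ∉ W → f0 v = f' v :=
    ⟨fun v => if v ∈ W then g v else f' v, fun v hv => by simp [hv], fun v hv => by simp [hv]⟩
  have hf02 : ∀ v, f0 (f0 v) ≠ v := by
    intro v hv
    obtain ⟨h1, h2⟩ := hN2W f0 hf0W v hv
    rw [hf0c _ h2, hf0c _ h1] at hv
    exact hf'2 v hv
  have hf0E : Finset.univ.image (em f0) = Γ := by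
    rw [← hf'E, ← Finset.union_compl W, Finset.image_union, Finset.image_union, hf'W, ← hgE]
    congr 1
    · apply Finset.image_congr
      intro v hv
      rw [em, em, hf0W v hv]
    · apply Finset.image_congr
      intro v hv
      rw [em, em, hf0c v (by simpa using hv)]
  have hsum := orient_sum φ Γ (fun u v h => hφ1 u v (hcr.1 h)) _ W f0 rfl hf02 hf0E
    (fun v hv => by rw [hf0W v hv]; exact hgW v hv)
  have hfib : F.filter (fun f => Finset.univ.image (em f) = Γ) =
      Finset.univ.filter (fun f : V → V => (∀ v, f (f v) ≠ v) ∧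
          Finset.univ.image (em f) = Γ ∧ ∀ v ∈ W, f v = f0 v) := by
    ext f
    simp only [hF, Finset.mem_filter, Finset.mem_univ, true_and]
    constructor
    · rintro ⟨⟨h1, _, h3⟩, h4⟩
      exact ⟨h1, h4, fun v hv => by rw [h3 v hv, hf0W v hv]⟩
    · rintro ⟨h1, h4, h3⟩
      refine ⟨⟨h1, ?_, fun v hv => by rw [h3 v hv, hf0W v hv]⟩, h4⟩
      intro v
      have : em f v ∈ Γ := h4 ▸ Finset.mem_image_of_mem _ (Finset.mem_univ v)
      exact hcr.1 this
  have hterm : ∀ f ∈ F.filter (fun f => Finset.univ.image (em f) = Γ),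
      (∏ e ∈ Finset.univ.biUnion γ, (edgeC c hc_symm e : ℂ)) *
        ((∏ v ∈ Wᶜ, (c v (f v) : ℂ)) * (Amat φ f W).det) =
      (∏ e ∈ Γ, (edgeC c hc_symm e : ℂ)) * (Amat φ f W).det := by
    intro f hf
    rw [Finset.mem_filter] at hf
    rw [← mul_assoc, hPK f hf.1, hf.2]
  rw [Finset.sum_congr rfl hterm, ← Finset.mul_sum, hfib, hsum, mul_assoc]
  congr 1
  rw [← Finset.prod_filter_mul_prod_filter_not (cyclesOf Γ)
    (fun δ => ∀ e ∈ δ, ∀ v ∈ e, v ∉ W)]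
  congr 1
  have himg : (cyclesOf Γ).filter (fun δ => ¬ ∀ e ∈ δ, ∀ v ∈ e, v ∉ W) =
      Finset.univ.image γ := by
    ext δ
    simp only [Finset.mem_filter, Finset.mem_image, Finset.mem_univ, true_and]
    constructor
    · rintro ⟨h1, h2⟩
      push Not at h2
      obtain ⟨e, he, v, hv, hvW⟩ := h2
      obtain ⟨j, hj⟩ := (hW v).1 hvW
      refine ⟨j, ?_⟩
      obtain ⟨Z, a1, a2⟩ := hcyc δ h1
      obtain ⟨Z', b1, b2⟩ := hcyc _ (hγcyc j)
      rw [b2] at hj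
      rw [a2] at he
      rw [a2, b2, b1.eq_of_mem a1 ((mem_verts b1.2.1 v).1 hj)
        ((mem_verts a1.2.1 v).1 ⟨e, he, hv⟩)]
    · rintro ⟨j, rfl⟩
      refine ⟨hγcyc j, ?_⟩
      intro h
      obtain ⟨_, _, _, e, he⟩ := cycle_orient (hγc j)
      induction e using Sym2.ind with
      | _ a b => exact h _ he a (by simp) ((hW a).2 ⟨j, _, he, by simp⟩)
  rw [himg, Finset.prod_image]
  intro j _ j' _ hjj
  by_contra hne
  obtain ⟨_, _, _, e, he⟩ := cycle_orient (hγc j)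
  induction e using Sym2.ind with
  | _ a b => exact hγdisj j j' hne a ⟨_, he, by simp⟩ ⟨_, hjj ▸ he, by simp⟩

end CRSFStmt
end
end

section
/- Let G = (V,E) be a finite connected graph with conductances c : E → ℝ_{>0}, and let α assign to each simple cycle γ of G a weight α(γ) ∈ [0,1]. Let S_1 ⊆ S_2 be nonempty proper subsets of V, and for i = 1,2 let μ_i be the probability measure on essential CRSFs of G with Dirichlet boundary S_i giving Γ probability proportional to Π_{e∈Γ} c(e) · Π_{cycles η⊆Γ} α(η). Then for any simple cycle γ of G that is vertex-disjoint from S_2, μ_1(γ is a cycle of the random essential CRSF) ≥ μ_2(γ is a cycle of the random essential CRSF). -/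
/-!
STATEMENT 8 (stochastic domination).  For Dirichlet boundaries `S₁ ⊆ S₂` and a simple
cycle `γ` vertex-disjoint from `S₂`, the probability that `γ` is a cycle of the random
essential CRSF is larger for boundary `S₁` than for boundary `S₂`.
-/

open Classical

noncomputable section

namespace CRSFStmt

variable {V : Type*} [Fintype V] [DecidableEq V]

/-- `Γ` is an essential CRSF of `G` with Dirichlet boundary `S`. -/
def IsEssentialCRSF (G : SimpleGraph V) (S : Finset V) (Γ : Finset (Sym2 V)) : Prop :=
  ↑Γ ⊆ G.edgeSet ∧
    ∀ C : (SimpleGraph.fromEdgeSet (↑Γ : Set (Sym2 V))).ConnectedComponent,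
      ((Γ.filter fun e => ∀ v ∈ e, v ∈ C.supp).card = C.supp.toFinite.toFinset.card ∧
          C.supp.toFinite.toFinset ∩ S = ∅) ∨
      ((Γ.filter fun e => ∀ v ∈ e, v ∈ C.supp).card + 1 = C.supp.toFinite.toFinset.card ∧
          (C.supp.toFinite.toFinset ∩ S).card = 1)

open Equiv

def edgesP (σ : Perm V) : Finset (Sym2 V) := σ.support.image (fun v => s(v, σ v))

def cyc (f : V → V) : Finset (Perm V) :=
  Finset.univ.filter (fun σ => σ.IsCycle ∧ ∀ v ∈ σ.support, f v = σ v)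

def FF (U : Finset V) : Finset (V → V) := Finset.univ.filter (fun f => ∀ v, v ∉ U → f v = v)

def ZZ (c : V → V → ℝ) (β : Perm V → ℝ) (U : Finset V) : ℝ :=
  ∑ f ∈ FF U, (∏ v ∈ U, c v (f v)) * ∏ σ ∈ cyc f, β σ

lemma mem_cyc {f : V → V} {σ : Perm V} :
    σ ∈ cyc f ↔ σ.IsCycle ∧ ∀ v ∈ σ.support, f v = σ v := by simp [cyc]

lemma mem_FF {U : Finset V} {f : V → V} : f ∈ FF U ↔ ∀ v, v ∉ U → f v = v := by simp [FF]

lemma cyc_iter {f : V → V} {σ : Perm V} (h : σ ∈ cyc f) {x : V} (hx : x ∈ σ.support) (n : ℕ) :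
    f^[n] x = (σ ^ n) x := by
  induction n with
  | zero => simp
  | succ n ih =>
    rw [Function.iterate_succ_apply', ih, (mem_cyc.1 h).2, pow_succ', Perm.mul_apply]
    exact Perm.pow_apply_mem_support.2 hx

lemma cyc_supp {f : V → V} {σ : Perm V} (h : σ ∈ cyc f) {x : V} (hx : x ∈ σ.support) (y : V) :
    y ∈ σ.support ↔ ∃ n, f^[n] x = y := by
  constructor
  · intro hy
    obtain ⟨n, hn⟩ := (mem_cyc.1 h).1.exists_pow_eq (Perm.mem_support.1 hx) (Perm.mem_support.1 hy)
    exact ⟨n, by rw [cyc_iter h hx, hn]⟩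
  · rintro ⟨n, rfl⟩
    rw [cyc_iter h hx]
    exact Perm.pow_apply_mem_support.2 hx

lemma cyc_eq {f : V → V} {σ ρ : Perm V} (h : σ ∈ cyc f) (h' : ρ ∈ cyc f) {x : V}
    (hx : x ∈ σ.support) (hx' : x ∈ ρ.support) : σ = ρ := by
  have hs : ∀ y, y ∈ σ.support ↔ y ∈ ρ.support := fun y => by
    rw [cyc_supp h hx, cyc_supp h' hx']
  ext y
  by_cases hy : y ∈ σ.support
  · rw [← (mem_cyc.1 h).2 y hy, ← (mem_cyc.1 h').2 y ((hs y).1 hy)]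
  · have hy' := fun q => hy ((hs y).2 q)
    rw [Perm.notMem_support.1 hy, Perm.notMem_support.1 hy']

lemma cyc_nonempty {σ : Perm V} (h : σ.IsCycle) : ∃ x, x ∈ σ.support := by
  obtain ⟨x, hx, _⟩ := h
  exact ⟨x, Perm.mem_support.2 hx⟩

lemma supp_sub {U : Finset V} {f : V → V} (hf : f ∈ FF U) {σ : Perm V} (h : σ ∈ cyc f) :
    σ.support ⊆ U := by
  intro v hv
  by_contra hU
  have := (mem_cyc.1 h).2 v hv
  rw [mem_FF.1 hf v hU] at this
  exact Perm.mem_support.1 hv this.symm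

lemma sum_reset (c : V → V → ℝ) (β : Perm V → ℝ) (U : Finset V) (σ : Perm V) (hσ : σ.IsCycle)
    (hU : σ.support ⊆ U) :
    ∑ f ∈ (FF U).filter (fun f => σ ∈ cyc f),
      (∏ v ∈ U, c v (f v)) * ∏ ρ ∈ (cyc f).erase σ, β ρ
    = (∏ v ∈ σ.support, c v (σ v)) * ZZ c β (U \ σ.support) := by
  rw [ZZ, Finset.mul_sum]
  refine Finset.sum_bij' (fun f _ => fun v => if v ∈ σ.support then v else f v)
    (fun g _ => fun v => if v ∈ σ.support then σ v else g v) ?_ ?_ ?_ ?_ ?_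
  · intro f hf
    rw [Finset.mem_filter, mem_FF] at hf
    rw [mem_FF]
    intro v hv
    rw [Finset.mem_sdiff] at hv
    split_ifs with h
    · rfl
    · exact hf.1 v (fun q => hv ⟨q, h⟩)
  · intro g hg
    rw [mem_FF] at hg
    rw [Finset.mem_filter, mem_FF, mem_cyc]
    refine ⟨fun v hv => ?_, hσ, fun v hv => by rw [if_pos hv]⟩
    rw [if_neg (fun q => hv (hU q))]
    exact hg v (fun q => hv (Finset.mem_sdiff.1 q).1)
  · intro f hf
    rw [Finset.mem_filter, mem_cyc] at hf
    funext v
    by_cases h : v ∈ σ.support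
    · simp only [if_pos h]; exact (hf.2.2 v h).symm
    · simp only [if_neg h]
  · intro g hg
    rw [mem_FF] at hg
    funext v
    by_cases h : v ∈ σ.support
    · simp only [if_pos h]; exact (hg v (fun q => (Finset.mem_sdiff.1 q).2 h)).symm
    · simp only [if_neg h]
  · intro f hf
    rw [Finset.mem_filter] at hf
    have h2 := hf.2
    rw [mem_cyc] at h2
    rw [← mul_assoc]
    congr 1
    · rw [← Finset.prod_sdiff hU, mul_comm]
      congr 1
      · exact Finset.prod_congr rfl (fun v hv => by rw [h2.2 v hv])
      · exact Finset.prod_congr rfl (fun v hv => by simp only [if_neg (Finset.mem_sdiff.1 hv).2])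
    · apply Finset.prod_congr _ (fun _ _ => rfl)
      ext ρ
      rw [Finset.mem_erase]
      constructor
      · rintro ⟨hne, hρ⟩
        rw [mem_cyc]
        refine ⟨(mem_cyc.1 hρ).1, fun v hv => ?_⟩
        rw [if_neg (fun q => hne (cyc_eq hρ hf.2 hv q))]
        exact (mem_cyc.1 hρ).2 v hv
      · intro hρ
        rw [mem_cyc] at hρ
        have hd : ∀ v ∈ ρ.support, v ∉ σ.support := by
          intro v hv hv'
          have := hρ.2 v hv
          rw [if_pos hv'] at this
          exact Perm.mem_support.1 hv this.symm
        obtain ⟨x, hx⟩ := cyc_nonempty hρ.1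
        refine ⟨fun h => hd x hx (h ▸ hx), mem_cyc.2 ⟨hρ.1, fun v hv => ?_⟩⟩
        have := hρ.2 v hv
        rwa [if_neg (hd v hv)] at this

lemma sum_insert (c : V → V → ℝ) (β : Perm V → ℝ) (U : Finset V) (x : V) (hx : x ∉ U) :
    ∑ f ∈ FF (insert x U), (∏ v ∈ insert x U, c v (f v)) *
      ∏ ρ ∈ (cyc f).filter (fun ρ => x ∉ ρ.support), β ρ
    = (∑ y, c x y) * ZZ c β U := by
  rw [ZZ, Finset.sum_mul_sum, ← Finset.sum_product']
  refine Finset.sum_bij' (fun f _ => (f x, Function.update f x x))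
    (fun p _ => Function.update p.2 x p.1) ?_ ?_ ?_ ?_ ?_
  · intro f hf
    rw [mem_FF] at hf
    simp only [Finset.mem_product, Finset.mem_univ, true_and, mem_FF]
    intro v hv
    by_cases h : v = x
    · simp [h]
    · rw [Function.update_of_ne h]
      exact hf v (by simp [h, hv])
  · rintro ⟨y, g⟩ hg
    simp only [Finset.mem_product, Finset.mem_univ, true_and, mem_FF] at hg
    rw [mem_FF]
    intro v hv
    rw [Finset.mem_insert, not_or] at hv
    simp only
    rw [Function.update_of_ne hv.1]
    exact hg v hv.2
  · intro f hf
    simp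
  · rintro ⟨y, g⟩ hg
    simp only [Finset.mem_product, Finset.mem_univ, true_and, mem_FF] at hg
    simp only [Function.update_self, Function.update_idem, Prod.mk.injEq, true_and]
    funext v
    by_cases h : v = x
    · subst h
      rw [Function.update_self, hg v hx]
    · rw [Function.update_of_ne h]
  · intro f hf
    rw [Finset.prod_insert hx]
    simp only
    rw [mul_assoc]
    congr 1
    congr 1
    · refine Finset.prod_congr rfl (fun v hv => ?_)
      rw [Function.update_of_ne (fun h : v = x => hx (h ▸ hv))]
    · apply Finset.prod_congr _ (fun _ _ => rfl)
      ext ρ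
      rw [Finset.mem_filter, mem_cyc, mem_cyc]
      constructor
      · rintro ⟨⟨h1, h2⟩, h3⟩
        refine ⟨h1, fun v hv => ?_⟩
        rw [Function.update_of_ne (fun h : v = x => h3 (h ▸ hv))]
        exact h2 v hv
      · rintro ⟨h1, h2⟩
        have h3 : x ∉ ρ.support := by
          intro hh
          have := h2 x hh
          rw [Function.update_self] at this
          exact Perm.mem_support.1 hh this.symm
        refine ⟨⟨h1, fun v hv => ?_⟩, h3⟩
        rw [← h2 v hv, Function.update_of_ne (fun h : v = x => h3 (h ▸ hv))]

lemma ZZ_rec (c : V → V → ℝ) (β : Perm V → ℝ) (U : Finset V) (x : V) (hx : x ∉ U) :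
    ZZ c β (insert x U) = (∑ y, c x y) * ZZ c β U -
      ∑ σ ∈ Finset.univ.filter (fun σ : Perm V => σ.IsCycle ∧ x ∈ σ.support ∧
        σ.support ⊆ insert x U),
        (1 - β σ) * ((∏ v ∈ σ.support, c v (σ v)) * ZZ c β (insert x U \ σ.support)) := by
  rw [← sum_insert c β U x hx]
  have h1 : ∀ σ ∈ Finset.univ.filter (fun σ : Perm V => σ.IsCycle ∧ x ∈ σ.support ∧
        σ.support ⊆ insert x U),
        (1 - β σ) * ((∏ v ∈ σ.support, c v (σ v)) * ZZ c β (insert x U \ σ.support))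
        = ∑ f ∈ FF (insert x U), if σ ∈ cyc f then (1 - β σ) *
          ((∏ v ∈ insert x U, c v (f v)) * ∏ ρ ∈ (cyc f).filter (fun ρ => x ∉ ρ.support), β ρ)
          else 0 := by
    intro σ hσ
    rw [Finset.mem_filter] at hσ
    obtain ⟨-, h1, h2, h3⟩ := hσ
    rw [← sum_reset c β _ σ h1 h3, Finset.mul_sum, Finset.sum_filter]
    refine Finset.sum_congr rfl (fun f hf => ?_)
    split_ifs with h
    · congr 2
      apply Finset.prod_congr _ (fun _ _ => rfl)
      ext ρ
      rw [Finset.mem_erase, Finset.mem_filter]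
      constructor
      · rintro ⟨a, b⟩
        exact ⟨b, fun q => a (cyc_eq b h q h2)⟩
      · rintro ⟨a, b⟩
        exact ⟨fun q => b (q ▸ h2), a⟩
    · rfl
  rw [Finset.sum_congr rfl h1, Finset.sum_comm, ← Finset.sum_sub_distrib, ZZ]
  refine Finset.sum_congr rfl (fun f hf => ?_)
  rw [← Finset.sum_filter]
  by_cases h : ∃ σ ∈ cyc f, x ∈ σ.support
  · obtain ⟨σ, hσ, hxσ⟩ := h
    have e1 : (Finset.univ.filter (fun σ : Perm V => σ.IsCycle ∧ x ∈ σ.support ∧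
        σ.support ⊆ insert x U)).filter (fun σ => σ ∈ cyc f) = {σ} := by
      ext ρ
      simp only [Finset.mem_filter, Finset.mem_univ, true_and, Finset.mem_singleton]
      constructor
      · rintro ⟨⟨_, h2, _⟩, h4⟩
        exact cyc_eq h4 hσ h2 hxσ
      · rintro rfl
        exact ⟨⟨(mem_cyc.1 hσ).1, hxσ, supp_sub hf hσ⟩, hσ⟩
    have e2 : cyc f = insert σ ((cyc f).filter (fun ρ => x ∉ ρ.support)) := by
      ext ρ
      rw [Finset.mem_insert, Finset.mem_filter]
      constructor
      · intro h
        by_cases hh : x ∈ ρ.support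
        · exact Or.inl (cyc_eq h hσ hh hxσ)
        · exact Or.inr ⟨h, hh⟩
      · rintro (rfl | h)
        · exact hσ
        · exact h.1
    rw [e1, Finset.sum_singleton]
    conv_lhs => rw [e2]
    have e3 : σ ∉ (cyc f).filter (fun ρ => x ∉ ρ.support) := by
      rw [Finset.mem_filter]; exact fun q => q.2 hxσ
    rw [Finset.prod_insert e3]
    ring
  · push Not at h
    have e1 : (Finset.univ.filter (fun σ : Perm V => σ.IsCycle ∧ x ∈ σ.support ∧
        σ.support ⊆ insert x U)).filter (fun σ => σ ∈ cyc f) = ∅ := by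
      ext ρ
      simp only [Finset.mem_filter, Finset.mem_univ, true_and, Finset.notMem_empty, iff_false]
      rintro ⟨⟨_, h2, _⟩, h4⟩
      exact h ρ h4 h2
    have e2 : (cyc f).filter (fun ρ => x ∉ ρ.support) = cyc f :=
      Finset.filter_true_of_mem h
    rw [e1, e2]
    simp

lemma ZZ_submod (c : V → V → ℝ) (hc : ∀ v w, 0 ≤ c v w) (β : Perm V → ℝ) (hβ : ∀ σ, β σ ≤ 1)
    (W : Finset V) (hW : ∀ U ⊆ W, 0 < ZZ c β U) (n : ℕ) :
    ∀ A B D : Finset V, A ⊆ B → Disjoint B D → B ∪ D ⊆ W → (B ∪ D).card ≤ n →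
      ZZ c β (B ∪ D) * ZZ c β A ≤ ZZ c β (A ∪ D) * ZZ c β B := by
  induction n with
  | zero =>
    intro A B D hAB hBD hBW hn
    have h0 : B ∪ D = ∅ := Finset.card_eq_zero.1 (by omega)
    obtain ⟨hB, hD⟩ := Finset.union_eq_empty.1 h0
    subst hB hD
    rw [Finset.subset_empty.1 hAB]
  | succ n ih =>
    intro A B D hAB hBD hBW hn
    have key : ∀ (A B : Finset V) (x : V), A ⊆ B → x ∉ B → insert x B ⊆ W →
        (insert x B).card ≤ n + 1 →
        ZZ c β (insert x B) * ZZ c β A ≤ ZZ c β (insert x A) * ZZ c β B := by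
      clear hBW hn hBD hAB A B D
      intro A B x hAB hx hBW hn
      have hxA : x ∉ A := fun h => hx (hAB h)
      rw [ZZ_rec c β B x hx, ZZ_rec c β A x hxA]
      rw [sub_mul, sub_mul]
      have hsub : (Finset.univ.filter (fun σ : Perm V => σ.IsCycle ∧ x ∈ σ.support ∧
          σ.support ⊆ insert x A)) ⊆ (Finset.univ.filter (fun σ : Perm V => σ.IsCycle ∧
          x ∈ σ.support ∧ σ.support ⊆ insert x B)) := by
        intro σ
        simp only [Finset.mem_filter, Finset.mem_univ, true_and]
        rintro ⟨a, b, d⟩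
        exact ⟨a, b, d.trans (Finset.insert_subset_insert _ hAB)⟩
      have hpos : ∀ U ⊆ insert x B, 0 < ZZ c β U := fun U hU => hW U (hU.trans hBW)
      have hle := Finset.sum_le_sum_of_subset_of_nonneg (f := fun σ : Perm V =>
        (1 - β σ) * ((∏ v ∈ σ.support, c v (σ v)) * ZZ c β (insert x B \ σ.support)) * ZZ c β A)
        hsub (by
          intro σ _ _
          have h1 := hpos (insert x B \ σ.support) Finset.sdiff_subset
          have h2 := hpos A (hAB.trans (Finset.subset_insert _ _))
          have h3 : 0 ≤ ∏ v ∈ σ.support, c v (σ v) := Finset.prod_nonneg (fun _ _ => hc _ _)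
          have h4 := hβ σ
          have h5 : 0 ≤ 1 - β σ := by linarith
          positivity)
      have hle2 : ∑ σ ∈ Finset.univ.filter (fun σ : Perm V => σ.IsCycle ∧ x ∈ σ.support ∧
          σ.support ⊆ insert x A),
          (1 - β σ) * ((∏ v ∈ σ.support, c v (σ v)) * ZZ c β (insert x A \ σ.support)) * ZZ c β B
          ≤ ∑ σ ∈ Finset.univ.filter (fun σ : Perm V => σ.IsCycle ∧ x ∈ σ.support ∧
          σ.support ⊆ insert x A),
          (1 - β σ) * ((∏ v ∈ σ.support, c v (σ v)) * ZZ c β (insert x B \ σ.support)) *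
            ZZ c β A := by
        refine Finset.sum_le_sum (fun σ hσ => ?_)
        simp only [Finset.mem_filter, Finset.mem_univ, true_and] at hσ
        obtain ⟨_, hxσ, hσA⟩ := hσ
        have h3 : 0 ≤ ∏ v ∈ σ.support, c v (σ v) := Finset.prod_nonneg (fun _ _ => hc _ _)
        have h4 := hβ σ
        have h5 : 0 ≤ 1 - β σ := by linarith
        have eA : insert x A \ σ.support = A \ (σ.support.erase x) := by
          ext v; simp only [Finset.mem_sdiff, Finset.mem_insert, Finset.mem_erase]; grind
        have eB : insert x B \ σ.support = B \ (σ.support.erase x) := by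
          ext v; simp only [Finset.mem_sdiff, Finset.mem_insert, Finset.mem_erase]; grind
        have eA' : A \ (σ.support.erase x) ∪ (σ.support.erase x) = A := by
          apply Finset.sdiff_union_of_subset
          intro v hv
          rw [Finset.mem_erase] at hv
          exact (Finset.mem_insert.1 (hσA hv.2)).resolve_left hv.1
        have eB' : B \ (σ.support.erase x) ∪ (σ.support.erase x) = B := by
          apply Finset.sdiff_union_of_subset
          intro v hv
          rw [Finset.mem_erase] at hv
          exact hAB ((Finset.mem_insert.1 (hσA hv.2)).resolve_left hv.1)
        have := ih (A \ (σ.support.erase x)) (B \ (σ.support.erase x)) (σ.support.erase x)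
          (Finset.sdiff_subset_sdiff hAB le_rfl) Finset.sdiff_disjoint
          (by rw [eB']; exact (Finset.subset_insert _ _).trans hBW)
          (by rw [eB']; rw [Finset.card_insert_of_notMem hx] at hn; omega)
        rw [eA', eB'] at this
        rw [eA, eB, mul_assoc, mul_assoc, mul_assoc, mul_assoc]
        refine mul_le_mul_of_nonneg_left (mul_le_mul_of_nonneg_left ?_ h3) h5
        linarith
      have := hle2.trans hle
      rw [← Finset.sum_mul, ← Finset.sum_mul] at this
      have e : (∑ y, c x y) * ZZ c β B * ZZ c β A = (∑ y, c x y) * ZZ c β A * ZZ c β B := by ring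
      linarith
    rcases D.eq_empty_or_nonempty with rfl | ⟨x, hxD⟩
    · simp [mul_comm]
    obtain ⟨D', hxD', rfl⟩ : ∃ D', x ∉ D' ∧ D = insert x D' :=
      ⟨D.erase x, Finset.notMem_erase x D, (Finset.insert_erase hxD).symm⟩
    rw [Finset.disjoint_insert_right] at hBD
    rw [Finset.union_insert] at *
    have hxn : x ∉ B ∪ D' := by simp [hBD.1, hxD']
    have k1 := key (A ∪ D') (B ∪ D') x (Finset.union_subset_union_left hAB) hxn hBW hn
    have k2 := ih A B D' hAB hBD.2 ((Finset.subset_insert _ _).trans hBW)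
      (by rw [Finset.card_insert_of_notMem hxn] at hn; omega)
    have p1 : 0 < ZZ c β (B ∪ D') := hW _ ((Finset.subset_insert _ _).trans hBW)
    have p2 : 0 < ZZ c β (A ∪ D') := hW _ ((Finset.union_subset_union_left hAB).trans
      ((Finset.subset_insert _ _).trans hBW))
    have p3 : 0 < ZZ c β A := hW _ ((hAB.trans Finset.subset_union_left).trans
      ((Finset.subset_insert _ _).trans hBW))
    have p4 : 0 < ZZ c β (insert x (A ∪ D')) := hW _
      ((Finset.insert_subset_insert _ (Finset.union_subset_union_left hAB)).trans hBW)
    rw [Finset.union_insert]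
    have k3 := mul_le_mul k1 k2 (by positivity) (by positivity)
    refine le_of_mul_le_mul_right ?_ (mul_pos p1 p2)
    linarith

lemma mem_edges_getVert {H : SimpleGraph V} {u v : V} (p : H.Walk u v) (e : Sym2 V) :
    e ∈ p.edges ↔ ∃ i, i < p.length ∧ e = s(p.getVert i, p.getVert (i + 1)) := by
  induction p with
  | nil => simp
  | cons h p ih =>
    rw [SimpleGraph.Walk.edges_cons, List.mem_cons, ih]
    constructor
    · rintro (rfl | ⟨i, hi, rfl⟩)
      · exact ⟨0, by simp, by simp⟩
      · exact ⟨i + 1, by simpa using hi, by simp⟩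
    · rintro ⟨i, hi, rfl⟩
      cases i with
      | zero => left; simp
      | succ i => right; exact ⟨i, by simpa using hi, by simp⟩

lemma rep_exists {δ : Finset (Sym2 V)} (h : IsCycleEdgeSet δ) :
    ∃ τ : Perm V, τ.IsCycle ∧ (∀ v ∈ τ.support, τ (τ v) ≠ v) ∧ edgesP τ = δ := by
  obtain ⟨v, w, hw, rfl⟩ := h
  have h3 := hw.three_le_length
  cases w with
  | nil => simp at h3
  | @cons _ u _ h p =>
    rw [SimpleGraph.Walk.cons_isCycle_iff] at hw
    have hnd : p.support.Nodup := hw.1.support_nodup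
    have hlen : p.support.length = p.length + 1 := p.length_support
    have h3' : 2 ≤ p.length := by simp at h3; omega
    have hne : ∀ x : V, p.support ≠ [x] := by
      intro x hx
      have := congrArg List.length hx
      rw [hlen, List.length_singleton] at this
      omega
    have hs : (p.support.formPerm).support = p.support.toFinset :=
      List.support_formPerm_of_nodup _ hnd hne
    have hap : ∀ i, i < p.length → p.support.formPerm (p.getVert i) = p.getVert (i + 1) := by
      intro i hi
      rw [p.getVert_eq_support_getElem hi.le, p.getVert_eq_support_getElem (Nat.succ_le_of_lt hi),
        List.formPerm_apply_lt_getElem _ hnd i (by omega)]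
    have hlast : p.support.formPerm v = u := by
      have := List.formPerm_apply_getElem _ hnd p.length (by omega)
      simp only [hlen, Nat.mod_self] at this
      rw [SimpleGraph.Walk.support_getElem_eq_getVert, SimpleGraph.Walk.support_getElem_eq_getVert] at this
      simpa using this
    have hinj : ∀ i j, i ≤ p.length → j ≤ p.length → p.getVert i = p.getVert j → i = j := by
      intro i j hi hj hij
      exact hw.1.getVert_injOn hi hj hij
    refine ⟨p.support.formPerm, List.isCycle_formPerm hnd (by omega), ?_, ?_⟩
    · intro x hx
      rw [hs, List.mem_toFinset, SimpleGraph.Walk.mem_support_iff_exists_getVert] at hx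
      obtain ⟨i, rfl, hi⟩ := hx
      rcases lt_trichotomy (i + 1) p.length with h1 | h1 | h1
      · rw [hap i (by omega), hap (i + 1) (by omega)]
        intro hh
        have := hinj _ _ (by omega) (by omega) hh
        omega
      · rw [hap i (by omega), h1, SimpleGraph.Walk.getVert_length, hlast]
        intro hh
        have := hinj 0 i (by omega) (by omega) (by simpa using hh)
        omega
      · have : i = p.length := by omega
        subst this
        rw [SimpleGraph.Walk.getVert_length, hlast]
        have h0 := hap 0 (by omega)
        rw [SimpleGraph.Walk.getVert_zero] at h0
        rw [h0]
        intro hh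
        have := hinj (0 + 1) p.length (by omega) (by omega) (by simpa using hh)
        omega
    · ext e
      rw [edgesP, hs, Finset.mem_image, List.mem_toFinset, SimpleGraph.Walk.edges_cons,
        List.mem_cons, mem_edges_getVert]
      constructor
      · rintro ⟨x, hx, rfl⟩
        rw [List.mem_toFinset, SimpleGraph.Walk.mem_support_iff_exists_getVert] at hx
        obtain ⟨i, rfl, hi⟩ := hx
        rcases lt_or_eq_of_le hi with h1 | h1
        · right; exact ⟨i, h1, by rw [hap i h1]⟩
        · left
          rw [h1, SimpleGraph.Walk.getVert_length, hlast]
      · rintro (rfl | ⟨i, hi, rfl⟩)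
        · exact ⟨v, by simp, by rw [hlast]⟩
        · exact ⟨p.getVert i, by simp [SimpleGraph.Walk.getVert_mem_support], by rw [hap i hi]⟩

lemma exists_cyc (f : V → V) (D : Finset V) (hm : ∀ v ∈ D, f v ∈ D)
    (hi : ∀ v ∈ D, ∀ w ∈ D, f v = f w → v = w) (v : V) (hv : v ∈ D) (hfv : f v ≠ v) :
    ∃ σ ∈ cyc f, v ∈ σ.support := by
  let g0 : {x // x ∈ D} → {x // x ∈ D} := fun x => ⟨f x.1, hm x.1 x.2⟩
  have hg0 : Function.Injective g0 := by
    intro a b hab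
    exact Subtype.ext (hi a.1 a.2 b.1 b.2 (congrArg Subtype.val hab))
  let g1 : Perm {x // x ∈ D} := Equiv.ofBijective g0 (Finite.injective_iff_bijective.1 hg0)
  let g : Perm V := Perm.ofSubtype g1
  have hg : ∀ x ∈ D, g x = f x := by
    intro x hx
    exact Perm.ofSubtype_apply_of_mem g1 hx
  have hg' : ∀ x, x ∉ D → g x = x := fun x hx => Perm.ofSubtype_apply_of_not_mem g1 hx
  have hgv : g v ≠ v := by rw [hg v hv]; exact hfv
  refine ⟨g.cycleOf v, mem_cyc.2 ⟨Perm.isCycle_cycleOf g hgv, fun u hu => ?_⟩, ?_⟩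
  · have hsu := (Perm.mem_support_cycleOf_iff.1 hu)
    have hug : u ∈ g.support := Perm.support_cycleOf_le g v hu
    rw [hsu.1.cycleOf_apply]
    refine (hg u ?_).symm
    by_contra hh
    exact Perm.mem_support.1 hug (hg' u hh)
  · rw [Perm.mem_support_cycleOf_iff' hgv]

def Gam (U : Finset V) (f : V → V) : Finset (Sym2 V) := U.image (fun v => s(v, f v))

lemma mem_edgesP {σ : Perm V} {v : V} (hv : v ∈ σ.support) : s(v, σ v) ∈ edgesP σ :=
  Finset.mem_image.2 ⟨v, hv, rfl⟩

lemma edgesP_inv (σ : Perm V) : edgesP σ⁻¹ = edgesP σ := by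
  ext e
  simp only [edgesP, Finset.mem_image, Perm.support_inv]
  constructor
  · rintro ⟨v, hv, rfl⟩
    refine ⟨σ⁻¹ v, ?_, ?_⟩
    · rw [← Perm.support_inv] at hv ⊢
      exact Perm.apply_mem_support.2 hv
    · rw [show σ (σ⁻¹ v) = v by simp, Sym2.eq_swap]
  · rintro ⟨v, hv, rfl⟩
    refine ⟨σ v, Perm.apply_mem_support.2 hv, ?_⟩
    rw [show σ⁻¹ (σ v) = v by simp, Sym2.eq_swap]

lemma cyc_of_edges {U : Finset V} {f : V → V} {τ : Perm V} (hτ : τ.IsCycle)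
    (h2 : ∀ v ∈ τ.support, τ (τ v) ≠ v) (hs : edgesP τ ⊆ Gam U f) :
    τ ∈ cyc f ∨ τ⁻¹ ∈ cyc f := by
  have hor : ∀ v ∈ τ.support, f v = τ v ∨ f (τ v) = v := by
    intro v hv
    have := hs (mem_edgesP hv)
    rw [Gam, Finset.mem_image] at this
    obtain ⟨u, -, hu⟩ := this
    rw [Sym2.eq_iff] at hu
    rcases hu with ⟨rfl, h⟩ | ⟨rfl, h⟩
    · exact Or.inl h
    · exact Or.inr h
  by_cases hex : ∃ v ∈ τ.support, f v = τ v
  · left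
    obtain ⟨v, hv, hfv⟩ := hex
    refine mem_cyc.2 ⟨hτ, fun u hu => ?_⟩
    obtain ⟨n, hn⟩ := hτ.exists_pow_eq (Perm.mem_support.1 hu) (Perm.mem_support.1 hv)
    induction n generalizing u with
    | zero => simp at hn; rw [hn]; exact hfv
    | succ n ih =>
      have hu' : τ u ∈ τ.support := Perm.apply_mem_support.2 hu
      have := ih (τ u) hu' (by rw [← hn, pow_succ, Perm.mul_apply])
      rcases hor u hu with h | h
      · exact h
      · exact absurd (this.symm.trans h) (h2 u hu)
  · right
    push Not at hex
    refine mem_cyc.2 ⟨hτ.inv, fun u hu => ?_⟩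
    have hu' : τ⁻¹ u ∈ τ.support := by
      rw [← Perm.support_inv]; exact Perm.apply_mem_support.2 hu
    have := (hor _ hu').resolve_left (hex _ hu')
    rwa [show τ (τ⁻¹ u) = u by simp] at this

def rep (δ : Finset (Sym2 V)) : Perm V :=
  if h : IsCycleEdgeSet δ then (rep_exists h).choose else 1

lemma rep_spec {δ : Finset (Sym2 V)} (h : IsCycleEdgeSet δ) :
    (rep δ).IsCycle ∧ (∀ v ∈ (rep δ).support, rep δ (rep δ v) ≠ v) ∧ edgesP (rep δ) = δ := by
  rw [rep, dif_pos h]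
  exact (rep_exists h).choose_spec

def Canon (σ : Perm V) : Prop := rep (edgesP σ) = σ ∧ IsCycleEdgeSet (edgesP σ)

def bet (α : Finset (Sym2 V) → ℝ) (σ : Perm V) : ℝ := if Canon σ then α (edgesP σ) else 0

def Good (G : SimpleGraph V) (U : Finset V) (f : V → V) : Prop :=
  f ∈ FF U ∧ (∀ v ∈ U, G.Adj v (f v)) ∧ ∀ σ ∈ cyc f, Canon σ

lemma canon_rep {δ : Finset (Sym2 V)} (h : IsCycleEdgeSet δ) : Canon (rep δ) := by
  unfold Canon
  rw [(rep_spec h).2.2]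
  exact ⟨rfl, h⟩

lemma Canon.sq {σ : Perm V} (h : Canon σ) : σ.IsCycle ∧ ∀ v ∈ σ.support, σ (σ v) ≠ v := by
  have := rep_spec h.2
  rw [h.1] at this
  exact ⟨this.1, this.2.1⟩

lemma Canon.inv {σ : Perm V} (h : Canon σ) : ¬ Canon σ⁻¹ := by
  intro h'
  have e := h'.1
  rw [edgesP_inv, h.1] at e
  obtain ⟨v, hv⟩ := cyc_nonempty h.sq.1
  refine h.sq.2 v hv ?_
  nth_rw 1 [e]
  simp

lemma Good.no2 {G : SimpleGraph V} {U : Finset V} {f : V → V} (h : Good G U f) {v : V}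
    (hv : v ∈ U) : f (f v) ≠ v := by
  intro h2
  have hne : f v ≠ v := (h.2.1 v hv).ne'
  obtain ⟨σ, hσ, hvσ⟩ := exists_cyc f {v, f v} (by
    intro w hw
    rw [Finset.mem_insert, Finset.mem_singleton] at hw
    rcases hw with rfl | rfl
    · simp
    · simp [h2]) (by
    intro a ha b hb hab
    rw [Finset.mem_insert, Finset.mem_singleton] at ha hb
    rcases ha with rfl | rfl <;> rcases hb with rfl | rfl
    · rfl
    · rw [h2] at hab; exact absurd hab hne
    · rw [h2] at hab; exact absurd hab.symm hne
    · rfl) v (by simp) hne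
  have hc := (mem_cyc.1 hσ).2
  refine (h.2.2 σ hσ).sq.2 v hvσ ?_
  rw [← hc _ (Perm.apply_mem_support.2 hvσ), ← hc v hvσ, h2]

lemma Good.inj {G : SimpleGraph V} {U : Finset V} {f : V → V} (h : Good G U f) :
    ∀ v ∈ U, ∀ w ∈ U, s(v, f v) = s(w, f w) → v = w := by
  intro v hv w hw hvw
  rw [Sym2.eq_iff] at hvw
  rcases hvw with ⟨h1, _⟩ | ⟨h1, h2⟩
  · exact h1
  · exact absurd (by rw [h2, ← h1]) (h.no2 hv)

lemma Good.sub_iff {G : SimpleGraph V} {U : Finset V} {f : V → V} (h : Good G U f)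
    {σ : Perm V} (hσ : Canon σ) : edgesP σ ⊆ Gam U f ↔ σ ∈ cyc f := by
  constructor
  · intro hs
    rcases cyc_of_edges hσ.sq.1 hσ.sq.2 hs with h1 | h1
    · exact h1
    · exact absurd (h.2.2 _ h1) hσ.inv
  · intro hc e he
    obtain ⟨v, hv, rfl⟩ := Finset.mem_image.1 he
    refine Finset.mem_image.2 ⟨v, supp_sub h.1 hc hv, ?_⟩
    rw [(mem_cyc.1 hc).2 v hv]

lemma Good.cyclesOf {G : SimpleGraph V} {U : Finset V} {f : V → V} (h : Good G U f) :
    cyclesOf (Gam U f) = (cyc f).image edgesP := by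
  ext δ
  rw [CRSFStmt.cyclesOf, Finset.mem_filter, Finset.mem_powerset, Finset.mem_image]
  constructor
  · rintro ⟨h1, h2⟩
    refine ⟨rep δ, (h.sub_iff (canon_rep h2)).1 ?_, (rep_spec h2).2.2⟩
    rwa [(rep_spec h2).2.2]
  · rintro ⟨σ, hσ, rfl⟩
    exact ⟨(h.sub_iff (h.2.2 σ hσ)).2 hσ, (h.2.2 σ hσ).2⟩

lemma Good.wt {G : SimpleGraph V} {U : Finset V} {f : V → V} (h : Good G U f)
    (c : V → V → ℝ) (hc : ∀ v w, c v w = c w v) (α : Finset (Sym2 V) → ℝ) :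
    wt c hc α (Gam U f) = (∏ v ∈ U, c v (f v)) * ∏ σ ∈ cyc f, bet α σ := by
  rw [CRSFStmt.wt, h.cyclesOf, Gam, Finset.prod_image, Finset.prod_image]
  · congr 1
    refine Finset.prod_congr rfl (fun σ hσ => ?_)
    rw [bet, if_pos (h.2.2 σ hσ)]
  · intro σ hσ ρ hρ hh
    rw [← (h.2.2 σ hσ).1, ← (h.2.2 ρ hρ).1]
    exact congrArg rep hh
  · intro v hv w hw hh
    exact h.inj v hv w hw hh

lemma Good.eq {G : SimpleGraph V} {U : Finset V} {f g : V → V} (h : Good G U f)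
    (h' : Good G U g) (he : Gam U f = Gam U g) : f = g := by
  let D := Finset.univ.filter (fun v => f v ≠ g v)
  have hDm : ∀ v, v ∈ D ↔ f v ≠ g v := by simp [D]
  have hDU : ∀ v ∈ D, v ∈ U := by
    intro v hv
    by_contra hh
    rw [hDm, mem_FF.1 h.1 v hh, mem_FF.1 h'.1 v hh] at hv
    exact hv rfl
  have hgf : ∀ v ∈ D, g (f v) = v := by
    intro v hv
    have : s(v, f v) ∈ Gam U g := he ▸ Finset.mem_image.2 ⟨v, hDU v hv, rfl⟩
    obtain ⟨u, _, hu⟩ := Finset.mem_image.1 this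
    rw [Sym2.eq_iff] at hu
    rcases hu with ⟨rfl, h1⟩ | ⟨rfl, h1⟩
    · exact absurd h1.symm ((hDm _).1 hv)
    · exact h1
  by_contra hne
  obtain ⟨v, hv⟩ := Function.ne_iff.1 hne
  have hvD := (hDm v).2 hv
  obtain ⟨σ, hσ, hvσ⟩ := exists_cyc f D (by
    intro w hw
    rw [hDm, hgf w hw]
    exact h.no2 (hDU w hw)) (by
    intro a ha b hb hab
    rw [← hgf a ha, hab, hgf b hb]) v hvD (h.2.1 v (hDU v hvD)).ne'
  have hσc := h.2.2 σ hσ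
  have hσg : σ ∈ cyc g := (h'.sub_iff hσc).1 (he ▸ (h.sub_iff hσc).2 hσ)
  exact hv (by rw [(mem_cyc.1 hσ).2 v hvσ, (mem_cyc.1 hσg).2 v hvσ])

lemma mem_Gam {U : Finset V} {f : V → V} {e : Sym2 V} :
    e ∈ Gam U f ↔ ∃ v ∈ U, s(v, f v) = e := Finset.mem_image

lemma reach_iter {f : V → V} {H : SimpleGraph V} (hH : ∀ a b, H.Adj a b → f a = b ∨ f b = a)
    {a b : V} (w : H.Walk a b) : ∃ n m : ℕ, f^[n] a = f^[m] b := by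
  induction w with
  | nil => exact ⟨0, 0, rfl⟩
  | @cons a b c h p ih =>
    obtain ⟨n, m, hnm⟩ := ih
    rcases hH a b h with h1 | h1
    · exact ⟨n + 1, m, by rw [Function.iterate_succ_apply, h1, hnm]⟩
    · refine ⟨n, m + 1, ?_⟩
      rw [← h1, ← Function.iterate_succ_apply, Function.iterate_succ_apply', hnm,
        Function.iterate_succ_apply']

lemma Good.crsf {G : SimpleGraph V} {S : Finset V} {f : V → V} (h : Good G Sᶜ f) :
    IsEssentialCRSF G S (Gam Sᶜ f) := by
  have hmem : ∀ v, v ∉ S → s(v, f v) ∈ Gam Sᶜ f := fun v hv =>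
    Finset.mem_image.2 ⟨v, Finset.mem_compl.2 hv, rfl⟩
  have hadj : ∀ v, v ∉ S → (SimpleGraph.fromEdgeSet (↑(Gam Sᶜ f) : Set (Sym2 V))).Adj v (f v) := by
    intro v hv
    rw [SimpleGraph.fromEdgeSet_adj]
    exact ⟨hmem v hv, (h.2.1 v (Finset.mem_compl.2 hv)).ne⟩
  refine ⟨?_, fun C => ?_⟩
  · intro e he
    obtain ⟨v, hv, rfl⟩ := Finset.mem_image.1 (Finset.mem_coe.1 he)
    exact h.2.1 v hv
  · have hK : ∀ v, v ∈ C.supp.toFinite.toFinset ↔ v ∈ C.supp := by simp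
    have hfil : (Gam Sᶜ f).filter (fun e => ∀ v ∈ e, v ∈ C.supp) =
        (C.supp.toFinite.toFinset \ S).image (fun v => s(v, f v)) := by
      ext e
      rw [Finset.mem_filter, mem_Gam, Finset.mem_image]
      constructor
      · rintro ⟨⟨v, hv, rfl⟩, h2⟩
        exact ⟨v, Finset.mem_sdiff.2 ⟨(hK v).2 (h2 v (Sym2.mem_mk_left _ _)),
          Finset.mem_compl.1 hv⟩, rfl⟩
      · rintro ⟨v, hv, rfl⟩
        rw [Finset.mem_sdiff, hK] at hv
        refine ⟨⟨v, Finset.mem_compl.2 hv.2, rfl⟩, fun u hu => ?_⟩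
        rw [Sym2.mem_iff] at hu
        rcases hu with rfl | rfl
        · exact hv.1
        · have := hv.1
          rw [SimpleGraph.ConnectedComponent.mem_supp_iff] at this ⊢
          rw [← this]
          exact SimpleGraph.ConnectedComponent.sound (hadj v hv.2).symm.reachable
    have hcard : ((Gam Sᶜ f).filter (fun e => ∀ v ∈ e, v ∈ C.supp)).card =
        (C.supp.toFinite.toFinset \ S).card := by
      rw [hfil]
      refine Finset.card_image_of_injOn ?_
      intro v hv w hw hvw
      exact h.inj v (Finset.mem_compl.2 (Finset.mem_sdiff.1 hv).2) w
        (Finset.mem_compl.2 (Finset.mem_sdiff.1 hw).2) hvw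
    have hle : (C.supp.toFinite.toFinset ∩ S).card ≤ 1 := by
      rw [Finset.card_le_one]
      intro a ha b hb
      rw [Finset.mem_inter, hK, SimpleGraph.ConnectedComponent.mem_supp_iff] at ha hb
      obtain ⟨w⟩ := SimpleGraph.ConnectedComponent.exact (ha.1.trans hb.1.symm)
      obtain ⟨n, m, hnm⟩ := reach_iter (f := f) (by
        intro x y hxy
        rw [SimpleGraph.fromEdgeSet_adj] at hxy
        obtain ⟨u, _, hu⟩ := Finset.mem_image.1 (Finset.mem_coe.1 hxy.1)
        rw [Sym2.eq_iff] at hu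
        rcases hu with ⟨rfl, h1⟩ | ⟨rfl, h1⟩
        · exact Or.inl h1
        · exact Or.inr h1) w
      have hfa : f a = a := mem_FF.1 h.1 a (by simp [ha.2])
      have hfb : f b = b := mem_FF.1 h.1 b (by simp [hb.2])
      rwa [Function.iterate_fixed hfa, Function.iterate_fixed hfb] at hnm
    have hsum := Finset.card_sdiff_add_card_inter C.supp.toFinite.toFinset S
    rw [hcard]
    rcases Nat.le_one_iff_eq_zero_or_eq_one.1 hle with h0 | h1
    · left
      exact ⟨by omega, Finset.card_eq_zero.1 h0⟩
    · right
      exact ⟨by omega, h1⟩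

lemma closer {H : SimpleGraph V} {v t : V} (hr : H.Reachable v t) (hne : v ≠ t) :
    ∃ w, H.Adj v w ∧ H.dist w t < H.dist v t := by
  obtain ⟨p, hp⟩ := hr.exists_walk_length_eq_dist
  cases p with
  | nil => exact absurd rfl hne
  | @cons _ w _ h q =>
    refine ⟨w, h, ?_⟩
    have := SimpleGraph.dist_le q
    rw [← hp, SimpleGraph.Walk.length_cons]
    omega

lemma exists_cycle_comp {Γ : Finset (Sym2 V)} (hnd : ∀ e ∈ Γ, ¬ e.IsDiag)
    (C : (SimpleGraph.fromEdgeSet (↑Γ : Set (Sym2 V))).ConnectedComponent)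
    (hC : (Γ.filter fun e => ∀ v ∈ e, v ∈ C.supp).card = C.supp.toFinite.toFinset.card) :
    ∃ δ : Finset (Sym2 V), δ ⊆ Γ ∧ IsCycleEdgeSet δ ∧ ∀ e ∈ δ, ∀ v ∈ e, v ∈ C.supp := by
  have hna : ¬ C.toSimpleGraph.IsAcyclic := by
    intro hac
    have htree : C.toSimpleGraph.IsTree := ⟨C.connected_toSimpleGraph, hac⟩
    have h1 := (SimpleGraph.isTree_iff_connected_and_card.1 htree).2
    have h2 : Nat.card C = C.supp.toFinite.toFinset.card := by
      rw [← Set.ncard_eq_toFinset_card]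
      rfl
    have h3 : Nat.card C.toSimpleGraph.edgeSet =
        (Γ.filter fun e => ∀ v ∈ e, v ∈ C.supp).card := by
      rw [Nat.card_coe_set_eq, ← Set.ncard_image_of_injective _
        (Sym2.map.injective (Subtype.val_injective (p := fun v => v ∈ C.supp))),
        ← Set.ncard_coe_finset]
      congr 1
      ext e
      rw [Finset.mem_coe, Finset.mem_filter]
      constructor
      · rintro ⟨e', he', rfl⟩
        induction e' using Sym2.ind with
        | _ a b =>
          have h1 : (SimpleGraph.fromEdgeSet (↑Γ : Set (Sym2 V))).Adj a.1 b.1 := he'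
          rw [SimpleGraph.fromEdgeSet_adj] at h1
          refine ⟨h1.1, ?_⟩
          intro u hu
          rw [Sym2.map_mk, Sym2.mem_iff] at hu
          rcases hu with rfl | rfl
          · exact a.2
          · exact b.2
      · rintro ⟨h1, h2⟩
        induction e using Sym2.ind with
        | _ a b =>
          refine ⟨s(⟨a, h2 a (Sym2.mem_mk_left _ _)⟩, ⟨b, h2 b (Sym2.mem_mk_right _ _)⟩), ?_, rfl⟩
          have h3 : (SimpleGraph.fromEdgeSet (↑Γ : Set (Sym2 V))).Adj a b := by
            rw [SimpleGraph.fromEdgeSet_adj]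
            exact ⟨h1, fun hh => hnd _ h1 (Sym2.mk_isDiag_iff.2 hh)⟩
          exact h3
    omega
  unfold SimpleGraph.IsAcyclic at hna
  push Not at hna
  obtain ⟨v, w, hw⟩ := hna
  let φ : C.toSimpleGraph →g (⊤ : SimpleGraph V) :=
    ⟨Subtype.val, fun {a b} hab => by
      rw [SimpleGraph.top_adj]
      exact fun hh => hab.ne (Subtype.ext hh)⟩
  have hφ : Function.Injective φ := Subtype.val_injective
  have key : ∀ e ∈ (w.map φ).edges, e ∈ Γ ∧ ∀ v ∈ e, v ∈ C.supp := by
    intro e he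
    rw [SimpleGraph.Walk.edges_map, List.mem_map] at he
    obtain ⟨e', he', rfl⟩ := he
    have := w.edges_subset_edgeSet he'
    induction e' using Sym2.ind with
    | _ a b =>
      rw [SimpleGraph.mem_edgeSet] at this
      have h1 : (SimpleGraph.fromEdgeSet (↑Γ : Set (Sym2 V))).Adj a.1 b.1 := this
      rw [SimpleGraph.fromEdgeSet_adj] at h1
      refine ⟨h1.1, ?_⟩
      intro u hu
      rw [Sym2.map_mk, Sym2.mem_iff] at hu
      rcases hu with rfl | rfl
      · exact a.2
      · exact b.2
  refine ⟨(w.map φ).edges.toFinset, ?_, ⟨_, w.map φ, ?_, rfl⟩, ?_⟩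
  · intro e he
    exact (key e (List.mem_toFinset.1 he)).1
  · exact (SimpleGraph.Walk.isCycle_map_iff_of_injective hφ).2 hw
  · intro e he
    exact (key e (List.mem_toFinset.1 he)).2

lemma exists_good {G : SimpleGraph V} {S : Finset V} {Γ : Finset (Sym2 V)}
    (h : IsEssentialCRSF G S Γ) : ∃ f, Good G Sᶜ f ∧ Gam Sᶜ f = Γ := by
  obtain ⟨hΓ, hcomp⟩ := h
  have hnd : ∀ e ∈ Γ, ¬ e.IsDiag := fun e he => G.not_isDiag_of_mem_edgeSet (hΓ he)
  set H := SimpleGraph.fromEdgeSet (↑Γ : Set (Sym2 V)) with hH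
  have hHadj : ∀ a b, H.Adj a b ↔ s(a, b) ∈ Γ := by
    intro a b
    rw [hH, SimpleGraph.fromEdgeSet_adj]
    exact ⟨fun q => q.1, fun q => ⟨q, fun hh => hnd _ q (Sym2.mk_isDiag_iff.2 hh)⟩⟩
  have hcard : ∀ C : H.ConnectedComponent, (Γ.filter fun e => ∀ v ∈ e, v ∈ C.supp).card =
      (C.supp.toFinite.toFinset \ S).card := by
    intro C
    have hsum := Finset.card_sdiff_add_card_inter C.supp.toFinite.toFinset S
    rcases hcomp C with ⟨h1, h2⟩ | ⟨h1, h2⟩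
    · rw [h2, Finset.card_empty] at hsum
      omega
    · omega
  have hdata : ∀ C : H.ConnectedComponent, ∃ (τ : Perm V) (t : V) (T : Finset V),
      t ∈ T ∧ (∀ v ∈ T, v ∈ C.supp) ∧ (∀ v ∈ T, τ v ∈ T) ∧
      (∀ v ∈ C.supp, v ∈ S → v ∈ T ∧ τ v = v) ∧ (∀ v ∈ T, v ∉ S → H.Adj v (τ v)) ∧
      (Canon τ ∨ τ = 1) := by
    intro C
    rcases hcomp C with ⟨h1, h2⟩ | ⟨h1, h2⟩
    · obtain ⟨δ, hδ, hcy, hδC⟩ := exists_cycle_comp hnd C h1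
      have hr := rep_spec hcy
      obtain ⟨t, ht⟩ := cyc_nonempty hr.1
      have hmem : ∀ v ∈ (rep δ).support, s(v, rep δ v) ∈ δ := fun v hv => by
        have := mem_edgesP hv
        rwa [hr.2.2] at this
      refine ⟨rep δ, t, (rep δ).support, ht, ?_, ?_, ?_, ?_, Or.inl (canon_rep hcy)⟩
      · intro v hv
        exact hδC _ (hmem v hv) v (Sym2.mem_mk_left _ _)
      · intro v hv
        exact Perm.apply_mem_support.2 hv
      · intro v hv hvS
        have : v ∈ C.supp.toFinite.toFinset ∩ S := by simp [hvS]; exact hv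
        rw [h2] at this
        simp at this
      · intro v hv _
        rw [hHadj]
        exact hδ (hmem v hv)
    · obtain ⟨t, ht⟩ := Finset.card_eq_one.1 h2
      have htm : t ∈ C.supp.toFinite.toFinset ∩ S := by rw [ht]; simp
      rw [Finset.mem_inter, Set.Finite.mem_toFinset] at htm
      refine ⟨1, t, {t}, by simp, ?_, by simp, ?_, ?_, Or.inr rfl⟩
      · intro v hv
        rw [Finset.mem_singleton.1 hv]
        exact htm.1
      · intro v hv hvS
        have : v ∈ C.supp.toFinite.toFinset ∩ S := by
          rw [Finset.mem_inter, Set.Finite.mem_toFinset]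
          exact ⟨hv, hvS⟩
        rw [ht] at this
        exact ⟨this, rfl⟩
      · intro v hv hvS
        rw [Finset.mem_singleton.1 hv] at hvS
        exact absurd htm.2 hvS
  choose τ t T htT hTC hτT hS hadjT hcan using hdata
  have hnext : ∀ v, ∃ w, v ∉ T (H.connectedComponentMk v) → H.Adj v w ∧
      H.dist w (t (H.connectedComponentMk v)) < H.dist v (t (H.connectedComponentMk v)) := by
    intro v
    by_cases hv : v ∈ T (H.connectedComponentMk v)
    · exact ⟨v, fun q => absurd hv q⟩
    · have h1 : H.Reachable v (t (H.connectedComponentMk v)) := by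
        have := hTC _ _ (htT (H.connectedComponentMk v))
        rw [SimpleGraph.ConnectedComponent.mem_supp_iff] at this
        exact SimpleGraph.ConnectedComponent.exact this.symm
      obtain ⟨w, hw⟩ := closer h1 (fun hh => hv (by
        have := htT (H.connectedComponentMk v)
        rwa [← hh] at this))
      exact ⟨w, fun _ => hw⟩
  choose nx hnx using hnext
  let m := fun v => H.connectedComponentMk v
  let f : V → V := fun v => if v ∈ T (m v) then τ (m v) v else nx v
  have hfT : ∀ v, v ∈ T (m v) → f v = τ (m v) v := fun v hv => if_pos hv
  have hfN : ∀ v, v ∉ T (m v) → f v = nx v := fun v hv => if_neg hv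
  have hmf : ∀ v, m (f v) = m v := by
    intro v
    by_cases hv : v ∈ T (m v)
    · rw [hfT v hv]
      have := hTC _ _ (hτT _ _ hv)
      rwa [SimpleGraph.ConnectedComponent.mem_supp_iff] at this
    · rw [hfN v hv]
      exact SimpleGraph.ConnectedComponent.sound (hnx v hv).1.symm.reachable
  have hfTT : ∀ v, v ∈ T (m v) → f v ∈ T (m (f v)) := by
    intro v hv
    rw [hmf, hfT v hv]
    exact hτT _ _ hv
  have hd : ∀ v, v ∉ T (m v) → H.dist (f v) (t (m (f v))) < H.dist v (t (m v)) := by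
    intro v hv
    rw [hmf, hfN v hv]
    exact (hnx v hv).2
  have hmS : ∀ v, v ∈ (m v).supp := fun v => by
    rw [SimpleGraph.ConnectedComponent.mem_supp_iff]
  have hfS : ∀ v ∈ S, f v = v := by
    intro v hv
    have := hS (m v) v (hmS v) hv
    rw [hfT v this.1, this.2]
  have hfadj : ∀ v, v ∉ S → H.Adj v (f v) := by
    intro v hv
    by_cases hvT : v ∈ T (m v)
    · rw [hfT v hvT]; exact hadjT _ _ hvT hv
    · rw [hfN v hvT]; exact (hnx v hvT).1
  have hgood : Good G Sᶜ f := by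
    refine ⟨mem_FF.2 (fun v hv => hfS v (by simpa using hv)), ?_, ?_⟩
    · intro v hv
      exact hΓ ((hHadj _ _).1 (hfadj v (Finset.mem_compl.1 hv)))
    · intro σ hσ
      have hσ' := mem_cyc.1 hσ
      obtain ⟨x, hx, hmin⟩ := Finset.exists_min_image σ.support (fun v => H.dist v (t (m v)))
        (cyc_nonempty hσ'.1)
      have hxT : x ∈ T (m x) := by
        by_contra hxT
        have h1 := hd x hxT
        have h2 := hmin (σ x) (Perm.apply_mem_support.2 hx)
        rw [hσ'.2 x hx] at h1
        omega
      have hall : ∀ n, m (f^[n] x) = m x ∧ f^[n] x ∈ T (m (f^[n] x)) := by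
        intro n
        induction n with
        | zero => exact ⟨rfl, hxT⟩
        | succ n ih =>
          rw [Function.iterate_succ_apply']
          exact ⟨(hmf _).trans ih.1, hfTT _ ih.2⟩
      have hστ : ∀ y ∈ σ.support, τ (m x) y = σ y := by
        intro y hy
        obtain ⟨n, rfl⟩ := (cyc_supp hσ hx y).1 hy
        rw [← hσ'.2 _ hy, hfT _ (hall n).2, (hall n).1]
      have hxne := Perm.mem_support.1 hx
      rcases hcan (m x) with hc | h1
      · have : σ = τ (m x) := cyc_eq (f := τ (m x)) (mem_cyc.2 ⟨hσ'.1, hστ⟩)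
          (mem_cyc.2 ⟨hc.sq.1, fun _ _ => rfl⟩) hx (by
            rw [Perm.mem_support, hστ x hx]; exact hxne)
        rw [this]
        exact hc
      · have := hστ x hx
        rw [h1] at this
        exact absurd this.symm hxne
  refine ⟨f, hgood, ?_⟩
  ext e
  rw [mem_Gam]
  constructor
  · rintro ⟨v, hv, rfl⟩
    exact (hHadj _ _).1 (hfadj v (Finset.mem_compl.1 hv))
  · intro he
    induction e using Sym2.ind with
    | _ a b =>
      have hab := (hHadj a b).2 he
      have hsub : ((m a).supp.toFinite.toFinset \ S).image (fun v => s(v, f v)) ⊆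
          Γ.filter (fun e => ∀ v ∈ e, v ∈ (m a).supp) := by
        intro e he
        obtain ⟨v, hv, rfl⟩ := Finset.mem_image.1 he
        rw [Finset.mem_sdiff, Set.Finite.mem_toFinset] at hv
        refine Finset.mem_filter.2 ⟨(hHadj _ _).1 (hfadj v hv.2), ?_⟩
        intro u hu
        rw [Sym2.mem_iff] at hu
        rcases hu with rfl | rfl
        · exact hv.1
        · have := hv.1
          rw [SimpleGraph.ConnectedComponent.mem_supp_iff] at this ⊢
          exact (hmf v).trans this
      have heq := Finset.eq_of_subset_of_card_le hsub (by
        rw [hcard, Finset.card_image_of_injOn]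
        intro v hv w hw hvw
        exact hgood.inj v (Finset.mem_compl.2 (Finset.mem_sdiff.1 hv).2) w
          (Finset.mem_compl.2 (Finset.mem_sdiff.1 hw).2) hvw)
      have hmem : s(a, b) ∈ Γ.filter (fun e => ∀ v ∈ e, v ∈ (m a).supp) := by
        refine Finset.mem_filter.2 ⟨he, ?_⟩
        intro u hu
        rw [Sym2.mem_iff] at hu
        rcases hu with rfl | rfl
        · exact hmS _
        · rw [SimpleGraph.ConnectedComponent.mem_supp_iff]
          exact SimpleGraph.ConnectedComponent.sound hab.symm.reachable
      rw [← heq] at hmem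
      obtain ⟨v, hv, hve⟩ := Finset.mem_image.1 hmem
      exact ⟨v, Finset.mem_compl.2 (Finset.mem_sdiff.1 hv).2, hve⟩

lemma sum_crsf (G : SimpleGraph V) (c : V → V → ℝ) (α : Finset (Sym2 V) → ℝ)
    (hc_symm : ∀ v w, c v w = c w v) (hc_zero : ∀ v w, ¬G.Adj v w → c v w = 0) (S : Finset V)
    (P : Finset (Sym2 V) → Prop) (Q : (V → V) → Prop)
    (hP : ∀ Γ, P Γ → IsEssentialCRSF G S Γ)
    (hPQ : ∀ f, Good G Sᶜ f → (P (Gam Sᶜ f) ↔ Q f)) :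
    ∑ Γ ∈ Finset.univ.filter P, wt c hc_symm α Γ =
      ∑ f ∈ (FF Sᶜ).filter Q, (∏ v ∈ Sᶜ, c v (f v)) * ∏ σ ∈ cyc f, bet α σ := by
  have h1 : ∑ f ∈ (FF Sᶜ).filter (fun f => Good G Sᶜ f ∧ Q f),
      (∏ v ∈ Sᶜ, c v (f v)) * ∏ σ ∈ cyc f, bet α σ =
      ∑ f ∈ (FF Sᶜ).filter Q, (∏ v ∈ Sᶜ, c v (f v)) * ∏ σ ∈ cyc f, bet α σ := by
    apply Finset.sum_subset
    · intro f
      rw [Finset.mem_filter, Finset.mem_filter]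
      rintro ⟨a, b⟩
      exact ⟨a, b.2⟩
    · intro f hf hf'
      rw [Finset.mem_filter] at hf hf'
      have hng : ¬ Good G Sᶜ f := fun hg => hf' ⟨hf.1, hg, hf.2⟩
      by_contra hne
      obtain ⟨n1, n2⟩ := mul_ne_zero_iff.1 hne
      rw [Finset.prod_ne_zero_iff] at n1 n2
      refine hng ⟨hf.1, fun v hv => ?_, fun σ hσ => ?_⟩
      · by_contra hh
        exact n1 v hv (hc_zero _ _ hh)
      · by_contra hh
        exact n2 σ hσ (if_neg hh)
  rw [← h1]
  symm
  refine Finset.sum_bij (fun f _ => Gam Sᶜ f) ?_ ?_ ?_ ?_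
  · intro f hf
    rw [Finset.mem_filter] at hf
    exact Finset.mem_filter.2 ⟨Finset.mem_univ _, (hPQ f hf.2.1).2 hf.2.2⟩
  · intro f hf g hg hfg
    rw [Finset.mem_filter] at hf hg
    exact hf.2.1.eq hg.2.1 hfg
  · intro Γ hΓ
    rw [Finset.mem_filter] at hΓ
    obtain ⟨f, hf, rfl⟩ := exists_good (hP Γ hΓ.2)
    exact ⟨f, Finset.mem_filter.2 ⟨hf.1, hf, (hPQ f hf).1 hΓ.2⟩, rfl⟩
  · intro f hf
    rw [Finset.mem_filter] at hf
    exact (hf.2.1.wt c hc_symm α).symm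

lemma ZZ_pos (G : SimpleGraph V) (hG : G.Connected) (c : V → V → ℝ) (hc : ∀ v w, 0 ≤ c v w)
    (hc_pos : ∀ v w, G.Adj v w → 0 < c v w) (β : Perm V → ℝ) (hβ : ∀ σ, 0 ≤ β σ)
    (U : Finset V) (t : V) (ht : t ∉ U) : 0 < ZZ c β U := by
  have hnext : ∀ v, ∃ w, v ≠ t → G.Adj v w ∧ G.dist w t < G.dist v t := by
    intro v
    by_cases hv : v = t
    · exact ⟨v, fun q => absurd hv q⟩
    · obtain ⟨w, hw⟩ := closer (hG v t) hv
      exact ⟨w, fun _ => hw⟩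
  choose nx hnx using hnext
  have hne : ∀ v ∈ U, v ≠ t := fun v hv h => ht (h ▸ hv)
  let f : V → V := fun v => if v ∈ U then nx v else v
  have hf : f ∈ FF U := mem_FF.2 (fun v hv => if_neg hv)
  have hcy : cyc f = ∅ := by
    rw [Finset.eq_empty_iff_forall_notMem]
    intro σ hσ
    obtain ⟨x, hx, hmin⟩ := Finset.exists_min_image σ.support (fun v => G.dist v t)
      (cyc_nonempty (mem_cyc.1 hσ).1)
    have h1 := hmin (σ x) (Perm.apply_mem_support.2 hx)
    have hxU := supp_sub hf hσ hx
    have h2 : σ x = nx x := by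
      rw [← (mem_cyc.1 hσ).2 x hx]
      exact if_pos hxU
    have h3 := (hnx x (hne x hxU)).2
    rw [h2] at h1
    omega
  refine Finset.sum_pos' (fun g _ => mul_nonneg (Finset.prod_nonneg (fun _ _ => hc _ _))
    (Finset.prod_nonneg (fun _ _ => hβ _))) ⟨f, hf, ?_⟩
  rw [hcy, Finset.prod_empty, mul_one]
  refine Finset.prod_pos (fun v hv => ?_)
  have : f v = nx v := if_pos hv
  rw [this]
  exact hc_pos _ _ (hnx v (hne v hv)).1


theorem stochastic_domination
    (G : SimpleGraph V) (hG : G.Connected)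
    (c : V → V → ℝ) (α : Finset (Sym2 V) → ℝ)
    (hc_symm : ∀ v w, c v w = c w v)
    (hc_pos : ∀ v w, G.Adj v w → 0 < c v w)
    (hc_zero : ∀ v w, ¬G.Adj v w → c v w = 0)
    (hα : ∀ δ : Finset (Sym2 V), IsCycleEdgeSet δ → 0 ≤ α δ ∧ α δ ≤ 1)
    (S₁ S₂ : Finset V) (hS₁ : S₁.Nonempty) (hS₁₂ : S₁ ⊆ S₂) (hS₂ : S₂ ≠ Finset.univ)
    (γ : Finset (Sym2 V)) (hγ : IsCycleEdgeSet γ) (hγG : ↑γ ⊆ G.edgeSet)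
    (hγS₂ : ∀ e ∈ γ, ∀ v ∈ e, v ∉ S₂) :
    (∑ Γ ∈ Finset.univ.filter
        (fun Γ : Finset (Sym2 V) => IsEssentialCRSF G S₂ Γ ∧ γ ⊆ Γ), wt c hc_symm α Γ) /
      (∑ Γ ∈ Finset.univ.filter (IsEssentialCRSF G S₂), wt c hc_symm α Γ)
    ≤ (∑ Γ ∈ Finset.univ.filter
        (fun Γ : Finset (Sym2 V) => IsEssentialCRSF G S₁ Γ ∧ γ ⊆ Γ), wt c hc_symm α Γ) /
      (∑ Γ ∈ Finset.univ.filter (IsEssentialCRSF G S₁), wt c hc_symm α Γ) := by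
  have hc : ∀ v w, 0 ≤ c v w := by
    intro v w
    by_cases h : G.Adj v w
    · exact (hc_pos v w h).le
    · exact (hc_zero v w h).ge
  have hb0 : ∀ σ, 0 ≤ bet α σ := by
    intro σ
    unfold bet
    split_ifs with h
    · exact (hα _ h.2).1
    · exact le_rfl
  have hb1 : ∀ σ, bet α σ ≤ 1 := by
    intro σ
    unfold bet
    split_ifs with h
    · exact (hα _ h.2).2
    · exact zero_le_one
  have hcr := canon_rep hγ
  have hrs := rep_spec hγ
  have hden : ∀ S : Finset V, ∑ Γ ∈ Finset.univ.filter (IsEssentialCRSF G S), wt c hc_symm α Γ =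
      ZZ c (bet α) Sᶜ := by
    intro S
    rw [sum_crsf G c α hc_symm hc_zero S (IsEssentialCRSF G S) (fun _ => True) (fun _ h => h)
      (fun f hf => iff_of_true hf.crsf trivial), ZZ]
    simp
  have hsupp : ∀ v ∈ (rep γ).support, v ∉ S₂ := by
    intro v hv
    have := mem_edgesP hv
    rw [hrs.2.2] at this
    exact hγS₂ _ this v (Sym2.mem_mk_left _ _)
  have hnum : ∀ S : Finset V, S ⊆ S₂ → ∑ Γ ∈ Finset.univ.filter
      (fun Γ : Finset (Sym2 V) => IsEssentialCRSF G S Γ ∧ γ ⊆ Γ), wt c hc_symm α Γ =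
      (bet α (rep γ) * ∏ v ∈ (rep γ).support, c v (rep γ v)) *
        ZZ c (bet α) (Sᶜ \ (rep γ).support) := by
    intro S hS
    have e := sum_crsf G c α hc_symm hc_zero S (fun Γ => IsEssentialCRSF G S Γ ∧ γ ⊆ Γ)
      (fun f => rep γ ∈ cyc f) (fun _ h => h.1) (fun f hf => by
        rw [← hf.sub_iff hcr, hrs.2.2]
        exact ⟨fun h => h.2, fun h => ⟨hf.crsf, h⟩⟩)
    have e2 := sum_reset c (bet α) Sᶜ (rep γ) hrs.1 (fun v hv =>
      Finset.mem_compl.2 (fun h => hsupp v hv (hS h)))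
    rw [mul_assoc, ← e2, Finset.mul_sum]
    refine Eq.trans ?_ (e.trans ?_)
    · congr!
    · refine Finset.sum_congr (by congr!) (fun f hf => ?_)
      rw [Finset.mem_filter] at hf
      rw [← Finset.mul_prod_erase _ _ hf.2]
      ring
  obtain ⟨t, ht⟩ := hS₁
  have hpos : ∀ U ⊆ S₁ᶜ, 0 < ZZ c (bet α) U := fun U hU =>
    ZZ_pos G hG c hc hc_pos _ hb0 U t (fun h => Finset.mem_compl.1 (hU h) ht)
  have h21 : S₂ᶜ ⊆ S₁ᶜ := Finset.compl_subset_compl.2 hS₁₂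
  have hs2 : (rep γ).support ⊆ S₂ᶜ := fun v hv => Finset.mem_compl.2 (hsupp v hv)
  have key := ZZ_submod c hc (bet α) hb1 S₁ᶜ hpos _ (S₂ᶜ \ (rep γ).support)
    (S₁ᶜ \ (rep γ).support) (rep γ).support (Finset.sdiff_subset_sdiff h21 le_rfl)
    Finset.sdiff_disjoint
    (by rw [Finset.sdiff_union_of_subset (hs2.trans h21)]) le_rfl
  rw [Finset.sdiff_union_of_subset (hs2.trans h21), Finset.sdiff_union_of_subset hs2] at key
  rw [hnum S₂ subset_rfl, hnum S₁ hS₁₂]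
  have d1 := hden S₁
  have d2 := hden S₂
  rw [d1, d2, div_le_div_iff₀ (hpos _ h21) (hpos _ subset_rfl)]
  have hK : 0 ≤ bet α (rep γ) * ∏ v ∈ (rep γ).support, c v (rep γ v) :=
    mul_nonneg (hb0 _) (Finset.prod_nonneg fun _ _ => hc _ _)
  have := mul_le_mul_of_nonneg_left key hK
  linarith

end CRSFStmt
end
end

section
/- Let G = (V,E) be a finite connected graph with conductances c : E → ℝ_{>0}, and let Φ be a unitary connection such that for every simple cycle η of G the monodromy ω_η = e^{iθ_η} satisfies cos θ_η ≥ 0 (equivalently 2 − 2cos θ_η ≤ 2). Let S_1 ⊆ S_2 be nonempty proper subsets of V and let γ be a simple cycle of G whose vertex set W is disjoint from S_2. Then det(Δ_{Φ,S_1∪W}) · det(Δ_{Φ,S_2}) ≥ det(Δ_{Φ,S_2∪W}) · det(Δ_{Φ,S_1}), where for S ⊆ V the Dirichlet Laplacian Δ_{Φ,S} is the principal submatrix of the line-bundle Laplacian Δ_Φ with rows and columns indexed by V∖S (these determinants are positive reals since the Dirichlet Laplacians are Hermitian positive definite). -/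
/-!
STATEMENT 9.  For a unitary connection all of whose cycle monodromies `e^{iθ}` satisfy
`cos θ ≥ 0` (i.e. `2 − 2cos θ ≤ 2`), and boundaries `S₁ ⊆ S₂` and a simple cycle `γ`
with vertex set `W` disjoint from `S₂`,
`det(Δ_{Φ,S₁∪W}) · det(Δ_{Φ,S₂}) ≥ det(Δ_{Φ,S₂∪W}) · det(Δ_{Φ,S₁})`
(all these determinants being positive reals).
-/

open Classical

noncomputable section

namespace CRSFStmt

variable {V : Type*} [Fintype V] [DecidableEq V]

open scoped ComplexOrder in
theorem aux_schur {m : Type*} [Fintype m] [DecidableEq m]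
    (M : Matrix (m ⊕ Unit) (m ⊕ Unit) ℂ) (hM : M.PosDef) :
    ∃ s : ℝ, M.det = M.toBlocks₁₁.det * (s : ℂ) ∧
      (∀ x : m → ℂ, s ≤ (star (Sum.elim x (fun _ => 1)) ⬝ᵥ
        (M.mulVec (Sum.elim x (fun _ => 1)))).re) ∧
      ∃ x : m → ℂ, (star (Sum.elim x (fun _ => 1)) ⬝ᵥ
        (M.mulVec (Sum.elim x (fun _ => 1)))).re = s := by
  have hA : M.toBlocks₁₁.PosDef := hM.submatrix Sum.inl_injective
  have hMe : M = Matrix.fromBlocks M.toBlocks₁₁ M.toBlocks₁₂ M.toBlocks₁₂.conjTranspose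
      M.toBlocks₂₂ := by
    conv_lhs => rw [← Matrix.fromBlocks_toBlocks M]
    congr 1
    ext i j
    exact (hM.1.apply _ _).symm
  generalize hAe : M.toBlocks₁₁ = A at *
  generalize M.toBlocks₁₂ = B at *
  generalize M.toBlocks₂₂ = D at *
  let _ := hA.isUnit.invertible
  have hdet : M.det = A.det * (D - B.conjTranspose * A⁻¹ * B).det := by
    rw [hMe, Matrix.det_fromBlocks₁₁, Matrix.invOf_eq_nonsing_inv]
  have key : ∀ x : m → ℂ, (star (Sum.elim x (fun _ => 1)) ⬝ᵥ
        (M.mulVec (Sum.elim x (fun _ => 1)))) =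
      star (x + (A⁻¹ * B).mulVec (fun _ : Unit => 1)) ⬝ᵥ
        (A.mulVec (x + (A⁻¹ * B).mulVec (fun _ => 1))) +
      (D - B.conjTranspose * A⁻¹ * B).det := by
    intro x
    rw [hMe, Matrix.dotProduct_mulVec, Matrix.schur_complement_eq₁₁ B D x _ hA.1]
    simp only [Matrix.dotProduct_mulVec]
    congr 1
    simp [Matrix.det_unique, Matrix.vecMul, dotProduct]
  have hpos : 0 < M.det := hM.det_pos
  have hApos : 0 < A.det := hA.det_pos
  have him : (D - B.conjTranspose * A⁻¹ * B).det.im = 0 := by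
    have h1 := congrArg Complex.im hdet
    rw [Complex.mul_im, ← (Complex.lt_def.1 hpos).2, ← (Complex.lt_def.1 hApos).2] at h1
    have h2 := (Complex.lt_def.1 hApos).1
    simp only [Complex.zero_im, Complex.zero_re, zero_mul, add_zero] at h1 h2
    exact (mul_eq_zero.1 h1.symm).resolve_left h2.ne'
  refine ⟨(D - B.conjTranspose * A⁻¹ * B).det.re, ?_, ?_, ?_⟩
  · rw [hdet]
    congr 1
    exact Complex.ext (Complex.ofReal_re _).symm (by rw [him, Complex.ofReal_im])
  · intro x
    rw [key, Complex.add_re]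
    have := (Complex.le_def.1 (hA.posSemidef.dotProduct_mulVec_nonneg
      (x + (A⁻¹ * B).mulVec (fun _ : Unit => 1)))).1
    simp only [Complex.zero_re] at this
    linarith
  · refine ⟨-(A⁻¹ * B).mulVec (fun _ => 1), ?_⟩
    rw [key]
    simp

theorem aux_quad {n : Type*} [Fintype n] (A : Matrix V V ℂ) (g : n → V)
    (hg : Function.Injective g) (f : V → ℂ) (hf : ∀ v, v ∉ Set.range g → f v = 0) :
    star f ⬝ᵥ (A.mulVec f) =
      star (f ∘ g) ⬝ᵥ ((A.submatrix g g).mulVec (f ∘ g)) := by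
  have h2 : ∀ v, A.mulVec f v = ∑ j, A v (g j) * f (g j) := by
    intro v
    simp only [Matrix.mulVec, dotProduct]
    exact (Fintype.sum_of_injective g hg _ _ (fun i hi => by simp [hf i hi]) (fun _ => rfl)).symm
  simp only [dotProduct, h2]
  refine (Fintype.sum_of_injective g hg _ _ (fun i hi => by simp [hf i hi]) (fun _ => ?_)).symm
  simp [Matrix.mulVec, dotProduct]

def pdet (A : Matrix V V ℂ) (S : Finset V) : ℂ :=
  Matrix.det (n := {v : V // v ∉ S}) (A.submatrix (fun v => (v : V)) (fun v => (v : V)))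

open scoped ComplexOrder in
theorem aux_full (A : Matrix V V ℂ) (hA : A.PosDef) (S : Finset V) (w : V) (hw : w ∉ S) :
    ∃ s : ℝ, pdet A S = pdet A (insert w S) * (s : ℂ) ∧
      (∀ f : V → ℂ, f w = 1 → (∀ v ∈ S, f v = 0) → s ≤ (star f ⬝ᵥ (A.mulVec f)).re) ∧
      ∃ f : V → ℂ, f w = 1 ∧ (∀ v ∈ S, f v = 0) ∧ (star f ⬝ᵥ (A.mulVec f)).re = s := by
  let g : {v : V // v ∉ insert w S} ⊕ Unit → V := Sum.elim (fun v => v.1) (fun _ => w)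
  have hg : Function.Injective g := by
    rintro (⟨a, ha⟩ | a) (⟨b, hb⟩ | b) h
    · simp only [g, Sum.elim_inl] at h
      subst h; rfl
    · simp only [g, Sum.elim_inl, Sum.elim_inr] at h
      exact absurd (by simp [h]) ha
    · simp only [g, Sum.elim_inl, Sum.elim_inr] at h
      exact absurd (by simp [h]) hb
    · rfl
  have hgS : ∀ a, g a ∉ S := by
    rintro (⟨a, ha⟩ | a)
    · simp only [g, Sum.elim_inl]
      exact fun h => ha (Finset.mem_insert_of_mem h)
    · exact hw
  have hrange : ∀ v, v ∉ Set.range g → v ∈ S := by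
    intro v hv
    by_contra h
    apply hv
    by_cases hvw : v = w
    · exact ⟨Sum.inr (), hvw.symm⟩
    · exact ⟨Sum.inl ⟨v, by simp [hvw, h]⟩, rfl⟩
  let e : {v : V // v ∉ insert w S} ⊕ Unit ≃ {v : V // v ∉ S} :=
    Equiv.ofBijective (fun a => ⟨g a, hgS a⟩)
      ⟨fun a b h => hg (congrArg Subtype.val h), fun v => by
        by_contra h
        push Not at h
        exact v.2 (hrange v.1 (fun ⟨a, ha⟩ => h a (Subtype.ext ha)))⟩
  obtain ⟨s, h1, h2, x, h3⟩ := aux_schur (A.submatrix g g) (hA.submatrix hg)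
  have hd : pdet A S = (A.submatrix g g).det := by
    rw [pdet, ← Matrix.det_submatrix_equiv_self e]
    rfl
  refine ⟨s, ?_, ?_, ?_⟩
  · rw [hd, h1]
    rfl
  · intro f hfw hfS
    rw [aux_quad A g hg f (fun v hv => hfS v (hrange v hv))]
    have : f ∘ g = Sum.elim (fun v => f v.1) (fun _ => 1) := by
      ext (a | a)
      · rfl
      · exact hfw
    rw [this]
    exact h2 _
  · have hc : Function.extend g (Sum.elim x (fun _ => 1)) 0 ∘ g = Sum.elim x (fun _ => 1) :=
      funext fun a => hg.extend_apply _ _ a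
    have h0 : ∀ v ∈ S, Function.extend g (Sum.elim x (fun _ => 1)) 0 v = 0 := by
      intro v hv
      rw [Function.extend_apply']
      · rfl
      · rintro ⟨a, rfl⟩
        exact hgS a hv
    refine ⟨Function.extend g (Sum.elim x (fun _ => 1)) 0, ?_, h0, ?_⟩
    · exact congrFun hc (Sum.inr ())
    · rw [aux_quad A g hg _ (fun v hv => h0 v (hrange v hv)), hc]
      exact h3

open scoped ComplexOrder in
theorem pdet_pos (A : Matrix V V ℂ) (hA : A.PosDef) (S : Finset V) : 0 < pdet A S :=
  (hA.submatrix Subtype.val_injective).det_pos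

open scoped ComplexOrder in
theorem pdet_re_pos (A : Matrix V V ℂ) (hA : A.PosDef) (S : Finset V) : 0 < (pdet A S).re :=
  (Complex.lt_def.1 (pdet_pos A hA S)).1

open scoped ComplexOrder in
theorem aux_step (A : Matrix V V ℂ) (hA : A.PosDef) (S₁ S₂ : Finset V) (h : S₁ ⊆ S₂)
    (w : V) (hw : w ∉ S₂) :
    (pdet A (insert w S₂)).re * (pdet A S₁).re ≤
      (pdet A (insert w S₁)).re * (pdet A S₂).re := by
  obtain ⟨s, h1, h2, -⟩ := aux_full A hA S₁ w (fun hh => hw (h hh))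
  obtain ⟨t, k1, -, f, f1, f2, f3⟩ := aux_full A hA S₂ w hw
  have hst : s ≤ t := f3 ▸ h2 f f1 (fun v hv => f2 v (h hv))
  rw [h1, k1, Complex.re_mul_ofReal, Complex.re_mul_ofReal]
  have := mul_le_mul_of_nonneg_left hst
    (mul_pos (pdet_re_pos A hA (insert w S₁)) (pdet_re_pos A hA (insert w S₂))).le
  linarith

open scoped ComplexOrder in
theorem aux_kot (A : Matrix V V ℂ) (hA : A.PosDef) (S₁ S₂ : Finset V) (h : S₁ ⊆ S₂)
    (W : Finset V) (hW : ∀ v ∈ W, v ∉ S₂) :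
    (pdet A (S₂ ∪ W)).re * (pdet A S₁).re ≤
      (pdet A (S₁ ∪ W)).re * (pdet A S₂).re := by
  induction W using Finset.induction_on with
  | empty => simp [mul_comm]
  | insert w W hw ih =>
    have ih := ih (fun v hv => hW v (Finset.mem_insert_of_mem hv))
    have st := aux_step A hA (S₁ ∪ W) (S₂ ∪ W) (Finset.union_subset_union_left h) w
      (by simp [hw, hW w (Finset.mem_insert_self _ _)])
    rw [Finset.union_insert, Finset.union_insert]
    have p1 := pdet_re_pos A hA (S₁ ∪ W)
    have p2 := pdet_re_pos A hA (S₂ ∪ W)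
    have p3 := pdet_re_pos A hA S₁
    have p4 := pdet_re_pos A hA (insert w (S₁ ∪ W))
    have := mul_le_mul st ih (mul_pos p2 p3).le (by positivity)
    refine le_of_mul_le_mul_right ?_ (mul_pos p1 p2)
    linarith

open scoped ComplexOrder in
theorem aux_psd (A : Matrix V V ℂ) (hA : A.PosSemidef) (S₁ S₂ : Finset V) (h : S₁ ⊆ S₂)
    (W : Finset V) (hW : ∀ v ∈ W, v ∉ S₂) :
    (pdet A (S₂ ∪ W)).re * (pdet A S₁).re ≤
      (pdet A (S₁ ∪ W)).re * (pdet A S₂).re := by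
  have hcont : ∀ S : Finset V, Filter.Tendsto
      (fun t : ℝ => (pdet (A + (t : ℂ) • (1 : Matrix V V ℂ)) S).re)
      (nhdsWithin 0 (Set.Ioi 0)) (nhds (pdet A S).re) := by
    intro S
    have hc : Continuous (fun t : ℝ => (pdet (A + (t : ℂ) • (1 : Matrix V V ℂ)) S).re) := by
      unfold pdet
      refine Complex.continuous_re.comp (Continuous.matrix_det ?_)
      refine Continuous.matrix_submatrix ?_ _ _
      fun_prop
    have := (hc.tendsto 0).mono_left (nhdsWithin_le_nhds (s := Set.Ioi 0))
    simpa using this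
  refine le_of_tendsto_of_tendsto ((hcont _).mul (hcont _)) ((hcont _).mul (hcont _)) ?_
  filter_upwards [self_mem_nhdsWithin] with t ht
  refine aux_kot _ ?_ S₁ S₂ h W hW
  refine Matrix.PosDef.posSemidef_add hA (Matrix.PosDef.one.smul ?_)
  exact_mod_cast ht

open scoped ComplexOrder in
theorem lap_psd (G : SimpleGraph V) (c : V → V → ℝ) (φ : V → V → ℂ)
    (hc_symm : ∀ v w, c v w = c w v)
    (hc_pos : ∀ v w, G.Adj v w → 0 < c v w)
    (hc_zero : ∀ v w, ¬G.Adj v w → c v w = 0)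
    (hφ_unit : ∀ v w, G.Adj v w → ‖φ v w‖ = 1)
    (hφ_symm : ∀ v w, G.Adj v w → φ w v = starRingEnd ℂ (φ v w)) :
    (lineLaplacian c φ).PosSemidef := by
  have hcs : ∀ v w, (c v w : ℂ) * φ w v = starRingEnd ℂ ((c w v : ℂ) * φ v w) := by
    intro v w
    by_cases h : G.Adj v w
    · rw [hφ_symm v w h, map_mul, Complex.conj_ofReal, hc_symm]
    · rw [hc_symm w v, hc_zero v w h]; simp
  have hnn : ∀ v w, 0 ≤ c v w := by
    intro v w
    by_cases h : G.Adj v w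
    · exact (hc_pos v w h).le
    · exact (hc_zero v w h).ge
  have hd : ∀ v, c v v = 0 := fun v => hc_zero v v (G.irrefl)
  have hL : ∀ v w, lineLaplacian c φ v w =
      (if v = w then (∑ u, (c v u : ℂ)) else 0) - (c v w : ℂ) * φ w v := by
    intro v w
    simp only [lineLaplacian, Matrix.of_apply]
    by_cases h : v = w
    · subst h; simp [hd]
    · simp [h]
  refine Matrix.PosSemidef.of_dotProduct_mulVec_nonneg ?_ ?_
  · ext v w
    rw [Matrix.conjTranspose_apply, hL, hL, star_sub]
    congr 1
    · by_cases h : v = w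
      · subst h; simp
      · simp [h, Ne.symm h]
    · exact (hcs v w).symm
  · intro x
    have hq : star x ⬝ᵥ ((lineLaplacian c φ).mulVec x) =
        ∑ v, ∑ w, ((c v w : ℂ) * (starRingEnd ℂ (x v) * x v) -
          (c v w : ℂ) * φ w v * starRingEnd ℂ (x v) * x w) := by
      simp only [dotProduct, Matrix.mulVec, hL, sub_mul, Finset.sum_sub_distrib, mul_sub]
      congr 1
      · refine Finset.sum_congr rfl fun v _ => ?_
        simp [Finset.sum_mul, Finset.mul_sum]
        refine Finset.sum_congr rfl fun w _ => ?_
        ring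
      · refine Finset.sum_congr rfl fun v _ => ?_
        simp [Finset.mul_sum]
        refine Finset.sum_congr rfl fun w _ => ?_
        ring
    have hq2 : 2 * (star x ⬝ᵥ ((lineLaplacian c φ).mulVec x)) =
        ∑ v, ∑ w, (((c v w) * Complex.normSq (x v - φ w v * x w) : ℝ) : ℂ) := by
      rw [two_mul]
      nth_rewrite 2 [hq]
      rw [Finset.sum_comm, hq, ← Finset.sum_add_distrib]
      refine Finset.sum_congr rfl fun v _ => ?_
      rw [← Finset.sum_add_distrib]
      refine Finset.sum_congr rfl fun w _ => ?_
      by_cases h : G.Adj v w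
      · have hu : φ w v * starRingEnd ℂ (φ w v) = 1 := by
          rw [Complex.mul_conj, Complex.normSq_eq_norm_sq, hφ_unit w v h.symm]; simp
        rw [Complex.ofReal_mul, ← Complex.mul_conj, hc_symm w v, hφ_symm w v h.symm]
        simp only [map_sub, map_mul]
        linear_combination (-(c v w : ℂ) * x w * starRingEnd ℂ (x w)) * hu
      · have h' : ¬ G.Adj w v := fun k => h k.symm
        simp [hc_zero _ _ h, hc_zero _ _ h']
    have hn : 0 ≤ 2 * (star x ⬝ᵥ ((lineLaplacian c φ).mulVec x)) := by
      rw [hq2]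
      refine Finset.sum_nonneg fun v _ => Finset.sum_nonneg fun w _ => ?_
      exact_mod_cast mul_nonneg (hnn v w) (Complex.normSq_nonneg _)
    rw [Complex.le_def] at hn ⊢
    simpa [eq_comm] using hn

open scoped ComplexOrder in
theorem psd_im (A : Matrix V V ℂ) (hA : A.PosSemidef) (S : Finset V) : (pdet A S).im = 0 :=
  ((Complex.le_def.1 (hA.submatrix (fun v : {v : V // v ∉ S} => (v : V))).det_nonneg).2).symm

theorem dirichlet_det_inequality
    (G : SimpleGraph V) (hG : G.Connected)
    (c : V → V → ℝ) (φ : V → V → ℂ)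
    (hc_symm : ∀ v w, c v w = c w v)
    (hc_pos : ∀ v w, G.Adj v w → 0 < c v w)
    (hc_zero : ∀ v w, ¬G.Adj v w → c v w = 0)
    (hφ_unit : ∀ v w, G.Adj v w → ‖φ v w‖ = 1)
    (hφ_symm : ∀ v w, G.Adj v w → φ w v = starRingEnd ℂ (φ v w))
    -- every simple cycle `η` of `G` has `2 − 2cos θ_η ≤ 2`, i.e. `cos θ_η ≥ 0`
    (hmon : ∀ δ : Finset (Sym2 V), IsCycleEdgeSet δ → ↑δ ⊆ G.edgeSet →
      (cycleWeight φ δ).re ≤ 2)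
    (S₁ S₂ : Finset V) (hS₁ : S₁.Nonempty) (hS₁₂ : S₁ ⊆ S₂) (hS₂ : S₂ ≠ Finset.univ)
    (γ : Finset (Sym2 V)) (hγ : IsCycleEdgeSet γ) (hγG : ↑γ ⊆ G.edgeSet)
    (W : Finset V) (hW : ∀ v, v ∈ W ↔ ∃ e ∈ γ, v ∈ e)
    (hWS₂ : ∀ v ∈ W, v ∉ S₂) :
    (dirichletDet c φ (S₁ ∪ W) * dirichletDet c φ S₂).im = 0 ∧
    (dirichletDet c φ (S₂ ∪ W) * dirichletDet c φ S₁).im = 0 ∧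
    (dirichletDet c φ (S₂ ∪ W) * dirichletDet c φ S₁).re ≤
      (dirichletDet c φ (S₁ ∪ W) * dirichletDet c φ S₂).re := by
  have hP := lap_psd G c φ hc_symm hc_pos hc_zero hφ_unit hφ_symm
  have him : ∀ S : Finset V, (dirichletDet c φ S).im = 0 := fun S => psd_im _ hP S
  have := aux_psd _ hP S₁ S₂ hS₁₂ W hWS₂
  refine ⟨by simp [Complex.mul_im, him], by simp [Complex.mul_im, him], ?_⟩
  rw [Complex.mul_re, Complex.mul_re, him, him, him, him]
  simpa [pdet, dirichletDet] using this

end CRSFStmt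
end
end

section
/- Let m ≥ 1 and α > 0 be real, and let M be the m×m real tridiagonal matrix with diagonal entries M_{ii} = 2cosh α, entries M_{i,i+1} = M_{i+1,i} = −1, and 0 elsewhere. Then M is invertible and for all 1 ≤ j ≤ i ≤ m, (M^{-1})_{ij} = (M^{-1})_{ji} = sinh(jα)·sinh((m+1−i)α) / (sinh(α)·sinh((m+1)α)). -/
/-!
STATEMENT 12.  The `m×m` tridiagonal matrix `M` with diagonal `2cosh α` and `−1` on the
sub- and super-diagonal is invertible, and (with rows/columns indexed by `1,…,m`,
encoded here by `i : Fin m ↦ i+1`) for `1 ≤ j ≤ i ≤ m`,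
`(M⁻¹)_{ij} = (M⁻¹)_{ji} = sinh(jα) sinh((m+1−i)α) / (sinh α · sinh((m+1)α))`.
-/

/-- Green function of the path, with indices shifted to `0, …, m+1`. -/
noncomputable def greenFn (m : ℕ) (α : ℝ) (p q : ℕ) : ℝ :=
  if p ≤ q then Real.sinh (p * α) * Real.sinh (((m : ℝ) + 1 - q) * α) /
      (Real.sinh α * Real.sinh ((m + 1) * α))
  else Real.sinh (q * α) * Real.sinh (((m : ℝ) + 1 - p) * α) /
      (Real.sinh α * Real.sinh ((m + 1) * α))

theorem row_sum_aux (m : ℕ) (c : ℝ) (f : ℕ → ℝ) (h0 : f 0 = 0) (h1 : f (m + 1) = 0)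
    (i : Fin m) :
    ∑ k : Fin m, ((if i = k then c else 0)
        - (if (i : ℕ) = (k : ℕ) + 1 ∨ (k : ℕ) = (i : ℕ) + 1 then (1 : ℝ) else 0)) * f (k + 1)
      = c * f (i + 1) - f i - f (i + 2) := by
  have e : ∀ k : Fin m, ((if i = k then c else 0)
        - (if (i : ℕ) = (k : ℕ) + 1 ∨ (k : ℕ) = (i : ℕ) + 1 then (1 : ℝ) else 0)) * f (k + 1)
      = (if i = k then c * f (k + 1) else 0)
        - ((if (i : ℕ) = (k : ℕ) + 1 then f (k + 1) else 0)
        + (if (i : ℕ) + 1 = (k : ℕ) then f (k + 1) else 0)) := by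
    intro k
    split_ifs <;> first | omega | ring
  rw [Finset.sum_congr rfl fun k _ => e k, Finset.sum_sub_distrib, Finset.sum_add_distrib,
    Finset.sum_ite_eq,
    Fin.sum_univ_eq_sum_range (fun k => if (i : ℕ) = k + 1 then f (k + 1) else 0) m,
    Fin.sum_univ_eq_sum_range (fun k => if (i : ℕ) + 1 = k then f (k + 1) else 0) m,
    Finset.sum_ite_eq]
  have hi := i.isLt
  have e1 : ∑ k ∈ Finset.range m, (if (i : ℕ) = k + 1 then f (k + 1) else 0) = f i := by
    rcases hn : (i : ℕ) with _ | n
    · simp [h0]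
    · simp only [Nat.add_right_cancel_iff, Finset.sum_ite_eq, Finset.mem_range]
      rw [if_pos (by omega)]
  have e2 : (if (i : ℕ) + 1 ∈ Finset.range m then f ((i : ℕ) + 1 + 1) else 0) = f (i + 2) := by
    by_cases h : (i : ℕ) + 1 < m
    · simp [h]
    · have : (i : ℕ) + 2 = m + 1 := by omega
      simp [h, this, h1]
  rw [e1, e2]
  simp
  ring

theorem green_rec (m : ℕ) (α : ℝ) (hα : 0 < α) (p i : ℕ) :
    2 * Real.cosh α * greenFn m α p (i + 1) - greenFn m α p i - greenFn m α p (i + 2)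
      = if i + 1 = p then 1 else 0 := by
  have hs : Real.sinh α ≠ 0 := (Real.sinh_pos_iff.2 hα).ne'
  have hs2 : Real.sinh ((m + 1) * α) ≠ 0 := (Real.sinh_pos_iff.2 (by positivity)).ne'
  unfold greenFn
  rcases lt_trichotomy (i + 1) p with h | h | h
  · have key : (if p ≤ i + 2 then Real.sinh (p * α) * Real.sinh (((m : ℝ) + 1 - (i + 2 : ℕ)) * α) /
        (Real.sinh α * Real.sinh ((m + 1) * α))
      else Real.sinh ((i + 2 : ℕ) * α) * Real.sinh (((m : ℝ) + 1 - p) * α) /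
        (Real.sinh α * Real.sinh ((m + 1) * α))) =
        Real.sinh ((i + 2 : ℕ) * α) * Real.sinh (((m : ℝ) + 1 - p) * α) /
        (Real.sinh α * Real.sinh ((m + 1) * α)) := by
      split_ifs with h'
      · obtain rfl : p = i + 2 := by omega
        rfl
      · rfl
    rw [key, if_neg (by omega), if_neg (by omega), if_neg (by omega)]
    have a1 : ((i + 2 : ℕ) : ℝ) * α = ((i + 1 : ℕ) : ℝ) * α + α := by push_cast; ring
    have a2 : (i : ℝ) * α = ((i + 1 : ℕ) : ℝ) * α - α := by push_cast; ring
    rw [a1, a2, Real.sinh_add, Real.sinh_sub]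
    ring
  · subst h
    rw [if_pos le_rfl, if_neg (by omega), if_pos (by omega), if_pos rfl]
    have a2 : (i : ℝ) * α = ((i + 1 : ℕ) : ℝ) * α - α := by push_cast; ring
    have a3 : ((m : ℝ) + 1 - (i + 2 : ℕ)) * α = ((m : ℝ) + 1 - (i + 1 : ℕ)) * α - α := by
      push_cast; ring
    have a4 : ((m : ℝ) + 1) * α = ((i + 1 : ℕ) : ℝ) * α + ((m : ℝ) + 1 - (i + 1 : ℕ)) * α := by
      ring
    rw [a4] at hs2
    rw [a2, a3, a4, Real.sinh_sub, Real.sinh_sub]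
    rw [← mul_div_assoc, ← sub_div, ← sub_div, div_eq_one_iff_eq (mul_ne_zero hs hs2),
      Real.sinh_add]
    ring
  · rw [if_pos (by omega), if_pos (by omega), if_pos (by omega), if_neg (by omega)]
    have a3 : ((m : ℝ) + 1 - (i + 2 : ℕ)) * α = ((m : ℝ) + 1 - (i + 1 : ℕ)) * α - α := by
      push_cast; ring
    have a4 : ((m : ℝ) + 1 - (i : ℕ)) * α = ((m : ℝ) + 1 - (i + 1 : ℕ)) * α + α := by
      push_cast; ring
    rw [a3, a4, Real.sinh_add, Real.sinh_sub]
    ring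

theorem tridiagonal_cosh_inverse (m : ℕ) (hm : 1 ≤ m) (α : ℝ) (hα : 0 < α)
    (M : Matrix (Fin m) (Fin m) ℝ)
    (hM : M = Matrix.of fun (i j : Fin m) =>
      (if i = j then 2 * Real.cosh α else 0)
        - (if (i : ℕ) = (j : ℕ) + 1 ∨ (j : ℕ) = (i : ℕ) + 1 then 1 else 0)) :
    IsUnit M.det ∧
    ∀ i j : Fin m, (j : ℕ) ≤ (i : ℕ) →
      M⁻¹ i j = Real.sinh (((j : ℕ) + 1) * α) * Real.sinh (((m - (i : ℕ) : ℕ) : ℝ) * α) /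
          (Real.sinh α * Real.sinh ((m + 1) * α)) ∧
      M⁻¹ j i = Real.sinh (((j : ℕ) + 1) * α) * Real.sinh (((m - (i : ℕ) : ℕ) : ℝ) * α) /
          (Real.sinh α * Real.sinh ((m + 1) * α)) := by
  have hmul : M * (Matrix.of fun k j : Fin m => greenFn m α (j + 1) (k + 1)) = 1 := by
    ext i j
    rw [Matrix.mul_apply, hM]
    simp only [Matrix.of_apply]
    rw [row_sum_aux m _ (fun q => greenFn m α (j + 1) q) (by simp [greenFn])
      (by have := j.isLt; simp [greenFn, this.le]) i]
    rw [green_rec m α hα, Matrix.one_apply]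
    simp [Fin.ext_iff]
  refine ⟨Matrix.isUnit_det_of_right_inverse hmul, ?_⟩
  rw [Matrix.inv_eq_right_inv hmul]
  intro i j hij
  have hi := i.isLt
  have e : ((m - (i : ℕ) : ℕ) : ℝ) = (m : ℝ) + 1 - ((i : ℕ) + 1 : ℕ) := by
    rw [Nat.cast_sub hi.le]; push_cast; ring
  rw [e]
  simp only [Matrix.of_apply, greenFn]
  constructor
  · rw [if_pos (by omega)]
    push_cast
    rfl
  · split_ifs with h
    · have hh : (i : ℕ) = j := by omega
      rw [hh]
      push_cast
      rfl
    · push_cast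
      rfl
end
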